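/- arXiv:0710.5856 — 2 statements merged into one kernel-verified Lean document; each statement's English description precedes it below -/
import Mathlib

section
/- If the eigenvalues of the N×N matrix Z^d (with diagonal entries a_i and off-diagonal entries Q_i/(Q_j - Q_i)), where Q_1,...,Q_N are distinct nonzero real numbers, are real numbers z_1,...,z_N satisfying |z_i - z_j| ≥ 1 for all i ≠ j, then a_1,...,a_N are all real. -/
open Matrix Polynomial

namespace CM

abbrev Mat (N : ℕ) := Matrix (Equiv.Perm (Fin N)) (Equiv.Perm (Fin N)) ℂ

variable {N : ℕ}

def Sg (g : Equiv.Perm (Fin N)) : Mat N := Matrix.of fun σ τ => if τ = σ * g then 1 else 0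

lemma Sg_mulVec (g : Equiv.Perm (Fin N)) (v : Equiv.Perm (Fin N) → ℂ) :
    Sg g *ᵥ v = fun σ => v (σ * g) := by
  ext σ; simp [Sg, Matrix.mulVec, dotProduct]

lemma Sg_mul (g h : Equiv.Perm (Fin N)) : Sg g * Sg h = Sg (g * h) := by
  apply Matrix.ext_of_mulVec_single
  intro i
  rw [← Matrix.mulVec_mulVec]
  simp only [Sg_mulVec, mul_assoc]

lemma Sg_one : Sg (1 : Equiv.Perm (Fin N)) = 1 := by
  apply Matrix.ext_of_mulVec_single
  intro i
  rw [Sg_mulVec]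
  simp only [mul_one, one_mulVec]

lemma Sg_diag (g : Equiv.Perm (Fin N)) (f : Equiv.Perm (Fin N) → ℂ) :
    Sg g * diagonal f = diagonal (fun σ => f (σ * g)) * Sg g := by
  apply Matrix.ext_of_mulVec_single
  intro i
  rw [← Matrix.mulVec_mulVec, ← Matrix.mulVec_mulVec]
  rw [Sg_mulVec, Sg_mulVec]
  ext σ
  simp only [Matrix.mulVec_diagonal]

lemma Sg_conj (g : Equiv.Perm (Fin N)) : (Sg g)ᴴ = Sg g⁻¹ := by
  ext σ τ
  simp only [Sg, conjTranspose_apply, of_apply]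
  have : (σ = τ * g) ↔ (τ = σ * g⁻¹) := by
    constructor <;> rintro rfl <;> simp
  simp only [this]
  split_ifs <;> simp

/-- transposition of places -/
def sw (a b : Fin N) : Mat N := Sg (Equiv.swap a b)

lemma sw_comm (a b : Fin N) : sw a b = sw b a := by simp [sw, Equiv.swap_comm]

lemma sw_sq (a b : Fin N) : sw a b * sw a b = 1 := by
  simp [sw, Sg_mul, Sg_one]

lemma sw_conj (a b : Fin N) : (sw a b)ᴴ = sw a b := by
  simp [sw, Sg_conj]

lemma Sg_sw (g : Equiv.Perm (Fin N)) (a b : Fin N) : Sg g * sw a b = sw (g a) (g b) * Sg g := by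
  simp only [sw, Sg_mul]
  congr 1
  rw [Equiv.swap_apply_apply]; group

lemma sw_sw_of_ne {a b c d : Fin N} (h1 : a ≠ c) (h2 : a ≠ d) (h3 : b ≠ c) (h4 : b ≠ d) :
    sw a b * sw c d = sw c d * sw a b := by
  conv_lhs => rw [sw, Sg_sw]
  rw [Equiv.swap_apply_of_ne_of_ne h1.symm h3.symm, Equiv.swap_apply_of_ne_of_ne h2.symm h4.symm]
  rfl

lemma sw3 {a b c : Fin N} (hac : a ≠ c) (hbc : b ≠ c) :
    sw a b * sw a c = sw b c * sw a b := by
  conv_lhs => rw [sw, Sg_sw]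
  rw [Equiv.swap_apply_left, Equiv.swap_apply_of_ne_of_ne hac.symm hbc.symm]
  rfl

/-- projector -/
def E (i m : Fin N) : Mat N := diagonal fun σ => if σ m = i then 1 else 0

lemma Sg_E (g : Equiv.Perm (Fin N)) (i m : Fin N) : Sg g * E i m = E i (g m) * Sg g := by
  rw [E, Sg_diag]; rfl

lemma sw_E_left (i a b : Fin N) : sw a b * E i a = E i b * sw a b := by
  simp [sw, Sg_E]

lemma sw_E_right (i a b : Fin N) : sw a b * E i b = E i a * sw a b := by
  simp [sw, Sg_E]

lemma E_conj (i m : Fin N) : (E i m)ᴴ = E i m := by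
  rw [E, diagonal_conjTranspose]
  congr 1; ext σ; simp only [Pi.star_apply]; split_ifs <;> simp

lemma E_sum (i : Fin N) : ∑ m, E i m = 1 := by
  ext σ τ
  rw [Matrix.sum_apply]
  by_cases h : σ = τ
  · subst h
    simp only [E, diagonal_apply_eq, one_apply_eq]
    rw [Finset.sum_eq_single (σ.symm i)]
    · simp
    · intro b _ hb
      rw [if_neg]
      rintro rfl; simp at hb
    · simp
  · simp [E, h]

/-- pair sums along a list -/
def Pair (i : Fin N) : List (Fin N) → Mat N
  | [] => 0
  | p :: l => (l.map fun m => E i m * sw m p).sum + Pair i l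

lemma list_sum_mul_left (l : List (Fin N)) (f : Fin N → Mat N) (B : Mat N) :
    B * (l.map f).sum = (l.map fun m => B * f m).sum := by
  rw [List.sum_map_mul_left]

lemma Sg_Pair (g : Equiv.Perm (Fin N)) (i : Fin N) (l : List (Fin N)) :
    Sg g * Pair i l = Pair i (l.map g) * Sg g := by
  induction l with
  | nil => simp [Pair]
  | cons p l ih =>
    simp only [Pair, List.map_cons, List.map_map, mul_add, add_mul, ih]
    congr 1
    rw [← List.sum_map_mul_left, ← List.sum_map_mul_right]
    congr 1
    apply List.map_congr_left
    intro m _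
    simp only [Function.comp]
    rw [← mul_assoc, Sg_E, mul_assoc, Sg_sw, mul_assoc]

lemma Pair_append_single (i p : Fin N) (l : List (Fin N)) :
    Pair i (l ++ [p]) = Pair i l + (l.map fun m => E i p * sw p m).sum := by
  induction l with
  | nil => simp [Pair]
  | cons q l ih =>
    simp only [List.cons_append, Pair, ih, List.map_append, List.sum_append, List.map_cons,
      List.map_nil, List.sum_cons, List.sum_nil, add_zero]
    abel

lemma Pair_conj (i : Fin N) (l : List (Fin N)) : (Pair i l)ᴴ = Pair i l.reverse := by
  induction l with
  | nil => simp [Pair]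
  | cons p l ih =>
    rw [List.reverse_cons, Pair_append_single, ← ih, Pair, conjTranspose_add, add_comm]
    congr 1
    rw [List.map_reverse, List.sum_reverse, conjTranspose_list_sum, List.map_map]
    congr 1
    apply List.map_congr_left
    intro m _
    simp only [Function.comp]
    rw [conjTranspose_mul, sw_conj, E_conj, sw_E_left, sw_comm]

lemma Pair_swap (i a b : Fin N) (l k : List (Fin N)) :
    Pair i (l ++ b :: a :: k) + E i b * sw a b = Pair i (l ++ a :: b :: k) + E i a * sw a b := by
  induction l with
  | nil =>
    simp only [List.nil_append, Pair, List.map_cons, List.sum_cons, sw_comm b a]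
    abel
  | cons q l ih =>
    simp only [List.cons_append, Pair]
    rw [add_assoc, ih, ← add_assoc]
    congr 2
    apply List.Perm.sum_eq
    apply List.Perm.map
    apply List.Perm.append_left
    exact List.Perm.swap _ _ _

lemma sw_Pair (i a b : Fin N) (l k : List (Fin N)) (h : (l ++ a :: b :: k).Nodup) :
    sw a b * Pair i (l ++ a :: b :: k) = Pair i (l ++ b :: a :: k) * sw a b := by
  rw [sw, Sg_Pair]
  congr 2
  have h1 : ∀ m ∈ l, Equiv.swap a b m = m := by
    intro m hm
    rw [List.nodup_append] at h
    apply Equiv.swap_apply_of_ne_of_ne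
    · exact h.2.2 m hm a (by simp)
    · exact h.2.2 m hm b (by simp)
  have h2 : ∀ m ∈ k, Equiv.swap a b m = m := by
    intro m hm
    rw [List.nodup_append] at h
    have := h.2.1
    simp only [List.nodup_cons, List.mem_cons, not_or] at this
    apply Equiv.swap_apply_of_ne_of_ne
    · rintro rfl; exact this.1.2 hm
    · rintro rfl; exact this.2.1 hm
  rw [List.map_append, List.map_cons, List.map_cons, Equiv.swap_apply_left, Equiv.swap_apply_right]
  congr 1
  · conv_rhs => rw [← List.map_id l]
    exact List.map_congr_left h1
  · congr 2
    conv_rhs => rw [← List.map_id k]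
    exact List.map_congr_left h2

/-- the R-matrix -/
def R (w : Fin N → Fin N → ℝ) (a b : Fin N) : Mat N := 1 + (w a b : ℂ) • sw a b

def A (w : Fin N → Fin N → ℝ) (a : Fin N) : List (Fin N) → Mat N
  | [] => 1
  | b :: l => R w a b * A w a l

def F (w : Fin N → Fin N → ℝ) : List (Fin N) → Mat N
  | [] => 1
  | a :: l => A w a l * F w l

lemma R_conj (w : Fin N → Fin N → ℝ) (a b : Fin N) : (R w a b)ᴴ = R w a b := by
  simp [R, sw_conj]

lemma R_comm (w : Fin N → Fin N → ℝ) {a b c d : Fin N}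
    (h1 : a ≠ c) (h2 : a ≠ d) (h3 : b ≠ c) (h4 : b ≠ d) :
    Commute (R w a b) (R w c d) := by
  have : Commute (sw a b) (sw c d) := sw_sw_of_ne h1 h2 h3 h4
  unfold R
  exact ((Commute.one_left _).add_left (((Commute.one_right _).add_right (this.smul_right _)).smul_left _))

lemma YBE (w : Fin N → Fin N → ℝ) {a b c : Fin N} (hab : a ≠ b) (hac : a ≠ c) (hbc : b ≠ c)
    (hw : w a c * (w a b + w b c) = w a b * w b c) :
    R w a b * R w a c * R w b c = R w b c * R w a c * R w a b := by
  have e1 : sw a b * sw a c = sw b c * sw a b := sw3 hac hbc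
  have e2 : sw a c * sw b c = sw b c * sw a b := by
    have := sw3 (a := c) (b := b) (c := a) hac.symm hab.symm
    rw [sw_comm c b, sw_comm c a, sw_comm b a] at this
    have h2 := sw3 (a := c) (b := a) (c := b) hbc.symm hab
    rw [sw_comm c b, sw_comm c a] at h2
    rw [h2, e1]
  have e3 : sw a c * sw a b = sw b c * sw a c := by
    have := sw3 (a := a) (b := c) (c := b) hab hbc.symm
    rwa [sw_comm c b] at this
  have e4 : sw a b * sw b c = sw b c * sw a c := by
    have := sw3 (a := b) (b := a) (c := c) hbc hac
    rw [sw_comm b a] at this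
    rw [this, e3]
  have e5 : sw a b * sw a c * sw b c = sw b c * sw a c * sw a b := by
    rw [mul_assoc, mul_assoc, e2, e3, e1.symm, ← mul_assoc, ← mul_assoc, sw_sq, sw_sq]
  have hw' : (w a c : ℂ) * (w a b + w b c) = w a b * w b c := by exact_mod_cast hw
  have key : (R w a b * R w a c * R w b c) - (R w b c * R w a c * R w a b) =
      ((w a c : ℂ) * (w a b + w b c) - w a b * w b c) • (sw b c * sw a b) -
      ((w a c : ℂ) * (w a b + w b c) - w a b * w b c) • (sw b c * sw a c) := by
    have e5' := e5
    simp only [mul_assoc] at e5'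
    simp only [R, add_mul, mul_add, one_mul, mul_one, smul_mul_assoc, mul_smul_comm,
      mul_assoc, e1, e2, e3, e4]
    have e6 : sw b c * (sw a c * sw a b) = sw a b * (sw b c * sw a b) := by
      rw [← mul_assoc (sw a b), e4, mul_assoc]
    rw [← e3, e6]
    module
  rw [hw', sub_self, zero_smul, zero_smul, sub_zero, sub_eq_zero] at key
  exact key

end CM

namespace CM
variable {N : ℕ}

lemma R_comm_A (w : Fin N → Fin N → ℝ) {a b c : Fin N} (l : List (Fin N))
    (h1 : a ≠ b) (h2 : a ≠ c) (hb : b ∉ l) (hc : c ∉ l) :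
    Commute (R w b c) (A w a l) := by
  induction l with
  | nil => exact Commute.one_right _
  | cons d l ih =>
    simp only [List.mem_cons, not_or] at hb hc
    exact (R_comm w h1.symm hb.1 h2.symm hc.1).mul_right (ih hb.2 hc.2)

lemma R_comm_F (w : Fin N → Fin N → ℝ) {b c : Fin N} (l : List (Fin N))
    (hb : b ∉ l) (hc : c ∉ l) :
    Commute (R w b c) (F w l) := by
  induction l with
  | nil => exact Commute.one_right _
  | cons d l ih =>
    simp only [List.mem_cons, not_or] at hb hc
    exact (R_comm_A w l (Ne.symm hb.1) (Ne.symm hc.1) hb.2 hc.2).mul_right (ih hb.2 hc.2)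

def IsYB (w : Fin N → Fin N → ℝ) : Prop := ∀ a b c, a ≠ b → a ≠ c → b ≠ c →
  w a c * (w a b + w b c) = w a b * w b c

lemma RAA (w : Fin N → Fin N → ℝ) (hw : IsYB w) {a b : Fin N} (hab : a ≠ b) (l : List (Fin N))
    (ha : a ∉ l) (hb : b ∉ l) (hl : l.Nodup) :
    R w a b * (A w a l * A w b l) = A w b l * A w a l * R w a b := by
  induction l with
  | nil => simp [A]
  | cons c l ih =>
    simp only [List.mem_cons, not_or] at ha hb
    rw [List.nodup_cons] at hl
    have c1 : Commute (R w b c) (A w a l) := R_comm_A w l hab ha.1 hb.2 hl.1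
    have c2 : Commute (R w a c) (A w b l) := R_comm_A w l hab.symm hb.1 ha.2 hl.1
    simp only [A]
    calc R w a b * (R w a c * A w a l * (R w b c * A w b l))
        = R w a b * R w a c * (A w a l * R w b c) * A w b l := by simp only [mul_assoc]
      _ = (R w a b * R w a c * R w b c) * (A w a l * A w b l) := by
          rw [← c1.eq]; simp only [mul_assoc]
      _ = R w b c * R w a c * (R w a b * (A w a l * A w b l)) := by
          rw [YBE w hab ha.1 hb.1 (hw a b c hab ha.1 hb.1)]; simp only [mul_assoc]
      _ = R w b c * (R w a c * A w b l) * A w a l * R w a b := by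
          rw [ih ha.2 hb.2 hl.2]; simp only [mul_assoc]
      _ = _ := by rw [c2.eq]; simp only [mul_assoc]

lemma A_append (w : Fin N → Fin N → ℝ) (a : Fin N) (l k : List (Fin N)) :
    A w a (l ++ k) = A w a l * A w a k := by
  induction l with
  | nil => simp [A]
  | cons c l ih => simp [A, ih, mul_assoc]

lemma A_conj (w : Fin N → Fin N → ℝ) (a : Fin N) (l : List (Fin N)) :
    (A w a l)ᴴ = A w a l.reverse := by
  induction l with
  | nil => simp [A]
  | cons c l ih => simp [A, A_append, ih, R_conj]

lemma AF (w : Fin N → Fin N → ℝ) (hw : IsYB w) {a : Fin N} (l : List (Fin N))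
    (ha : a ∉ l) (hl : l.Nodup) : A w a l * F w l = F w l * A w a l.reverse := by
  induction l with
  | nil => simp [A, F]
  | cons b l ih =>
    simp only [List.mem_cons, not_or] at ha
    rw [List.nodup_cons] at hl
    rw [List.reverse_cons, A_append]
    simp only [A, F, mul_one]
    calc R w a b * A w a l * (A w b l * F w l)
        = (R w a b * (A w a l * A w b l)) * F w l := by simp only [mul_assoc]
      _ = A w b l * A w a l * (R w a b * F w l) := by
          rw [RAA w hw ha.1 l ha.2 hl.1 hl.2]; simp only [mul_assoc]
      _ = A w b l * (A w a l * F w l) * R w a b := by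
          rw [(R_comm_F w l ha.2 hl.1).eq]; simp only [mul_assoc]
      _ = _ := by rw [ih ha.2 hl.2]; simp only [mul_assoc]

lemma F_conj (w : Fin N → Fin N → ℝ) (hw : IsYB w) (l : List (Fin N)) (hl : l.Nodup) :
    (F w l)ᴴ = F w l := by
  induction l with
  | nil => simp [F]
  | cons a l ih =>
    rw [List.nodup_cons] at hl
    rw [F, conjTranspose_mul, ih hl.2, A_conj, AF w hw l hl.1 hl.2]

lemma R_det (w : Fin N → Fin N → ℝ) (a b : Fin N) (h : |w a b| < 1) : IsUnit (R w a b) := by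
  have h2 : (1 - (w a b : ℂ)^2) ≠ 0 := by
    intro h3
    have : 1 - (w a b)^2 = 0 := by exact_mod_cast h3
    have := (sq_lt_one_iff_abs_lt_one (w a b)).2 h
    linarith
  have e : R w a b * (1 - (w a b : ℂ) • sw a b) = (1 - (w a b : ℂ)^2) • 1 := by
    simp only [R, add_mul, mul_sub, one_mul, mul_one, smul_mul_assoc, mul_smul_comm, sw_sq]
    module
  apply IsUnit.of_mul_eq_one ((1 - (w a b : ℂ)^2)⁻¹ • (1 - (w a b : ℂ) • sw a b))
  rw [mul_smul_comm, e, smul_smul, inv_mul_cancel₀ h2, one_smul]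

lemma A_unit (w : Fin N → Fin N → ℝ) (a : Fin N) (l : List (Fin N)) (ha : a ∉ l)
    (h : ∀ a b, a ≠ b → |w a b| < 1) : IsUnit (A w a l) := by
  induction l with
  | nil => exact isUnit_one
  | cons c l ih =>
    simp only [List.mem_cons, not_or] at ha
    exact (R_det w a c (h a c ha.1)).mul (ih ha.2)

lemma F_unit (w : Fin N → Fin N → ℝ) (l : List (Fin N)) (hl : l.Nodup)
    (h : ∀ a b, a ≠ b → |w a b| < 1) : IsUnit (F w l) := by
  induction l with
  | nil => exact isUnit_one
  | cons c l ih =>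
    rw [List.nodup_cons] at hl
    exact (A_unit w c l hl.1 h).mul (ih hl.2)

/-- diagonal part -/
def Dz (z : Fin N → ℝ) (i : Fin N) : Mat N := ∑ m, (z m : ℂ) • E i m

noncomputable def wz (z : Fin N → ℝ) (t : ℝ) (a b : Fin N) : ℝ := t / (z a - z b)

lemma sw_Dz (z : Fin N → ℝ) (i a b : Fin N) (hab : a ≠ b) :
    sw a b * Dz z i - Dz z i * sw a b = ((z a : ℂ) - z b) • ((E i b - E i a) * sw a b) := by
  have h1 : sw a b * Dz z i = (∑ m, (z (Equiv.swap a b m) : ℂ) • E i m) * sw a b := by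
    simp only [Dz, Finset.mul_sum, Finset.sum_mul, mul_smul_comm, smul_mul_assoc]
    rw [← Equiv.sum_comp (Equiv.swap a b)]
    apply Finset.sum_congr rfl
    intro m _
    rw [sw, Sg_E, Equiv.swap_apply_self]
  rw [h1, Dz, ← sub_mul, ← Finset.sum_sub_distrib, ← smul_mul_assoc]
  congr 1
  simp only [← sub_smul]
  rw [← Finset.add_sum_erase _ _ (Finset.mem_univ a),
    ← Finset.add_sum_erase _ _ (Finset.mem_erase.2 ⟨hab.symm, Finset.mem_univ b⟩),
    Finset.sum_eq_zero]
  · simp only [Equiv.swap_apply_left, Equiv.swap_apply_right]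
    module
  · intro m hm
    simp only [Finset.mem_erase] at hm
    rw [Equiv.swap_apply_of_ne_of_ne hm.2.1 hm.1, sub_self, zero_smul]

def G (z : Fin N → ℝ) (K : Mat N) (i : Fin N) (l : List (Fin N)) : Mat N :=
  Dz z i - Pair i l + K

lemma R_G (z : Fin N → ℝ) (hz : Function.Injective z) (K : Mat N)
    (hK : ∀ g, Commute (Sg g) K) (i a b : Fin N)
    (l k : List (Fin N)) (h : (l ++ a :: b :: k).Nodup) :
    R (wz z 1) a b * G z K i (l ++ a :: b :: k) = G z K i (l ++ b :: a :: k) * R (wz z 1) a b := by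
  have hab : a ≠ b := by
    rw [List.nodup_append] at h
    have := h.2.1
    simp only [List.nodup_cons, List.mem_cons, not_or] at this
    exact this.1.1
  have hz' : ((z a : ℂ) - z b) ≠ 0 := by
    intro h'
    have : z a - z b = 0 := by exact_mod_cast h'
    exact hab (hz (sub_eq_zero.1 this))
  have e1 := sw_Pair i a b l k h
  have e2 := Pair_swap i a b l k
  have e3 := sw_Dz z i a b hab
  have e4 : sw a b * K = K * sw a b := (hK _).eq
  set P := Pair i (l ++ a :: b :: k)
  have e2' : Pair i (l ++ b :: a :: k) = P + E i a * sw a b - E i b * sw a b := by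
    rw [← e2]; abel
  set P' := Pair i (l ++ b :: a :: k)
  have e3' : sw a b * Dz z i = Dz z i * sw a b + ((z a : ℂ) - z b) • ((E i b - E i a) * sw a b) := by
    rw [← e3]; abel
  have hw : ((wz z 1 a b : ℝ) : ℂ) * ((z a : ℂ) - z b) = 1 := by
    rw [wz]; push_cast; field_simp
  have k1 : sw a b * (Dz z i - P + K) = (Dz z i - P' + K) * sw a b +
      ((z a : ℂ) - z b) • ((E i b - E i a) * sw a b) := by
    rw [mul_add, mul_sub, e3', e1, e4, add_mul (Dz z i - P'), sub_mul (Dz z i)]; abel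
  have k2 : Dz z i - P + K = Dz z i - P' + K - (E i b - E i a) * sw a b := by
    rw [e2', sub_mul]; abel
  change (1 + _ • sw a b) * (Dz z i - P + K) = (Dz z i - P' + K) * (1 + _ • sw a b)
  rw [add_mul 1, one_mul, mul_add _ 1, mul_one, smul_mul_assoc, mul_smul_comm, k1, smul_add, smul_smul,
    hw, one_smul]
  nth_rewrite 1 [k2]
  abel

lemma A_G (z : Fin N → ℝ) (hz : Function.Injective z) (K : Mat N)
    (hK : ∀ g, Commute (Sg g) K) (i a : Fin N)
    (x m y : List (Fin N)) (h : (x ++ a :: (m.reverse ++ y)).Nodup) :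
    A (wz z 1) a m * G z K i (x ++ a :: (m.reverse ++ y)) =
      G z K i (x ++ (m.reverse ++ a :: y)) * A (wz z 1) a m := by
  induction m generalizing y with
  | nil => simp [A]
  | cons b m ih =>
    have h' : (x ++ a :: (m.reverse ++ (b :: y))).Nodup := by simpa using h
    have := ih (b :: y) h'
    have e : x ++ a :: ((b :: m).reverse ++ y) = x ++ a :: (m.reverse ++ (b :: y)) := by simp
    have hn : ((x ++ m.reverse) ++ a :: b :: y).Nodup := by
      refine (List.Perm.nodup_iff ?_).1 h'
      rw [List.append_assoc]
      exact List.Perm.append_left _ List.perm_middle.symm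
    have k := R_G z hz K hK i a b (x ++ m.reverse) y hn
    rw [e, A, mul_assoc, this, ← mul_assoc, ← List.append_assoc x, k]
    simp [mul_assoc]

lemma F_G (z : Fin N → ℝ) (hz : Function.Injective z) (K : Mat N)
    (hK : ∀ g, Commute (Sg g) K) (i : Fin N)
    (x m y : List (Fin N)) (h : (x ++ (m ++ y)).Nodup) :
    F (wz z 1) m * G z K i (x ++ (m ++ y)) =
      G z K i (x ++ (m.reverse ++ y)) * F (wz z 1) m := by
  induction m generalizing x with
  | nil => simp [F]
  | cons a m ih =>
    have h' : ((x ++ [a]) ++ (m ++ y)).Nodup := by simpa using h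
    have k := ih (x ++ [a]) h'
    have hn : (x ++ a :: (m.reverse ++ y)).Nodup := by
      refine (List.Perm.nodup_iff ?_).1 h
      apply List.Perm.append_left
      apply List.Perm.cons
      exact List.Perm.append_right _ m.reverse_perm.symm
    have k2 := A_G z hz K hK i a x m y hn
    have e : x ++ (a :: m ++ y) = (x ++ [a]) ++ (m ++ y) := by simp
    have e2 : x ++ [a] ++ (m.reverse ++ y) = x ++ a :: (m.reverse ++ y) := by simp
    rw [e, F, mul_assoc, k, e2, ← mul_assoc, k2]
    simp [mul_assoc]

lemma Dz_conj (z : Fin N → ℝ) (i : Fin N) : (Dz z i)ᴴ = Dz z i := by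
  simp [Dz, conjTranspose_sum, E_conj]

lemma F_G_conj (z : Fin N → ℝ) (hz : Function.Injective z) (K : Mat N)
    (hK : ∀ g, Commute (Sg g) K) (hKc : Kᴴ = K) (i : Fin N) (m : List (Fin N)) (h : m.Nodup) :
    F (wz z 1) m * G z K i m = (G z K i m)ᴴ * F (wz z 1) m := by
  have := F_G z hz K hK i [] m [] (by simpa using h)
  simp only [List.nil_append, List.append_nil] at this
  rw [this]
  simp [G, Dz_conj, hKc, Pair_conj]

lemma wz_YB (z : Fin N → ℝ) (hz : Function.Injective z) (t : ℝ) : IsYB (wz z t) := by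
  intro a b c hab hac hbc
  have h1 : z a - z b ≠ 0 := sub_ne_zero.2 (hz.ne hab)
  have h2 : z a - z c ≠ 0 := sub_ne_zero.2 (hz.ne hac)
  have h3 : z b - z c ≠ 0 := sub_ne_zero.2 (hz.ne hbc)
  simp only [wz]; field_simp; ring

lemma cont_R (z : Fin N → ℝ) (a b : Fin N) : Continuous fun t => R (wz z t) a b := by
  simp only [R, wz]; fun_prop

lemma cont_A (z : Fin N → ℝ) (a : Fin N) (l : List (Fin N)) :
    Continuous fun t => A (wz z t) a l := by
  induction l with
  | nil => exact continuous_const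
  | cons b l ih => exact (cont_R z a b).mul ih

lemma cont_F (z : Fin N → ℝ) (l : List (Fin N)) : Continuous fun t => F (wz z t) l := by
  induction l with
  | nil => exact continuous_const
  | cons b l ih => exact (cont_A z b l).mul ih

lemma R_zero (z : Fin N → ℝ) (a b : Fin N) : R (wz z 0) a b = 1 := by simp [R, wz]

lemma A_zero (z : Fin N → ℝ) (a : Fin N) (l : List (Fin N)) : A (wz z 0) a l = 1 := by
  induction l with
  | nil => rfl
  | cons b l ih => simp [A, R_zero, ih]

lemma F_zero (z : Fin N → ℝ) (l : List (Fin N)) : F (wz z 0) l = 1 := by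
  induction l with
  | nil => rfl
  | cons b l ih => simp [F, A_zero, ih]

open scoped ComplexOrder in
/-- positivity along a path of invertible Hermitian matrices -/
lemma pos_path {n : Type*} [Fintype n] [DecidableEq n] (H : ℝ → Matrix n n ℂ) (hc : Continuous H)
    (h0 : H 0 = 1) (hh : ∀ t ∈ Set.Icc (0:ℝ) 1, (H t).IsHermitian)
    (hu : ∀ t ∈ Set.Icc (0:ℝ) 1, IsUnit (H t)) :
    ∀ v : n → ℂ, v ≠ 0 → (star v ⬝ᵥ (H 1 *ᵥ v)).re ≠ 0 := by
  set q : ℝ × (n → ℂ) → ℝ := fun p => (star p.2 ⬝ᵥ (H p.1 *ᵥ p.2)).re with hq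
  have hqc : Continuous q := by
    apply Complex.continuous_re.comp
    apply Continuous.dotProduct
    · fun_prop
    · exact Continuous.matrix_mulVec (hc.comp continuous_fst) continuous_snd
  set T : Set (ℝ × (n → ℂ)) := (Set.Icc (0:ℝ) 1 ×ˢ Metric.sphere (0 : n → ℂ) 1) ∩ {p | q p ≤ 0}
  have hT : IsCompact T :=
    (isCompact_Icc.prod (isCompact_sphere _ _)).inter_right (isClosed_le hqc continuous_const)
  have qs : ∀ (t : ℝ) (c : ℝ) (v : n → ℂ), q (t, (c:ℂ) • v) = c^2 * q (t, v) := by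
    intro t c v
    simp only [hq, star_smul, mulVec_smul, dotProduct_smul, smul_dotProduct, smul_eq_mul]
    have : star (c:ℂ) = (c:ℂ) := Complex.conj_ofReal c
    rw [this, ← mul_assoc, ← Complex.ofReal_mul, Complex.re_ofReal_mul]; ring
  have hsc : ∀ (t : ℝ) (v : n → ℂ), v ≠ 0 → (∀ u, ‖u‖ = 1 → 0 < q (t, u)) → 0 < q (t, v) := by
    intro t v hv hu
    have h1 : ‖v‖ ≠ 0 := norm_ne_zero_iff.2 hv
    have h2 := hu (((‖v‖⁻¹ : ℝ) : ℂ) • v) (by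
      rw [norm_smul]; simp [h1])
    rw [qs] at h2
    exact pos_of_mul_pos_right h2 (by positivity)
  by_cases hTe : T.Nonempty
  · exfalso
    obtain ⟨⟨t0, v0⟩, hm, hmin⟩ := hT.exists_isMinOn hTe continuous_fst.continuousOn
    obtain ⟨⟨ht0, hv0⟩, hq0⟩ := hm
    change t0 ∈ Set.Icc (0:ℝ) 1 at ht0
    simp only [Set.mem_ofPred_eq] at hq0
    simp only [mem_sphere_iff_norm, sub_zero] at hv0
    have hv00 : v0 ≠ 0 := by rintro rfl; simp at hv0
    have hlt : ∀ t ∈ Set.Ico 0 t0, ∀ v, v ≠ 0 → 0 < q (t, v) := by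
      intro t ht v hv
      apply hsc t v hv
      intro u hu1
      by_contra hcon
      have : (t, u) ∈ T := ⟨⟨⟨ht.1, ht.2.le.trans ht0.2⟩, by simpa using hu1⟩, not_lt.1 hcon⟩
      have := hmin this
      simp only [Set.mem_ofPred_eq] at this
      exact absurd ht.2 (not_lt.2 this)
    have ht0p : 0 < t0 := by
      rcases ht0.1.eq_or_lt with h | h
      · exfalso
        rw [← h] at hq0
        simp only [hq, h0, one_mulVec] at hq0
        have : 0 < star v0 ⬝ᵥ v0 := dotProduct_star_self_pos_iff.2 hv00
        exact absurd (Complex.lt_def.1 this).1 (not_lt.2 hq0)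
      · exact h
    have hge : ∀ v, 0 ≤ q (t0, v) := by
      intro v
      by_cases hv : v = 0
      · simp [hq, hv]
      have hcl : t0 ∈ closure (Set.Ico 0 t0) := by
        rw [closure_Ico ht0p.ne]; exact ⟨ht0p.le, le_rfl⟩
      have hcv : Continuous fun t => q (t, v) := hqc.comp (by fun_prop)
      have : closure (Set.Ico 0 t0) ⊆ {t | 0 ≤ q (t, v)} :=
        closure_minimal (fun t ht => (hlt t ht v hv).le) (isClosed_le continuous_const hcv)
      exact this hcl
    have hps : (H t0).PosSemidef := by
      apply PosSemidef.of_dotProduct_mulVec_nonneg (hh t0 ht0)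
      intro v
      rw [Complex.le_def]
      refine ⟨hge v, ?_⟩
      have := (hh t0 ht0).im_star_dotProduct_mulVec_self v
      simpa using this.symm
    have hz : star v0 ⬝ᵥ (H t0 *ᵥ v0) = 0 := by
      apply Complex.ext
      · exact le_antisymm hq0 (hge v0)
      · simpa using (hh t0 ht0).im_star_dotProduct_mulVec_self v0
    rw [hps.dotProduct_mulVec_zero_iff] at hz
    apply hv00
    have hinj := Matrix.mulVec_injective_of_isUnit (hu t0 ht0)
    exact hinj (by rw [hz, mulVec_zero])
  · intro v hv
    apply ne_of_gt
    apply hsc 1 v hv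
    intro u hu1
    by_contra hcon
    exact hTe ⟨(1, u), ⟨⟨by norm_num, le_rfl⟩, by simpa using hu1⟩, not_lt.1 hcon⟩

lemma real_spec (z : Fin N → ℝ) (hz : ∀ a b, a ≠ b → 1 < |z a - z b|) (K : Mat N)
    (hK : ∀ g, Commute (Sg g) K) (hKc : Kᴴ = K) (i : Fin N) (m : List (Fin N)) (h : m.Nodup)
    (lam : ℂ) (v : Equiv.Perm (Fin N) → ℂ) (hv : v ≠ 0) (he : G z K i m *ᵥ v = lam • v) :
    lam.im = 0 := by
  have hinj : Function.Injective z := by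
    intro a b hab
    by_contra hne
    have := hz a b hne
    rw [hab] at this; norm_num at this
  have hp := pos_path (fun t => F (wz z t) m) (cont_F z m) (F_zero z m)
    (fun t _ => F_conj _ (wz_YB z hinj t) m h)
    (fun t ht => F_unit _ m h (by
      intro a b hab
      have := hz a b hab
      rw [wz, abs_div, div_lt_one (by linarith), abs_of_nonneg ht.1]
      linarith [ht.2])) v hv
  have e := F_G_conj z hinj K hK hKc i m h
  set S := F (wz z 1) m
  have e1 : star v ⬝ᵥ ((S * G z K i m) *ᵥ v) = lam * (star v ⬝ᵥ (S *ᵥ v)) := by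
    rw [← mulVec_mulVec, he, mulVec_smul, dotProduct_smul, smul_eq_mul]
  have e2 : star v ⬝ᵥ (((G z K i m)ᴴ * S) *ᵥ v) = star lam * (star v ⬝ᵥ (S *ᵥ v)) := by
    rw [← mulVec_mulVec, dotProduct_mulVec, ← star_mulVec, he, star_smul, smul_dotProduct,
      smul_eq_mul]
  rw [e, e2] at e1
  have hne : star v ⬝ᵥ (S *ᵥ v) ≠ 0 := by
    intro h0
    apply hp
    rw [h0]; rfl
  have := mul_right_cancel₀ hne e1
  have h3 := congrArg Complex.im this
  simp at h3
  linarith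

lemma real_spec_edge (z : Fin N → ℝ) (hz : ∀ a b, a ≠ b → 1 ≤ |z a - z b|) (K : Mat N)
    (hK : ∀ g, Commute (Sg g) K) (hKc : Kᴴ = K) (i : Fin N) (m : List (Fin N)) (h : m.Nodup)
    (lam : ℂ) (v : Equiv.Perm (Fin N) → ℂ) (hv : v ≠ 0) (he : G z K i m *ᵥ v = lam • v) :
    lam.im = 0 := by
  by_contra him
  set H : ℝ → Mat N := fun t => G (fun a => t * z a) K i m with hH
  have hHc : Continuous H := by
    simp only [hH, G, Dz]; push_cast; fun_prop
  set n := Fintype.card (Equiv.Perm (Fin N))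
  have hev : ∀ t, ((H t).charpoly.eval lam) = (scalar _ lam - H t).det := fun t => by
    rw [eval_charpoly]
  have hb : ∀ t ∈ Set.Ioi (1:ℝ), |lam.im| ^ n ≤ ‖(scalar _ lam - H t).det‖ := by
    intro t ht
    have ht' : (1:ℝ) < t := ht
    rw [← hev]
    have hsp := IsAlgClosed.splits (H t).charpoly
    rw [hsp.eval_eq_prod_roots_of_monic (charpoly_monic _)]
    have hcard : n = Multiset.card (H t).charpoly.roots := by
      rw [← hsp.natDegree_eq_card_roots, charpoly_natDegree_eq_dim]
    have hroots : ∀ r ∈ (H t).charpoly.roots, r.im = 0 := by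
      intro r hr
      rw [mem_roots (charpoly_monic _).ne_zero, IsRoot, eval_charpoly] at hr
      obtain ⟨u, hu, hu2⟩ := Matrix.exists_mulVec_eq_zero_iff.2 hr
      refine real_spec (fun a => t * z a) ?_ K hK hKc i m h r u hu ?_
      · intro a b hab
        rw [← mul_sub, abs_mul, abs_of_pos (by linarith)]
        have := hz a b hab
        nlinarith
      · rw [sub_mulVec, sub_eq_zero] at hu2
        rw [show G (fun a => t * z a) K i m = H t from rfl, ← hu2]
        ext σ; simp [scalar_apply, mulVec_diagonal]
    rw [hcard]
    generalize (H t).charpoly.roots = rs at hroots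
    clear hcard
    induction rs using Multiset.induction_on with
    | empty => simp
    | cons r rs ih =>
      simp only [Multiset.card_cons, Multiset.map_cons, Multiset.prod_cons, norm_mul, pow_succ]
      rw [mul_comm]
      apply mul_le_mul _ (ih fun r hr => hroots r (Multiset.mem_cons_of_mem hr)) (by positivity)
        (norm_nonneg _)
      have := Complex.abs_im_le_norm (lam - r)
      rwa [Complex.sub_im, hroots r (Multiset.mem_cons_self _ _), sub_zero] at this
  have hcd : Continuous fun t => ‖(scalar _ lam - H t).det‖ :=
    (Continuous.matrix_det (continuous_const.sub hHc)).norm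
  have hcl : (1:ℝ) ∈ closure (Set.Ioi (1:ℝ)) := by rw [closure_Ioi]; exact Set.self_mem_Ici
  have h1 : |lam.im| ^ n ≤ ‖(scalar _ lam - H 1).det‖ :=
    closure_minimal hb (isClosed_le continuous_const hcd) hcl
  have h2 : (scalar _ lam - H 1).det = 0 := by
    apply Matrix.exists_mulVec_eq_zero_iff.1
    refine ⟨v, hv, ?_⟩
    have : H 1 = G z K i m := by simp [hH]
    rw [sub_mulVec, this, he, sub_eq_zero]
    ext σ; simp [scalar_apply, mulVec_diagonal]
  rw [h2, norm_zero] at h1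
  have : 0 < |lam.im| ^ n := by positivity
  linarith

end CM

namespace CM
variable {N : ℕ}

def br (a b : Mat N) : Mat N := a * b - b * a

lemma br_self (a : Mat N) : br a a = 0 := sub_self _
lemma br_add (a b c : Mat N) : br a (b + c) = br a b + br a c := by
  simp only [br, mul_add, add_mul]; abel
lemma br_sub (a b c : Mat N) : br a (b - c) = br a b - br a c := by
  simp only [br, mul_sub, sub_mul]; abel
lemma add_br (a b c : Mat N) : br (a + b) c = br a c + br b c := by
  simp only [br, mul_add, add_mul]; abel
lemma br_sum (a : Mat N) (s : Finset (Fin N)) (f : Fin N → Mat N) :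
    br a (∑ p ∈ s, f p) = ∑ p ∈ s, br a (f p) := by
  simp only [br, Finset.mul_sum, Finset.sum_mul, Finset.sum_sub_distrib]
lemma sum_br (a : Mat N) (s : Finset (Fin N)) (f : Fin N → Mat N) :
    br (∑ p ∈ s, f p) a = ∑ p ∈ s, br (f p) a := by
  simp only [br, Finset.mul_sum, Finset.sum_mul, Finset.sum_sub_distrib]

/-- one-place diagonal operator -/
def dg (f : Fin N → ℂ) (m : Fin N) : Mat N := diagonal fun σ => f (σ m)

/-- two-place diagonal operator -/
noncomputable def dd (Q : Fin N → ℂ) (m p : Fin N) : Mat N := diagonal fun σ => (Q (σ p) - Q (σ m))⁻¹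

noncomputable def r (Q : Fin N → ℂ) (m p : Fin N) : Mat N := dd Q m p * sw m p

lemma Sg_dg (g : Equiv.Perm (Fin N)) (f : Fin N → ℂ) (m : Fin N) :
    Sg g * dg f m = dg f (g m) * Sg g := by
  rw [dg, Sg_diag]; rfl

lemma Sg_dd (g : Equiv.Perm (Fin N)) (Q : Fin N → ℂ) (m p : Fin N) :
    Sg g * dd Q m p = dd Q (g m) (g p) * Sg g := by
  rw [dd, Sg_diag]; rfl

lemma Sg_r (g : Equiv.Perm (Fin N)) (Q : Fin N → ℂ) (m p : Fin N) :
    Sg g * r Q m p = r Q (g m) (g p) * Sg g := by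
  rw [r, ← mul_assoc, Sg_dd, mul_assoc, Sg_sw, r, mul_assoc]

lemma r_self (Q : Fin N → ℂ) (m : Fin N) : r Q m m = 0 := by
  simp [r, dd]

lemma r_anti (Q : Fin N → ℂ) (m p : Fin N) : r Q p m = - r Q m p := by
  rw [r, r, sw_comm, ← neg_mul]
  congr 1
  rw [dd, dd, diagonal_neg]
  congr 1; ext σ
  rw [← inv_neg, neg_sub]

lemma r_mul (Q : Fin N → ℂ) (a b c d : Fin N) :
    r Q a b * r Q c d = dd Q a b * dd Q (Equiv.swap a b c) (Equiv.swap a b d) *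
      (sw a b * sw c d) := by
  rw [r, r, mul_assoc, ← mul_assoc (sw a b)]
  have : sw a b * dd Q c d = dd Q (Equiv.swap a b c) (Equiv.swap a b d) * sw a b := by
    rw [sw, Sg_dd]
  rw [this]; simp only [mul_assoc]

lemma r_comm (Q : Fin N → ℂ) {a b c d : Fin N}
    (h1 : a ≠ c) (h2 : a ≠ d) (h3 : b ≠ c) (h4 : b ≠ d) :
    br (r Q a b) (r Q c d) = 0 := by
  rw [br, r_mul, r_mul, Equiv.swap_apply_of_ne_of_ne h1.symm h3.symm,
    Equiv.swap_apply_of_ne_of_ne h2.symm h4.symm, Equiv.swap_apply_of_ne_of_ne h1 h2,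
    Equiv.swap_apply_of_ne_of_ne h3 h4, sw_sw_of_ne h1 h2 h3 h4, sub_eq_zero]
  congr 1
  simp only [dd, diagonal_mul_diagonal]
  congr 1; ext σ; ring

lemma cybe (Q : Fin N → ℂ) (hQ : Function.Injective Q) {m n p : Fin N} (hmn : m ≠ n) (hmp : m ≠ p)
    (hnp : n ≠ p) :
    br (r Q m p) (r Q n p) + br (r Q m n) (r Q n p) - br (r Q m p) (r Q m n) = 0 := by
  have c1 : sw n p * sw m n = sw m p * sw n p := by
    have := sw3 (a := n) (b := p) (c := m) hmn.symm hmp.symm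
    rw [sw_comm n m, sw_comm p m] at this; exact this
  have c2 : sw m n * sw m p = sw m p * sw n p := by
    rw [sw3 hmp hnp, c1]
  have d1 : sw m p * sw m n = sw n p * sw m p := by
    have := sw3 (a := m) (b := p) (c := n) hmn hnp.symm
    rw [sw_comm p n] at this; exact this
  have d2 : sw m n * sw n p = sw n p * sw m p := by
    have := sw3 (a := n) (b := m) (c := p) hnp hmp
    rw [sw_comm n m] at this; rw [this, d1]
  simp only [br, r_mul, c1, c2, d1, d2, Equiv.swap_apply_left, Equiv.swap_apply_right,
    Equiv.swap_apply_of_ne_of_ne hmp.symm hnp.symm, Equiv.swap_apply_of_ne_of_ne hmn.symm hnp,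
    Equiv.swap_apply_of_ne_of_ne hmn hmp]
  have k1 : dd Q m p * dd Q n m - dd Q n p * dd Q m p + dd Q m n * dd Q n p = 0 := by
    simp only [dd, diagonal_mul_diagonal, diagonal_sub, diagonal_add]
    rw [← diagonal_zero]
    congr 1; ext σ
    have e1 : Q (σ p) - Q (σ m) ≠ 0 := sub_ne_zero.2 (hQ.ne (σ.injective.ne hmp.symm))
    have e2 : Q (σ p) - Q (σ n) ≠ 0 := sub_ne_zero.2 (hQ.ne (σ.injective.ne hnp.symm))
    have e3 : Q (σ n) - Q (σ m) ≠ 0 := sub_ne_zero.2 (hQ.ne (σ.injective.ne hmn.symm))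
    have e4 : Q (σ m) - Q (σ n) = -(Q (σ n) - Q (σ m)) := by ring
    rw [e4, inv_neg]
    field_simp; ring
  have k2 : -(dd Q n p * dd Q m n) + dd Q m n * dd Q m p - dd Q m p * dd Q p n = 0 := by
    simp only [dd, diagonal_mul_diagonal, diagonal_sub, diagonal_add, diagonal_neg]
    rw [← diagonal_zero]
    congr 1; ext σ
    have e1 : Q (σ p) - Q (σ m) ≠ 0 := sub_ne_zero.2 (hQ.ne (σ.injective.ne hmp.symm))
    have e2 : Q (σ p) - Q (σ n) ≠ 0 := sub_ne_zero.2 (hQ.ne (σ.injective.ne hnp.symm))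
    have e3 : Q (σ n) - Q (σ m) ≠ 0 := sub_ne_zero.2 (hQ.ne (σ.injective.ne hmn.symm))
    have e4 : Q (σ n) - Q (σ p) = -(Q (σ p) - Q (σ n)) := by ring
    rw [e4, inv_neg]
    field_simp; ring
  have k3 := congrArg (· * (sw m p * sw n p)) k1
  have k4 := congrArg (· * (sw n p * sw m p)) k2
  simp only [add_mul, sub_mul, neg_mul, zero_mul] at k3 k4
  have := congrArg₂ (· + ·) k3 k4
  simp only [add_zero] at this
  rw [← this]
  abel

/-- rational Dunkl operators -/
noncomputable def Du (Q f : Fin N → ℂ) (m : Fin N) : Mat N := dg f m + ∑ p, r Q m p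

lemma Sg_Du (g : Equiv.Perm (Fin N)) (Q f : Fin N → ℂ) (m : Fin N) :
    Sg g * Du Q f m = Du Q f (g m) * Sg g := by
  rw [Du, Du, mul_add, add_mul, Sg_dg, Finset.mul_sum, Finset.sum_mul]
  congr 1
  rw [← Equiv.sum_comp g (fun p => r Q (g m) p * Sg g)]
  exact Finset.sum_congr rfl fun p _ => Sg_r g Q m p

lemma dg_dg (f h : Fin N → ℂ) (m n : Fin N) : Commute (dg f m) (dg h n) := by
  simp only [Commute, SemiconjBy, dg, diagonal_mul_diagonal]
  congr 1; ext σ; ring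

lemma dg_dd (f Q : Fin N → ℂ) (m n p : Fin N) : Commute (dg f m) (dd Q n p) := by
  simp only [Commute, SemiconjBy, dg, dd, diagonal_mul_diagonal]
  congr 1; ext σ; ring

lemma r_dg (Q f : Fin N → ℂ) (m n p : Fin N) :
    r Q m n * dg f p = dg f (Equiv.swap m n p) * r Q m n := by
  rw [r, mul_assoc, sw, Sg_dg, ← mul_assoc, ← (dg_dd f Q _ m n).eq, mul_assoc]

lemma Du_comm (Q f : Fin N → ℂ) (hQ : Function.Injective Q) (m n : Fin N) (hmn : m ≠ n) :
    br (Du Q f m) (Du Q f n) = 0 := by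
  set s := (Finset.univ.erase m).erase n
  have hs : ∀ p ∈ s, p ≠ n ∧ p ≠ m := by intro p hp; simpa [s] using hp
  have e1 : Du Q f m = dg f m + r Q m n + ∑ p ∈ s, r Q m p := by
    rw [Du, ← Finset.add_sum_erase _ _ (Finset.mem_univ m), r_self, zero_add,
      ← Finset.add_sum_erase _ _ (Finset.mem_erase.2 ⟨hmn.symm, Finset.mem_univ n⟩), add_assoc]
  have e2 : Du Q f n = dg f n - r Q m n + ∑ p ∈ s, r Q n p := by
    rw [Du, ← Finset.add_sum_erase _ _ (Finset.mem_univ m),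
      ← Finset.add_sum_erase _ _ (Finset.mem_erase.2 ⟨hmn.symm, Finset.mem_univ n⟩), r_self,
      zero_add, r_anti Q m n]
    abel
  have h1 : br (dg f m) (dg f n) = 0 := by rw [br, (dg_dg f f m n).eq, sub_self]
  have h2 : br (r Q m n) (dg f n) = br (dg f m) (r Q m n) := by
    rw [br, br, r_dg, r_dg, Equiv.swap_apply_left, Equiv.swap_apply_right]
  have h3 : br (dg f m) (∑ p ∈ s, r Q n p) = 0 := by
    rw [br_sum]
    apply Finset.sum_eq_zero
    intro p hp
    rw [br, r_dg, Equiv.swap_apply_of_ne_of_ne hmn (hs p hp).2.symm, sub_self]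
  have h4 : br (∑ p ∈ s, r Q m p) (dg f n) = 0 := by
    rw [sum_br]
    apply Finset.sum_eq_zero
    intro p hp
    rw [br, r_dg, Equiv.swap_apply_of_ne_of_ne hmn.symm (hs p hp).1.symm, sub_self]
  have h5 : br (∑ p ∈ s, r Q m p) (∑ p ∈ s, r Q n p) = ∑ p ∈ s, br (r Q m p) (r Q n p) := by
    rw [sum_br]
    apply Finset.sum_congr rfl
    intro p hp
    rw [br_sum]
    apply Finset.sum_eq_single_of_mem p hp
    intro q hq hqp
    exact r_comm Q hmn (hs q hq).2.symm (hs p hp).1 hqp.symm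
  have h6 : (∑ p ∈ s, br (r Q m p) (r Q n p)) + br (r Q m n) (∑ p ∈ s, r Q n p)
      - br (∑ p ∈ s, r Q m p) (r Q m n) = 0 := by
    rw [br_sum, sum_br, ← Finset.sum_add_distrib, ← Finset.sum_sub_distrib]
    apply Finset.sum_eq_zero
    intro p hp
    exact cybe Q hQ hmn (hs p hp).2.symm (hs p hp).1.symm
  rw [e1, e2]
  simp only [add_br, br_add, br_sub, h1, h2, h3, h4, h5, br_self]
  refine Eq.trans ?_ h6
  abel

lemma dd_dg_sub (Q : Fin N → ℂ) (hQ : Function.Injective Q) {m n : Fin N} (hmn : m ≠ n) :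
    (dg Q n - dg Q m) * dd Q m n = 1 := by
  simp only [dg, dd, diagonal_sub, diagonal_mul_diagonal]
  rw [← diagonal_one]
  congr 1; ext σ
  exact mul_inv_cancel₀ (sub_ne_zero.2 (hQ.ne (σ.injective.ne hmn.symm)))

lemma Du_x (Q f : Fin N → ℂ) (hQ : Function.Injective Q) (m n : Fin N) (hmn : m ≠ n) :
    Du Q f m * dg Q n = dg Q n * Du Q f m - sw m n := by
  rw [Du, add_mul, mul_add, (dg_dg f Q m n).eq, Finset.sum_mul, Finset.mul_sum,
    ← Finset.add_sum_erase _ _ (Finset.mem_univ n)]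
  rw [← Finset.add_sum_erase _ (fun p => dg Q n * r Q m p) (Finset.mem_univ n)]
  have h1 : ∑ x ∈ Finset.univ.erase n, r Q m x * dg Q n = ∑ x ∈ Finset.univ.erase n, dg Q n * r Q m x := by
    apply Finset.sum_congr rfl
    intro p hp
    rw [r_dg, Equiv.swap_apply_of_ne_of_ne hmn.symm (Finset.mem_erase.1 hp).1.symm]
  have h2 : r Q m n * dg Q n = dg Q n * r Q m n - sw m n := by
    rw [r_dg, Equiv.swap_apply_right, eq_sub_iff_add_eq, eq_comm, ← sub_eq_iff_eq_add', ← sub_mul, r,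
      ← mul_assoc, dd_dg_sub Q hQ hmn, one_mul]
  rw [h1, h2]; abel

noncomputable def yt (Q f : Fin N → ℂ) (m : Fin N) : Mat N := dg Q m * Du Q f m

lemma Sg_yt (g : Equiv.Perm (Fin N)) (Q f : Fin N → ℂ) (m : Fin N) :
    Sg g * yt Q f m = yt Q f (g m) * Sg g := by
  rw [yt, ← mul_assoc, Sg_dg, mul_assoc, Sg_Du, yt, mul_assoc]

lemma yt_lie (Q f : Fin N → ℂ) (hQ : Function.Injective Q) (m n : Fin N) (hmn : m ≠ n) :
    yt Q f m * yt Q f n - yt Q f n * yt Q f m = sw m n * (yt Q f m - yt Q f n) := by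
  have e := Du_comm Q f hQ m n hmn
  rw [br, sub_eq_zero] at e
  have a1 := Du_x Q f hQ m n hmn
  have a2 := Du_x Q f hQ n m hmn.symm
  have a3 : sw m n * dg Q m = dg Q n * sw m n := by simp [sw, Sg_dg]
  have a4 : sw m n * dg Q n = dg Q m * sw m n := by simp [sw, Sg_dg]
  have b1 : yt Q f m * yt Q f n = dg Q m * dg Q n * (Du Q f m * Du Q f n) -
      sw m n * yt Q f n := by
    rw [yt, yt, mul_assoc, ← mul_assoc (Du Q f m), a1, ← mul_assoc (sw m n), a4]
    simp only [sub_mul, mul_sub, mul_assoc]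
  have b2 : yt Q f n * yt Q f m = dg Q m * dg Q n * (Du Q f m * Du Q f n) -
      sw m n * yt Q f m := by
    rw [yt, yt, mul_assoc, ← mul_assoc (Du Q f n), a2, ← mul_assoc (sw m n), a3, e,
      (dg_dg Q Q m n).eq, sw_comm n m]
    simp only [sub_mul, mul_sub, mul_assoc]
  rw [b1, b2, mul_sub]; abel

def J (m : Fin N) : Mat N := ∑ p ∈ Finset.univ.filter (· < m), sw m p

lemma Sg_J (g : Equiv.Perm (Fin N)) (m : Fin N) (hm : g m = m) (hg : ∀ p, g p < m ↔ p < m) :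
    Sg g * J m = J m * Sg g := by
  rw [J, Finset.mul_sum, Finset.sum_mul, Finset.sum_filter, Finset.sum_filter,
    ← Equiv.sum_comp g (fun p => if p < m then sw m p * Sg g else 0)]
  apply Finset.sum_congr rfl
  intro p _
  simp only [hg, Sg_sw, hm]

noncomputable def y (Q f : Fin N → ℂ) (m : Fin N) : Mat N := yt Q f m + J m

lemma yt_sw (Q f : Fin N → ℂ) {m a b : Fin N} (ha : m ≠ a) (hb : m ≠ b) :
    sw a b * yt Q f m = yt Q f m * sw a b := by
  rw [sw, Sg_yt, Equiv.swap_apply_of_ne_of_ne ha hb]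

lemma sw_J {m a b : Fin N} (h : (a < m ∧ b < m) ∨ (m < a ∧ m < b)) :
    sw a b * J m = J m * sw a b := by
  rw [sw]
  apply Sg_J
  · apply Equiv.swap_apply_of_ne_of_ne
    · rcases h with h | h; exacts [h.1.ne', h.1.ne]
    · rcases h with h | h; exacts [h.2.ne', h.2.ne]
  · intro p
    rw [Equiv.swap_apply_def]
    split_ifs with h1 h2
    · subst h1; rcases h with h | h
      · simp [h.1, h.2]
      · simp [h.1.le, h.2.le, not_lt.2 h.1.le, not_lt.2 h.2.le]
    · subst h2; rcases h with h | h
      · simp [h.1, h.2]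
      · simp [h.1.le, h.2.le, not_lt.2 h.1.le, not_lt.2 h.2.le]
    · rfl

lemma y_comm_lt (Q f : Fin N → ℂ) (hQ : Function.Injective Q) (m n : Fin N) (hmn : m < n) :
    Commute (y Q f m) (y Q f n) := by
  have e := yt_lie Q f hQ m n hmn.ne
  have j1 : J m * yt Q f n = yt Q f n * J m := by
    rw [J, Finset.sum_mul, Finset.mul_sum]
    apply Finset.sum_congr rfl
    intro p hp
    exact yt_sw Q f hmn.ne' ((Finset.mem_filter.1 hp).2.trans hmn).ne'
  have j2 : J m * J n = J n * J m := by
    conv_lhs => rw [J, Finset.sum_mul]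
    conv_rhs => rw [J.eq_def m, Finset.mul_sum]
    apply Finset.sum_congr rfl
    intro p hp
    exact sw_J (Or.inl ⟨hmn, (Finset.mem_filter.1 hp).2.trans hmn⟩)
  have j3 : yt Q f m * J n - J n * yt Q f m = sw m n * (yt Q f n - yt Q f m) := by
    rw [J, ← Finset.add_sum_erase _ _ (Finset.mem_filter.2 ⟨Finset.mem_univ m, hmn⟩)]
    have : yt Q f m * ∑ p ∈ (Finset.univ.filter (· < n)).erase m, sw n p =
        (∑ p ∈ (Finset.univ.filter (· < n)).erase m, sw n p) * yt Q f m := by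
      rw [Finset.sum_mul, Finset.mul_sum]
      apply Finset.sum_congr rfl
      intro p hp
      exact (yt_sw Q f hmn.ne (Finset.mem_erase.1 hp).1.symm).symm
    rw [mul_add, add_mul, this, sw_comm n m, mul_sub]
    have h2 : sw m n * yt Q f n = yt Q f m * sw m n := by rw [sw, Sg_yt, Equiv.swap_apply_right]
    rw [h2]; abel
  change y Q f m * y Q f n = y Q f n * y Q f m
  rw [← sub_eq_zero]
  calc _ = (yt Q f m * yt Q f n - yt Q f n * yt Q f m) + (yt Q f m * J n - J n * yt Q f m)
      + (J m * yt Q f n - yt Q f n * J m) + (J m * J n - J n * J m) := by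
        simp only [y, mul_add, add_mul]; abel
    _ = 0 := by rw [e, j1, j2, j3]; simp only [mul_sub]; abel

lemma y_comm (Q f : Fin N → ℂ) (hQ : Function.Injective Q) (m n : Fin N) :
    Commute (y Q f m) (y Q f n) := by
  rcases lt_trichotomy m n with h | h | h
  · exact y_comm_lt Q f hQ m n h
  · subst h; exact Commute.refl _
  · exact (y_comm_lt Q f hQ n m h).symm

lemma J_succ {a b : Fin N} (hab : a.val + 1 = b.val) : sw a b * J a = (J b - sw a b) * sw a b := by
  have h1 : J b = sw a b + ∑ p ∈ Finset.univ.filter (· < a), sw b p := by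
    have : Finset.univ.filter (· < b) = insert a (Finset.univ.filter (· < a)) := by
      ext p; simp only [Finset.mem_filter, Finset.mem_univ, true_and, Finset.mem_insert,
        Fin.lt_def, Fin.ext_iff]; omega
    rw [J, this, Finset.sum_insert (by simp), sw_comm b a]
  rw [h1, add_sub_cancel_left, J, Finset.mul_sum, Finset.sum_mul]
  apply Finset.sum_congr rfl
  intro p hp
  have hp' := (Finset.mem_filter.1 hp).2
  conv_lhs => rw [sw, Sg_sw]
  rw [Equiv.swap_apply_left, Equiv.swap_apply_of_ne_of_ne hp'.ne]
  · rfl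
  · rintro rfl; rw [Fin.lt_def] at hp'; omega

lemma sw_y1 (Q f : Fin N → ℂ) {a b : Fin N} (hab : a.val + 1 = b.val) :
    sw a b * y Q f a = y Q f b * sw a b - 1 := by
  have h2 : sw a b * yt Q f a = yt Q f b * sw a b := by rw [sw, Sg_yt, Equiv.swap_apply_left]
  rw [y, mul_add, J_succ hab, h2, y, sub_mul, sw_sq, add_mul]; abel

lemma sw_y2 (Q f : Fin N → ℂ) {a b : Fin N} (hab : a.val + 1 = b.val) :
    sw a b * y Q f b = y Q f a * sw a b + 1 := by
  have h := sw_y1 Q f hab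
  have h2 : sw a b * (sw a b * y Q f a) * sw a b = sw a b * (y Q f b * sw a b - 1) * sw a b := by
    rw [h]
  rw [← mul_assoc, sw_sq, one_mul, mul_sub, sub_mul, mul_one, sw_sq, mul_assoc, mul_assoc, sw_sq,
    mul_one] at h2
  rw [h2]; abel

lemma sw_y3 (Q f : Fin N → ℂ) {a b m : Fin N} (hab : a.val + 1 = b.val) (ha : m ≠ a) (hb : m ≠ b) :
    sw a b * y Q f m = y Q f m * sw a b := by
  rw [y, mul_add, add_mul, yt_sw Q f ha hb, sw_J]
  rw [Ne, Fin.ext_iff] at ha hb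
  simp only [Fin.lt_def]; omega

lemma sw_y4 (Q f : Fin N → ℂ) (hQ : Function.Injective Q) {a b : Fin N} (hab : a.val + 1 = b.val)
    (u : ℂ) : Commute (sw a b) ((u • 1 - y Q f a) * (u • 1 - y Q f b)) := by
  have h1 := sw_y1 Q f hab
  have h2 := sw_y2 Q f hab
  have h3 := (y_comm Q f hQ a b).eq
  have k : sw a b * (y Q f a * y Q f b) = (y Q f a * y Q f b) * sw a b := by
    rw [← mul_assoc, h1, sub_mul, mul_assoc, h2, mul_add, h3]; simp [mul_assoc]
  have k2 : sw a b * (y Q f a + y Q f b) = (y Q f a + y Q f b) * sw a b := by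
    rw [mul_add, h1, h2, add_mul]; abel
  have e : (u • 1 - y Q f a) * (u • 1 - y Q f b) = (u*u) • (1 : Mat N) - u • (y Q f a + y Q f b)
      + y Q f a * y Q f b := by
    simp only [sub_mul, mul_sub, smul_mul_assoc, mul_smul_comm, one_mul, mul_one]; module
  rw [e]
  refine Commute.add_right (Commute.sub_right ?_ ?_) k
  · exact (Commute.one_right _).smul_right _
  · exact Commute.smul_right k2 _

end CM

namespace CM
variable {N : ℕ}

noncomputable def Dl (Q f : Fin N → ℂ) (u : ℂ) : Mat N :=
  ((List.finRange N).map (fun m => u • (1 : Mat N) - y Q f m)).prod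

lemma phi_prod {A' : Type*} [CommRing A'] [Algebra ℂ A'] (φ : A' →ₐ[ℂ] Mat N) (Y : Fin N → A')
    (Q f : Fin N → ℂ) (hY : ∀ m, φ (Y m) = y Q f m) (u : ℂ) :
    φ (∏ m, (algebraMap ℂ A' u - Y m)) = Dl Q f u := by
  rw [Fin.prod_univ_def, map_list_prod, List.map_map, Dl]
  congr 1
  apply List.map_congr_left
  intro m _
  simp [hY, Algebra.algebraMap_eq_smul_one]

lemma phi_comm_adj {A' : Type*} [CommRing A'] [Algebra ℂ A'] (φ : A' →ₐ[ℂ] Mat N) (Y : Fin N → A')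
    (Q f : Fin N → ℂ) (hQ : Function.Injective Q) (hY : ∀ m, φ (Y m) = y Q f m) (u : ℂ)
    {a b : Fin N} (hab : a.val + 1 = b.val) :
    Commute (sw a b) (φ (∏ m, (algebraMap ℂ A' u - Y m))) := by
  have hne : b ≠ a := by rintro rfl; omega
  have hu : ∀ m, φ (algebraMap ℂ A' u - Y m) = u • 1 - y Q f m := by
    intro m; simp [hY, Algebra.algebraMap_eq_smul_one]
  rw [← Finset.mul_prod_erase _ _ (Finset.mem_univ a),
    ← Finset.mul_prod_erase _ _ (Finset.mem_erase.2 ⟨hne, Finset.mem_univ b⟩), ← mul_assoc,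
    map_mul, map_mul, hu, hu]
  apply Commute.mul_right (sw_y4 Q f hQ hab u)
  apply Finset.prod_induction _ (fun x => Commute (sw a b) (φ x))
  · intro x y hx hy; rw [map_mul]; exact hx.mul_right hy
  · rw [map_one]; exact Commute.one_right _
  · intro m hm
    simp only [Finset.mem_erase, Finset.mem_univ, and_true] at hm
    rw [hu]
    exact ((Commute.one_right _).smul_right _).sub_right (sw_y3 Q f hab hm.2 hm.1)

lemma comm_all (M : Mat N) (h : ∀ a b : Fin N, a.val + 1 = b.val → Commute (sw a b) M)
    (g : Equiv.Perm (Fin N)) : Commute (Sg g) M := by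
  rcases N with _ | n
  · have : g = 1 := Subsingleton.elim _ _
    rw [this, Sg_one]; exact Commute.one_left _
  · have hg : g ∈ Submonoid.closure
        (Set.range fun i : Fin n => Equiv.swap i.castSucc i.succ) := by
      rw [Equiv.Perm.mclosure_swap_castSucc_succ]; trivial
    induction hg using Submonoid.closure_induction with
    | mem x hx => obtain ⟨i, rfl⟩ := hx; exact h _ _ (by simp)
    | one => rw [Sg_one]; exact Commute.one_left _
    | mul x y _ _ hx hy => rw [← Sg_mul]; exact hx.mul_left hy

def v1 : Equiv.Perm (Fin N) → ℂ := fun _ => 1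

lemma const_of_comm (M : Mat N) (h : ∀ g, Commute (Sg g) M) (σ : Equiv.Perm (Fin N)) :
    (M *ᵥ v1) σ = (M *ᵥ v1) 1 := by
  have h1 : Sg σ *ᵥ (M *ᵥ v1) = M *ᵥ v1 := by
    rw [mulVec_mulVec, (h σ).eq, ← mulVec_mulVec]
    congr 1
    rw [Sg_mulVec]; rfl
  have := congrFun h1 1
  rw [Sg_mulVec] at this
  simpa using this

lemma exists_c_aux {A' : Type*} [CommRing A'] [Algebra ℂ A'] (φ : A' →ₐ[ℂ] Mat N) (Y : Fin N → A')
    (Q f : Fin N → ℂ) (hQ : Function.Injective Q) (hY : ∀ m, φ (Y m) = y Q f m) :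
    ∃ c : ℂ[X], c.Monic ∧ c.natDegree = N ∧ (∀ u, Dl Q f u *ᵥ v1 = c.eval u • v1) ∧
      ∀ m, aeval (y Q f m) c *ᵥ v1 = 0 := by
  rcases subsingleton_or_nontrivial A' with hs | hs
  · have : (1 : Mat N) = 0 := by
      rw [← map_one φ, ← map_zero φ, Subsingleton.elim (1 : A') 0]
    exact absurd this one_ne_zero
  set P : A'[X] := ∏ m, (X - C (Y m)) with hP
  have hPm : P.Monic := monic_prod_of_monic _ _ fun m _ => monic_X_sub_C _
  have hPd : P.natDegree = N := by
    rw [hP, natDegree_prod_of_monic _ _ fun m _ => monic_X_sub_C _]; simp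
  have hPe : ∀ x : A', ∏ m, (x - Y m) = ∑ k ∈ Finset.range (N + 1), P.coeff k * x ^ k := by
    intro x
    have h := eval_eq_sum_range (p := P) x
    rw [hPd] at h
    rw [← h, hP, eval_prod]; simp
  let p : Equiv.Perm (Fin N) → ℂ[X] := fun σ => ∑ k ∈ Finset.range (N + 1),
    monomial k ((φ (P.coeff k) *ᵥ v1) σ)
  have hpc : ∀ σ k, k < N + 1 → (p σ).coeff k = (φ (P.coeff k) *ᵥ v1) σ := by
    intro σ k hk
    simp only [p, finset_sum_coeff, coeff_monomial]
    rw [Finset.sum_ite_eq' (Finset.range (N+1)) k]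
    simp [hk]
  have hpe : ∀ σ u, (p σ).eval u = (Dl Q f u *ᵥ v1) σ := by
    intro σ u
    rw [← phi_prod φ Y Q f hY, hPe, map_sum, Matrix.sum_mulVec, Finset.sum_apply]
    simp only [p, eval_finset_sum, eval_monomial]
    apply Finset.sum_congr rfl
    intro k _
    rw [← map_pow, mul_comm (P.coeff k), ← Algebra.smul_def, map_smul, smul_mulVec, Pi.smul_apply, smul_eq_mul, mul_comm]
  have hconst : ∀ σ u, (Dl Q f u *ᵥ v1) σ = (Dl Q f u *ᵥ v1) 1 := by
    intro σ u
    apply const_of_comm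
    apply comm_all
    intro a b hab
    rw [← phi_prod φ Y Q f hY]
    exact phi_comm_adj φ Y Q f hQ hY u hab
  have hp1 : ∀ σ, p σ = p 1 := by
    intro σ
    apply Polynomial.funext
    intro u
    rw [hpe, hpe, hconst]
  have hk : ∀ k, k < N + 1 → φ (P.coeff k) *ᵥ v1 = (p 1).coeff k • v1 := by
    intro k hk
    ext σ
    rw [← hpc σ k hk, hp1 σ]; simp [v1]
  have hd : (p 1).natDegree ≤ N := by
    apply natDegree_sum_le_of_forall_le
    intro k hk
    exact (natDegree_monomial_le _).trans (Nat.lt_succ_iff.1 (Finset.mem_range.1 hk))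
  have hN1 : (p 1).coeff N = 1 := by
    rw [hpc 1 N (Nat.lt_succ_self N)]
    have : P.coeff N = 1 := by
      have := hPm.coeff_natDegree; rwa [hPd] at this
    rw [this, map_one, one_mulVec]; rfl
  have hdN : (p 1).natDegree = N := le_antisymm hd (le_natDegree_of_ne_zero (by rw [hN1]; exact one_ne_zero))
  refine ⟨p 1, ?_, hdN, ?_, ?_⟩
  · rw [Monic, leadingCoeff, hdN, hN1]
  · intro u
    ext σ
    rw [hconst, hpe]; simp [v1]
  · intro m
    have h0 : ∏ k, (Y m - Y k) = 0 := Finset.prod_eq_zero (Finset.mem_univ m) (sub_self _)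
    have h1 : φ (∏ k, (Y m - Y k)) *ᵥ v1 = 0 := by rw [h0, map_zero, zero_mulVec]
    rw [hPe, map_sum, Matrix.sum_mulVec] at h1
    rw [aeval_eq_sum_range, hdN, Matrix.sum_mulVec, ← h1]
    apply Finset.sum_congr rfl
    intro k hk'
    rw [mul_comm, map_mul, map_pow, hY, ← mulVec_mulVec, hk k (Finset.mem_range.1 hk'),
      mulVec_smul, smul_mulVec]

open scoped IsMulCommutative in
lemma exists_c (Q f : Fin N → ℂ) (hQ : Function.Injective Q) :
    ∃ c : ℂ[X], c.Monic ∧ c.natDegree = N ∧ (∀ u, Dl Q f u *ᵥ v1 = c.eval u • v1) ∧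
      ∀ m, aeval (y Q f m) c *ᵥ v1 = 0 := by
  haveI : IsMulCommutative ↥(Algebra.adjoin ℂ (Set.range (y Q f))) := by
    apply Algebra.isMulCommutative_adjoin
    rintro _ ⟨m, rfl⟩ _ ⟨n, rfl⟩
    exact (y_comm Q f hQ m n).eq
  exact exists_c_aux (A' := ↥(Algebra.adjoin ℂ (Set.range (y Q f))))
    (Algebra.adjoin ℂ (Set.range (y Q f))).val
    (fun m => ⟨y Q f m, Algebra.subset_adjoin ⟨m, rfl⟩⟩) Q f hQ (fun m => rfl)

end CM

namespace CM
variable {N : ℕ}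

noncomputable def Zm (Q a : Fin N → ℂ) : Matrix (Fin N) (Fin N) ℂ :=
  of fun i j => if i = j then a i else Q i / (Q j - Q i)

def lift (m : Fin N) (φ : Fin N → ℂ) : Equiv.Perm (Fin N) → ℂ := fun σ => φ (σ m)

lemma lift_inj (m : Fin N) (φ : Fin N → ℂ) (h : lift m φ = 0) : φ = 0 := by
  ext i
  have := congrFun h (Equiv.swap m i)
  simpa [lift] using this

lemma J_min (m : Fin N) (hm : ∀ p, ¬ p < m) : J m = 0 := by
  rw [J]; apply Finset.sum_eq_zero
  intro p hp
  exact absurd (Finset.mem_filter.1 hp).2 (hm p)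

lemma y_lift (Q a : Fin N → ℂ) (hQ0 : ∀ i, Q i ≠ 0) (m : Fin N)
    (hm : ∀ p, ¬ p < m) (φ : Fin N → ℂ) :
    y Q (fun i => a i / Q i) m *ᵥ lift m φ = lift m (Zm Q a *ᵥ φ) := by
  rw [y, J_min m hm, add_zero, yt, ← mulVec_mulVec, Du, add_mulVec, Matrix.sum_mulVec]
  ext σ
  have h1 : ∀ p, (r Q m p *ᵥ lift m φ) σ = (Q (σ p) - Q (σ m))⁻¹ * φ (σ p) := by
    intro p
    rw [r, ← mulVec_mulVec, dd, mulVec_diagonal, sw, Sg_mulVec]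
    simp [lift]
  rw [dg, mulVec_diagonal, Pi.add_apply, Finset.sum_apply, dg, mulVec_diagonal]
  simp only [h1]
  rw [Equiv.sum_comp σ (fun j => (Q j - Q (σ m))⁻¹ * φ j)]
  simp only [lift, mulVec, dotProduct, Zm, of_apply]
  rw [← Finset.add_sum_erase _ _ (Finset.mem_univ (σ m))]
  rw [← Finset.add_sum_erase Finset.univ (fun j => (if σ m = j then a (σ m) else Q (σ m) / (Q j - Q (σ m))) * φ j) (Finset.mem_univ (σ m))]
  simp only [sub_self, _root_.inv_zero, zero_mul, zero_add, if_true, mul_add, Finset.mul_sum]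
  congr 1
  · field_simp [hQ0 (σ m)]
  · apply Finset.sum_congr rfl
    intro j hj
    rw [if_neg (Finset.mem_erase.1 hj).1.symm]
    ring

lemma aeval_lift (Q a : Fin N → ℂ) (hQ0 : ∀ i, Q i ≠ 0) (m : Fin N)
    (hm : ∀ p, ¬ p < m) (c : ℂ[X]) (φ : Fin N → ℂ) :
    aeval (y Q (fun i => a i / Q i) m) c *ᵥ lift m φ = lift m (aeval (Zm Q a) c *ᵥ φ) := by
  have hp : ∀ k φ, (y Q (fun i => a i / Q i) m) ^ k *ᵥ lift m φ = lift m ((Zm Q a)^k *ᵥ φ) := by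
    intro k
    induction k with
    | zero => intro φ; simp
    | succ k ih => intro φ; rw [pow_succ, pow_succ, ← mulVec_mulVec, y_lift Q a hQ0 m hm, ih, mulVec_mulVec]
  rw [aeval_eq_sum_range, aeval_eq_sum_range, Matrix.sum_mulVec, Matrix.sum_mulVec]
  ext σ
  simp only [smul_mulVec, hp]
  simp [lift]

/-- Krylov matrix -/
def Kr {R : Type*} [CommRing R] (M : Matrix (Fin N) (Fin N) R) : Matrix (Fin N) (Fin N) R :=
  of fun i j => (M ^ (j : ℕ) *ᵥ (fun _ => 1)) i

lemma kr_zero (M : Matrix (Fin N) (Fin N) ℂ) (h : (Kr M).det ≠ 0) (d : ℂ[X]) (hd : d.degree < N)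
    (h0 : aeval M d *ᵥ (fun _ => 1) = 0) : d = 0 := by
  by_contra hne
  have hd' : d.natDegree < N := (natDegree_lt_iff_degree_lt hne).2 hd
  rw [aeval_eq_sum_range' hd', Matrix.sum_mulVec, Finset.sum_range] at h0
  have := Matrix.eq_zero_of_mulVec_eq_zero h (v := fun j : Fin N => d.coeff j) (by
    rw [← h0]
    ext i
    rw [Finset.sum_apply]
    simp only [mulVec, dotProduct, Kr, of_apply, Matrix.smul_apply, smul_eq_mul, mul_one]
    apply Finset.sum_congr rfl
    intro j _
    rw [Finset.sum_mul]
    apply Finset.sum_congr rfl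
    intro k _
    ring)
  apply hne
  ext k
  by_cases hk : k < N
  · exact congrFun this ⟨k, hk⟩
  · exact coeff_eq_zero_of_natDegree_lt (by omega)

lemma ident_generic (Q a : Fin N → ℂ) (hQ : Function.Injective Q) (hQ0 : ∀ i, Q i ≠ 0)
    (m : Fin N) (hm : ∀ p, ¬ p < m) (h : (Kr (Zm Q a)).det ≠ 0) (u : ℂ) :
    Dl Q (fun i => a i / Q i) u *ᵥ v1 = (scalar (Fin N) u - Zm Q a).det • v1 := by
  obtain ⟨c, c1, c2, c3, c4⟩ := exists_c Q (fun i => a i / Q i) hQ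
  rw [c3, ← eval_charpoly]
  congr 2
  have e := c4 m
  have hv : (v1 : Equiv.Perm (Fin N) → ℂ) = lift m (fun _ => 1) := rfl
  rw [hv, aeval_lift Q a hQ0 m hm] at e
  have e2 := lift_inj m _ e
  rw [← sub_eq_zero]
  have hc : (Zm Q a).charpoly.degree = N := by
    rw [charpoly_degree_eq_dim]; simp
  have hcd : c.degree = N := by rw [degree_eq_natDegree c1.ne_zero, c2]
  apply kr_zero (Zm Q a) h
  · rw [← hcd]
    apply degree_sub_lt_left (by rw [hc, hcd]) c1.ne_zero
    rw [c1.leadingCoeff, (charpoly_monic _).leadingCoeff]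
  · rw [map_sub, sub_mulVec, e2, aeval_self_charpoly, zero_mulVec, sub_zero]

lemma kr_scale (M : Matrix (Fin N) (Fin N) ℂ) (t : ℂ) :
    (Kr (t • M)).det = (∏ i : Fin N, t ^ (i : ℕ)) * (Kr M).det := by
  rw [← Matrix.det_mul_row]
  congr 1
  ext i j
  simp [Kr, _root_.smul_pow, smul_mulVec]

noncomputable def bb (N : ℕ) : Fin N → ℂ := fun i => ((i : ℕ) : ℂ)

lemma kr_diag : (Kr (diagonal (bb N))).det ≠ 0 := by
  have : Kr (diagonal (bb N)) = vandermonde (bb N) := by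
    ext i j
    simp [Kr, vandermonde, diagonal_pow, mulVec_diagonal]
  rw [this, det_vandermonde_ne_zero_iff]
  intro i j h
  simpa [bb, Fin.ext_iff] using h

lemma kr_finite (Z : Matrix (Fin N) (Fin N) ℂ) :
    {s : ℂ | (Kr (s • Z + diagonal (bb N))).det = 0}.Finite := by
  let M : Matrix (Fin N) (Fin N) ℂ[X] := (X : ℂ[X]) • Z.map C + (diagonal (bb N)).map C
  have hM : ∀ s, (evalRingHom s).mapMatrix M = s • Z + diagonal (bb N) := by
    intro s
    ext i j
    by_cases h : i = j
    · subst h; simp [M]; ring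
    · simp [M, h]; ring
  have hK : ∀ s, (Kr M).det.eval s = (Kr (s • Z + diagonal (bb N))).det := by
    intro s
    rw [← coe_evalRingHom, RingHom.map_det, ← hM]
    congr 1
    ext i j
    rw [Kr, Kr, of_apply, ← map_pow]
    simp [mulVec, dotProduct, eval_finsetSum]
  have h0 : (Kr M).det ≠ 0 := by
    intro h
    have := hK 0
    rw [h, zero_smul, zero_add, eval_zero] at this
    exact kr_diag this.symm
  apply ((Kr M).det.roots.toFinset.finite_toSet).subset
  intro s hs
  simp only [Finset.mem_coe, Multiset.mem_toFinset, mem_roots h0, IsRoot.def, hK]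
  exact hs

lemma cont_Dl (Q : Fin N → ℂ) (f : ℂ → Fin N → ℂ) (hf : ∀ i, Continuous fun t => f t i) (u : ℂ) :
    Continuous fun t => Dl Q (f t) u := by
  unfold Dl
  apply continuous_list_prod
  intro m _
  apply continuous_const.sub
  unfold y yt Du
  apply Continuous.add _ continuous_const
  apply continuous_const.mul
  apply Continuous.add _ continuous_const
  unfold dg
  apply Continuous.matrix_diagonal
  exact continuous_pi fun σ => hf _

lemma ident (Q a : Fin N → ℂ) (hQ : Function.Injective Q) (hQ0 : ∀ i, Q i ≠ 0)
    (m : Fin N) (hm : ∀ p, ¬ p < m) (u : ℂ) :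
    Dl Q (fun i => a i / Q i) u *ᵥ v1 = (scalar (Fin N) u - Zm Q a).det • v1 := by
  let at' : ℂ → Fin N → ℂ := fun t i => a i + t * bb N i
  have hZ : ∀ t, Zm Q (at' t) = Zm Q a + t • diagonal (bb N) := by
    intro t; ext i j
    by_cases h : i = j
    · subst h; simp [Zm, at']
    · simp [Zm, h]
  have hcont1 : Continuous fun t => Dl Q (fun i => at' t i / Q i) u *ᵥ (v1 : Equiv.Perm (Fin N) → ℂ) := by
    apply Continuous.matrix_mulVec _ continuous_const
    apply cont_Dl
    intro i
    simp only [at']; fun_prop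
  have hcont2 : Continuous fun t => (scalar (Fin N) u - Zm Q (at' t)).det • (v1 : Equiv.Perm (Fin N) → ℂ) := by
    have hk : Continuous fun t => (scalar (Fin N) u - Zm Q (at' t)).det := by
      apply Continuous.matrix_det
      simp only [hZ]
      fun_prop
    exact hk.smul continuous_const
  let bad : Set ℂ := {0} ∪ (fun t : ℂ => t⁻¹) ⁻¹' {s : ℂ | (Kr (s • Zm Q a + diagonal (bb N))).det = 0}
  have hbad : bad.Finite := (Set.finite_singleton 0).union
    ((kr_finite (Zm Q a)).preimage inv_injective.injOn)
  have hd : Dense badᶜ := hbad.countable.dense_compl ℂ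
  have := hcont1.ext_on hd hcont2 (by
    intro t ht
    simp only [bad, Set.mem_compl_iff, Set.mem_union, Set.mem_singleton_iff, Set.mem_preimage,
      Set.mem_setOf_eq, not_or] at ht
    apply ident_generic Q (at' t) hQ hQ0 m hm
    rw [hZ]
    have : Zm Q a + t • diagonal (bb N) = t • (t⁻¹ • Zm Q a + diagonal (bb N)) := by
      rw [smul_add, smul_smul, mul_inv_cancel₀ ht.1, one_smul]
    rw [this, kr_scale]
    exact mul_ne_zero (Finset.prod_ne_zero_iff.2 fun i _ => pow_ne_zero _ ht.1) ht.2)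
  have h0 := congrFun this 0
  simpa [at'] using h0

end CM

namespace CM
variable {N : ℕ}

lemma joint {n : Type*} [Fintype n] [DecidableEq n] {ι : Type*} (T : ι → Matrix n n ℂ)
    (hT : ∀ a b, Commute (T a) (T b)) (l : List ι) :
    ∀ U : Submodule ℂ (n → ℂ), U ≠ ⊥ → (∀ m, ∀ v ∈ U, T m *ᵥ v ∈ U) →
      ∃ v ∈ U, v ≠ 0 ∧ ∀ m ∈ l, ∃ c : ℂ, T m *ᵥ v = c • v := by
  induction l with
  | nil =>
    intro U hU _
    obtain ⟨v, hv, hv0⟩ := U.ne_bot_iff.1 hU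
    exact ⟨v, hv, hv0, by simp⟩
  | cons m l ih =>
    intro U hU hinv
    haveI : Nontrivial U := Submodule.nontrivial_iff_ne_bot.2 hU
    obtain ⟨c, hc⟩ := Module.End.exists_eigenvalue ((T m).mulVecLin.restrict (hinv m))
    obtain ⟨w, hw⟩ := hc.exists_hasEigenvector
    have hw1 : T m *ᵥ (w : n → ℂ) = c • (w : n → ℂ) := by
      have := congrArg Subtype.val hw.apply_eq_smul
      exact this
    let U1 : Submodule ℂ (n → ℂ) := U ⊓ LinearMap.ker ((T m).mulVecLin - c • LinearMap.id)
    have hU1 : ∀ v, v ∈ U1 ↔ v ∈ U ∧ T m *ᵥ v = c • v := by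
      intro v
      simp [U1, sub_eq_zero]
    obtain ⟨v, hv, hv0, hvl⟩ := ih U1 (by
      rw [Submodule.ne_bot_iff]
      refine ⟨w, (hU1 _).2 ⟨w.2, hw1⟩, ?_⟩
      intro h
      exact hw.2 (Subtype.ext h)) (by
      intro k v hv
      rw [hU1] at hv ⊢
      refine ⟨hinv k v hv.1, ?_⟩
      rw [mulVec_mulVec, (hT m k).eq, ← mulVec_mulVec, hv.2, mulVec_smul])
    rw [hU1] at hv
    refine ⟨v, hv.1, hv0, ?_⟩
    intro k hk
    rcases List.mem_cons.1 hk with rfl | hk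
    · exact ⟨c, hv.2⟩
    · exact hvl k hk

lemma y_Dl (Q f : Fin N → ℂ) (hQ : Function.Injective Q) (m : Fin N) (u : ℂ) :
    Commute (y Q f m) (Dl Q f u) := by
  apply Commute.list_prod_right
  intro x hx
  obtain ⟨k, _, rfl⟩ := List.mem_map.1 hx
  exact ((Commute.one_right _).smul_right _).sub_right (y_comm Q f hQ m k)

lemma exists_psi (Q a : Fin N → ℂ) (hQ : Function.Injective Q) (hQ0 : ∀ i, Q i ≠ 0)
    (m : Fin N) (hm : ∀ p, ¬ p < m) :
    ∃ ψ : Equiv.Perm (Fin N) → ℂ, ψ ≠ 0 ∧ ∃ ζ : Fin N → ℂ,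
      (∀ k, y Q (fun i => a i / Q i) k *ᵥ ψ = ζ k • ψ) ∧
      ∀ u, (Zm Q a).charpoly.eval u = ∏ k, (u - ζ k) := by
  set f : Fin N → ℂ := fun i => a i / Q i with hf
  let U : Submodule ℂ (Equiv.Perm (Fin N) → ℂ) :=
    { carrier := {v | ∀ u, Dl Q f u *ᵥ v = (scalar (Fin N) u - Zm Q a).det • v}
      add_mem' := by
        intro v w hv hw u
        rw [mulVec_add, hv u, hw u, smul_add]
      zero_mem' := by intro u; simp
      smul_mem' := by
        intro c v hv u
        rw [mulVec_smul, hv u, smul_comm] }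
  have hU : ∀ v, v ∈ U ↔ ∀ u, Dl Q f u *ᵥ v = (scalar (Fin N) u - Zm Q a).det • v := fun v => Iff.rfl
  obtain ⟨ψ, h1, h2, h3⟩ := joint (y Q f) (y_comm Q f hQ) (List.finRange N) U (by
    rw [Submodule.ne_bot_iff]
    refine ⟨v1, fun u => ident Q a hQ hQ0 m hm u, ?_⟩
    intro h
    have := congrFun h 1
    simp [v1] at this) (by
    intro k v hv u
    rw [mulVec_mulVec, ← (y_Dl Q f hQ k u).eq, ← mulVec_mulVec, hv u, mulVec_smul])
  choose ζ hζ using fun k => h3 k (List.mem_finRange k)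
  refine ⟨ψ, h2, ζ, hζ, ?_⟩
  intro u
  have h4 : ∀ l : List (Fin N), (l.map (fun m => u • (1 : Mat N) - y Q f m)).prod *ᵥ ψ =
      (l.map (fun m => u - ζ m)).prod • ψ := by
    intro l
    induction l with
    | nil => simp
    | cons k l ih =>
      rw [List.map_cons, List.prod_cons, ← mulVec_mulVec, ih, mulVec_smul, sub_mulVec, hζ,
        smul_mulVec, one_mulVec, ← sub_smul, smul_smul, List.map_cons, List.prod_cons, mul_comm]
  have h5 := h4 (List.finRange N)
  rw [← Fin.prod_univ_def] at h5
  have h6 := (hU ψ).1 h1 u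
  rw [Dl, h5] at h6
  rw [eval_charpoly]
  by_contra hne
  rw [← sub_eq_zero, ← sub_smul, smul_eq_zero] at h6
  rcases h6 with h6 | h6
  · exact hne (sub_eq_zero.1 h6).symm
  · exact h2 h6

lemma Pair_sorted (i : Fin N) (l : List (Fin N)) (hl : l.Pairwise (· < ·)) :
    Pair i l = ∑ m, ∑ p, if p < m ∧ p ∈ l ∧ m ∈ l then E i m * sw m p else 0 := by
  induction l with
  | nil => simp [Pair]
  | cons q l ih =>
    rw [List.pairwise_cons] at hl
    have hn : l.Nodup := hl.2.imp (fun h => ne_of_lt h)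
    have h1 : (l.map fun m => E i m * sw m q).sum = ∑ m, ∑ p, if p = q ∧ m ∈ l then E i m * sw m p else 0 := by
      rw [← List.sum_toFinset _ hn]
      simp only [ite_and, Finset.sum_ite_eq', Finset.mem_univ, if_true]
      rw [← Finset.sum_filter]
      congr 1
      ext m; simp
    rw [Pair, h1, ih hl.2, ← Finset.sum_add_distrib]
    apply Finset.sum_congr rfl
    intro m _
    rw [← Finset.sum_add_distrib]
    apply Finset.sum_congr rfl
    intro p _
    have hql : q ∉ l := fun h => lt_irrefl _ (hl.1 q h)
    by_cases hpq : p = q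
    · subst hpq
      by_cases hm : m ∈ l
      · simp [hm, hql, hl.1 m hm]
      · by_cases hmp : m = p
        · subst hmp; simp [hm]
        · simp [hm, hmp]
    · by_cases hmq : m = q
      · subst hmq
        by_cases hp : p ∈ l
        · simp [hql, hp, hpq, not_lt.2 (hl.1 p hp).le]
        · simp [hql, hp, hpq]
      · simp [hpq, hmq]

lemma Pair_J (i : Fin N) : Pair i (List.finRange N) = ∑ m, E i m * J m := by
  rw [Pair_sorted i _ (List.pairwise_lt_finRange N)]
  apply Finset.sum_congr rfl
  intro m _
  simp [J, Finset.mul_sum, Finset.sum_filter]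

noncomputable def KK (Q : Fin N → ℂ) (i : Fin N) : Mat N :=
  - ∑ m, ∑ p, E i m * (dg Q m * r Q m p)

lemma KK_comm (Q : Fin N → ℂ) (i : Fin N) (g : Equiv.Perm (Fin N)) : Commute (Sg g) (KK Q i) := by
  apply Commute.neg_right
  change _ * _ = _ * _
  rw [Finset.mul_sum, Finset.sum_mul, ← Equiv.sum_comp g (fun m => (∑ p, E i m * (dg Q m * r Q m p)) * Sg g)]
  apply Finset.sum_congr rfl
  intro m _
  rw [Finset.mul_sum, Finset.sum_mul, ← Equiv.sum_comp g (fun p => _ * Sg g)]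
  apply Finset.sum_congr rfl
  intro p _
  rw [← mul_assoc, Sg_E, mul_assoc, ← mul_assoc (Sg g), Sg_dg, mul_assoc, Sg_r]
  simp only [mul_assoc]

lemma KK_conj (Q : Fin N → ℝ) (i : Fin N) :
    (KK (fun j => (Q j : ℂ)) i)ᴴ = KK (fun j => (Q j : ℂ)) i := by
  set Qc : Fin N → ℂ := fun j => (Q j : ℂ)
  have hT : ∀ m p, E i m * (dg Qc m * r Qc m p) = diagonal (fun σ => (if σ m = i then (1:ℂ) else 0) *
      (Qc (σ m) * (Qc (σ p) - Qc (σ m))⁻¹)) * sw m p := by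
    intro m p
    rw [r, E, dg, dd, ← mul_assoc, ← mul_assoc, diagonal_mul_diagonal, diagonal_mul_diagonal]
    simp only [mul_assoc]
  have hH : ∀ m p, (E i m * (dg Qc m * r Qc m p))ᴴ = E i p * (dg Qc p * r Qc p m) := by
    intro m p
    rw [hT, hT, conjTranspose_mul, sw_conj, diagonal_conjTranspose]
    conv_lhs => rw [sw, Sg_diag]
    rw [sw_comm p m]
    congr 2
    ext σ
    simp only [Qc, Pi.star_apply, Equiv.Perm.mul_apply, Equiv.swap_apply_left, Equiv.swap_apply_right]
    split_ifs <;> simp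
  rw [KK, conjTranspose_neg, conjTranspose_sum]
  simp only [conjTranspose_sum, hH]
  rw [Finset.sum_comm]

lemma E_dg (a : Fin N → ℂ) (i m : Fin N) : E i m * dg a m = a i • E i m := by
  rw [E, dg, diagonal_mul_diagonal, ← diagonal_smul]
  congr 1
  ext σ
  by_cases h : σ m = i
  · simp [h]
  · simp [h]

lemma yt_eq (Q a : Fin N → ℂ) (hQ0 : ∀ i, Q i ≠ 0) (m : Fin N) :
    yt Q (fun i => a i / Q i) m = dg a m + ∑ p, dg Q m * r Q m p := by
  rw [yt, Du, mul_add, Finset.mul_sum, dg, dg, diagonal_mul_diagonal]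
  congr 1
  rw [dg]
  congr 1
  ext σ
  rw [mul_div_cancel₀ _ (hQ0 _)]

lemma G_psi (Q : Fin N → ℂ) (a : Fin N → ℂ) (hQ0 : ∀ i, Q i ≠ 0) (z : Fin N → ℝ)
    (ψ : Equiv.Perm (Fin N) → ℂ) (h : ∀ k, y Q (fun i => a i / Q i) k *ᵥ ψ = (z k : ℂ) • ψ)
    (i : Fin N) : G z (KK Q i) i (List.finRange N) *ᵥ ψ = a i • ψ := by
  have e : G z (KK Q i) i (List.finRange N) =
      ∑ m, (E i m * ((z m : ℂ) • 1 - y Q (fun i => a i / Q i) m) + a i • E i m) := by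
    rw [G, Pair_J, KK, Dz, ← Finset.sum_sub_distrib, ← sub_eq_add_neg, ← Finset.sum_sub_distrib]
    apply Finset.sum_congr rfl
    intro m _
    rw [y, yt_eq Q a hQ0, mul_sub, mul_add, mul_add, E_dg, Finset.mul_sum, mul_smul_comm, mul_one]
    abel
  rw [e, Matrix.sum_mulVec]
  have : ∀ m, (E i m * ((z m : ℂ) • 1 - y Q (fun i => a i / Q i) m) + a i • E i m) *ᵥ ψ =
      a i • (E i m *ᵥ ψ) := by
    intro m
    rw [add_mulVec, ← mulVec_mulVec, sub_mulVec, smul_mulVec, one_mulVec, h, sub_self, mulVec_zero,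
      zero_add, smul_mulVec]
  simp only [this]
  rw [← Finset.smul_sum, ← Matrix.sum_mulVec, E_sum, one_mulVec]

lemma final (Q : Fin N → ℝ)
    (hQdist : Function.Injective Q) (hQ0 : ∀ i, Q i ≠ 0)
    (a : Fin N → ℂ) 
    (z : Fin N → ℝ)
    (hchar : (Zm (fun i => (Q i : ℂ)) a).charpoly = ∏ i, (X - C ((z i : ℂ))))
    (hsep : ∀ i j, i ≠ j → 1 ≤ |z i - z j|) (i : Fin N) : (a i).im = 0 := by
  have hpos : 0 < N := i.pos
  have hQc : Function.Injective (fun i => (Q i : ℂ)) := Complex.ofReal_injective.comp hQdist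
  have hQ0c : ∀ i, (Q i : ℂ) ≠ 0 := fun i => Complex.ofReal_ne_zero.2 (hQ0 i)
  have hzinj : Function.Injective z := by
    intro x y h
    by_contra hne
    have := hsep x y hne
    rw [h, sub_self, abs_zero] at this
    linarith
  obtain ⟨ψ, h1, ζ, h2, h3⟩ := exists_psi (fun i => (Q i : ℂ)) a hQc hQ0c ⟨0, hpos⟩ (by
    intro p hp; rw [Fin.lt_def] at hp; exact Nat.not_lt_zero _ hp)
  have h4 : ∀ k, ∃ m, ζ m = z k := by
    intro k
    have := h3 (z k)
    rw [hchar, eval_prod, Finset.prod_eq_zero (Finset.mem_univ k) (by simp)] at this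
    obtain ⟨m, _, hm⟩ := Finset.prod_eq_zero_iff.1 this.symm
    exact ⟨m, (sub_eq_zero.1 hm).symm⟩
  choose g hg using h4
  have hginj : Function.Injective g := by
    intro x y h
    apply hzinj
    have := hg x
    rw [h, hg y] at this
    exact_mod_cast this.symm
  obtain ⟨g', hg'⟩ := (Finite.injective_iff_surjective.1 hginj).hasRightInverse
  have hz : ∀ m, ζ m = (z (g' m) : ℂ) := by
    intro m
    rw [← hg, hg' m]
  apply real_spec_edge (fun m => z (g' m)) _ (KK (fun j => (Q j : ℂ)) i) (KK_comm _ i) (KK_conj Q i) i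
    (List.finRange N) (List.nodup_finRange N) (a i) ψ h1
  · apply G_psi _ a hQ0c
    intro k
    rw [h2, hz]
  · intro x y hxy
    apply hsep
    intro h
    exact hxy (hg'.injective h)

end CM

/-- If the eigenvalues of the matrix `Z^d` (diagonal `a i`, off-diagonal
`Q i/(Q j - Q i)` with `Q i` distinct nonzero reals) are real numbers
`z 1, …, z N` with `|z i - z j| ≥ 1` for `i ≠ j`, then all `a i` are real. -/
theorem stmt_13 (N : ℕ) (hN : 2 ≤ N) (Q : Fin N → ℝ)
    (hQdist : Function.Injective Q) (hQ0 : ∀ i, Q i ≠ 0)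
    (a : Fin N → ℂ) (Zd : Matrix (Fin N) (Fin N) ℂ)
    (hZd : ∀ i j, Zd i j = if i = j then a i
      else (Q i : ℂ) / ((Q j : ℂ) - (Q i : ℂ)))
    (z : Fin N → ℝ)
    (hchar : Matrix.charpoly Zd = ∏ i, (X - C ((z i : ℂ))))
    (hsep : ∀ i j, i ≠ j → 1 ≤ |z i - z j|) :
    ∀ i, ∃ r : ℝ, a i = (r : ℂ) := by
  intro i
  have hZ : Zd = CM.Zm (fun i => (Q i : ℂ)) a := by
    ext k l
    rw [hZd, CM.Zm, of_apply]
  rw [hZ] at hchar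
  refine ⟨(a i).re, ?_⟩
  apply Complex.ext
  · simp
  · simpa using CM.final Q hQdist hQ0 a z hchar hsep i
end

section
/- For distinct nonzero real numbers z_1,...,z_N with |z_i - z_j| > 1 for all i ≠ j: if the matrix Q^d with diagonal entries b_i and off-diagonal entries b_j/(z_i - z_j + 1) has N distinct nonzero real eigenvalues, then b_1,...,b_N are real. -/
open Matrix Polynomial

section Affine
variable {R : Type*} [Ring R]

/-- descending product `s (k-1) * ... * s 0` -/
def afP (s : ℕ → R) : ℕ → R
  | 0 => 1
  | k + 1 => s k * afP s k

/-- the commuting elements -/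
def afX (s : ℕ → R) (x : R) : ℕ → R
  | 0 => x
  | k + 1 => s k * afX s x k * s k

theorem afP_comm_high (s : ℕ → R) (n : ℕ)
    (hfar : ∀ i j, i + 1 < j → j < n → s i * s j = s j * s i)
    (k j : ℕ) (hkj : k < j) (hj : j < n) : s j * afP s k = afP s k * s j := by
  induction k with
  | zero => simp [afP]
  | succ k ih =>
    simp only [afP]
    rw [← mul_assoc, ← hfar k j (by omega) hj, mul_assoc, ih (by omega), mul_assoc]

theorem afP_shift (s : ℕ → R) (n : ℕ)
    (hbr : ∀ i, i + 1 < n → s i * s (i + 1) * s i = s (i + 1) * s i * s (i + 1))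
    (hfar : ∀ i j, i + 1 < j → j < n → s i * s j = s j * s i)
    (k j : ℕ) (hjk : j + 1 < k) (hk : k ≤ n) : s j * afP s k = afP s k * s (j + 1) := by
  induction k with
  | zero => omega
  | succ k ih =>
    rcases Nat.lt_or_ge (j + 1) k with h | h
    · simp only [afP]
      rw [← mul_assoc, hfar j k h (by omega), mul_assoc, ih h (by omega), mul_assoc]
    · obtain rfl : k = j + 1 := by omega
      simp only [afP]
      have h1 := afP_comm_high s n hfar j (j + 1) (by omega) (by omega)
      calc s j * (s (j + 1) * (s j * afP s j)) = (s j * s (j + 1) * s j) * afP s j := by noncomm_ring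
        _ = s (j + 1) * s j * (s (j + 1) * afP s j) := by
            rw [hbr j (by omega)]; noncomm_ring
        _ = _ := by rw [h1]; noncomm_ring

/-- `s (k-1) ... s 0 * P = P * (s k ... s 1)` in the form we need -/
theorem afP_shift_prod (s : ℕ → R) (n : ℕ)
    (hbr : ∀ i, i + 1 < n → s i * s (i + 1) * s i = s (i + 1) * s i * s (i + 1))
    (hfar : ∀ i j, i + 1 < j → j < n → s i * s j = s j * s i)
    (k : ℕ) (hk : k + 1 ≤ n) :
    afP s k * afP s n * s 0 = afP s n * afP s (k + 1) := by
  induction k with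
  | zero => simp [afP]
  | succ k ih =>
    have h := afP_shift s n hbr hfar n k (by omega) le_rfl
    calc afP s (k + 1) * afP s n * s 0 = s k * (afP s k * afP s n * s 0) := by
          simp only [afP]; noncomm_ring
      _ = (s k * afP s n) * afP s (k + 1) := by rw [ih (by omega)]; noncomm_ring
      _ = _ := by rw [h]; simp only [afP]; noncomm_ring

theorem afPi_P (s : ℕ → R) (p : R) (n : ℕ)
    (hp : ∀ i, i + 1 < n → p * s i = s (i + 1) * p) (k : ℕ) (hk : k + 1 ≤ n) :
    afP s (k + 1) * s 0 * p = afP s (k + 1) * s 0 * p ∧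
    ∀ t, t * t = 1 → t = s 0 → afP s (k + 1) * t * p = p * afP s k := by
  refine ⟨rfl, ?_⟩
  intro t ht hts
  induction k with
  | zero => simp [afP, ← hts, ht]
  | succ k ih =>
    have := ih (by omega)
    calc afP s (k + 1 + 1) * t * p = s (k + 1) * (afP s (k + 1) * t * p) := by
          rw [afP]; noncomm_ring
      _ = (s (k + 1) * p) * afP s k := by rw [this]; noncomm_ring
      _ = _ := by rw [← hp k (by omega)]; simp only [afP]; noncomm_ring

theorem afX_base (s : ℕ → R) (p : R) (n : ℕ)
    (hsq : ∀ i, i < n → s i * s i = 1)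
    (hbr : ∀ i, i + 1 < n → s i * s (i + 1) * s i = s (i + 1) * s i * s (i + 1))
    (hfar : ∀ i j, i + 1 < j → j < n → s i * s j = s j * s i)
    (hp : ∀ i, i + 1 < n → p * s i = s (i + 1) * p)
    (hp2 : ∀ m, n = m + 1 → p * p * s m = s 0 * (p * p)) (hn : 0 < n) :
    Commute (afX s (p * afP s n) 0) (afX s (p * afP s n) 1) := by
  obtain ⟨m, rfl⟩ : ∃ m, n = m + 1 := ⟨n - 1, by omega⟩
  have h1 := (afPi_P s p (m + 1) hp m le_rfl).2 (s 0) (hsq 0 hn) rfl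
  have h2 := afP_shift_prod s (m + 1) hbr hfar m le_rfl
  have h3 := hp2 m rfl
  simp only [afX, Commute, SemiconjBy]
  calc p * afP s (m + 1) * (s 0 * (p * afP s (m + 1)) * s 0)
      = p * (afP s (m + 1) * s 0 * p) * afP s (m + 1) * s 0 := by noncomm_ring
    _ = p * p * (afP s m * afP s (m + 1) * s 0) := by rw [h1]; noncomm_ring
    _ = p * p * (s m * afP s m) * afP s (m + 1) := by rw [h2]; simp only [afP]; noncomm_ring
    _ = (p * p * s m) * afP s m * afP s (m + 1) := by noncomm_ring
    _ = s 0 * p * (p * afP s m) * afP s (m + 1) := by rw [h3]; noncomm_ring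
    _ = _ := by rw [← h1]; noncomm_ring

theorem afX_base_s (s : ℕ → R) (p : R) (n : ℕ)
    (hbr : ∀ i, i + 1 < n → s i * s (i + 1) * s i = s (i + 1) * s i * s (i + 1))
    (hfar : ∀ i j, i + 1 < j → j < n → s i * s j = s j * s i)
    (hp : ∀ i, i + 1 < n → p * s i = s (i + 1) * p) (j : ℕ) (hj : j + 1 < n) :
    Commute (s (j + 1)) (p * afP s n) := by
  have h := afP_shift s n hbr hfar n j hj le_rfl
  simp only [Commute, SemiconjBy]
  rw [← mul_assoc, ← hp j hj, mul_assoc, h, mul_assoc]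

/-- `s j` commutes with `X i` for `j > i`. -/
theorem afX_high (s : ℕ → R) (x : R) (n : ℕ)
    (hfar : ∀ i j, i + 1 < j → j < n → s i * s j = s j * s i)
    (hx : ∀ j, j + 1 < n → Commute (s (j + 1)) x)
    (i j : ℕ) (hij : i < j) (hj : j < n) : Commute (s j) (afX s x i) := by
  induction i with
  | zero =>
    obtain ⟨m, rfl⟩ : ∃ m, j = m + 1 := ⟨j - 1, by omega⟩
    exact hx m hj
  | succ i ih =>
    have h : Commute (s j) (s i) := (hfar i j (by omega) hj).symm
    exact (h.mul_right (ih (by omega))).mul_right h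

theorem afX_low (s : ℕ → R) (x : R) (n : ℕ)
    (hbr : ∀ i, i + 1 < n → s i * s (i + 1) * s i = s (i + 1) * s i * s (i + 1))
    (hfar : ∀ i j, i + 1 < j → j < n → s i * s j = s j * s i)
    (hx : ∀ j, j + 1 < n → Commute (s (j + 1)) x)
    (i j : ℕ) (hij : j + 1 < i) (hi : i ≤ n) : Commute (s j) (afX s x i) := by
  induction i with
  | zero => omega
  | succ i ih =>
    rcases Nat.lt_or_ge (j + 1) i with h | h
    · have h' : Commute (s j) (s i) := hfar j i h (by omega)
      exact (h'.mul_right (ih h (by omega))).mul_right h'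
    · obtain rfl : i = j + 1 := by omega
      have h1 : s (j + 1) * afX s x j = afX s x j * s (j + 1) :=
        afX_high s x n hfar hx j (j + 1) (by omega) (by omega)
      have h2 := hbr j (by omega)
      simp only [afX, Commute, SemiconjBy]
      calc s j * (s (j + 1) * (s j * afX s x j * s j) * s (j + 1))
          = (s j * s (j + 1) * s j) * afX s x j * s j * s (j + 1) := by noncomm_ring
        _ = s (j + 1) * s j * (s (j + 1) * afX s x j) * s j * s (j + 1) := by
            rw [h2]; noncomm_ring
        _ = s (j + 1) * s j * afX s x j * (s (j + 1) * s j * s (j + 1)) := by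
            rw [h1]; noncomm_ring
        _ = _ := by rw [← h2]; noncomm_ring

theorem afX_comm (s : ℕ → R) (x : R) (n : ℕ)
    (hbr : ∀ i, i + 1 < n → s i * s (i + 1) * s i = s (i + 1) * s i * s (i + 1))
    (hfar : ∀ i j, i + 1 < j → j < n → s i * s j = s j * s i)
    (hx : ∀ j, j + 1 < n → Commute (s (j + 1)) x)
    (h01 : 0 < n → Commute (afX s x 0) (afX s x 1))
    (i j : ℕ) (hij : i < j) (hj : j ≤ n) : Commute (afX s x i) (afX s x j) := by
  induction i with
  | zero =>
    induction j with
    | zero => omega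
    | succ j ih =>
      rcases Nat.eq_zero_or_pos j with rfl | h
      · exact h01 (by omega)
      · have h1 : Commute (afX s x 0) (s j) :=
          (afX_high s x n hfar hx 0 j h (by omega)).symm
        exact (h1.mul_right (ih (by omega) (by omega))).mul_right h1
  | succ i ih =>
    have h1 : Commute (s i) (afX s x j) := afX_low s x n hbr hfar hx j i hij hj
    exact (h1.mul_left (ih (by omega))).mul_left h1

end Affine


section YangBaxter
variable {R : Type*} [Ring R]

structure YBF (A : ℕ → ℝ → ℝ → R) (n : ℕ) : Prop where
  yb : ∀ i, i + 1 < n → ∀ a b c : ℝ, a ≠ b → a ≠ c → b ≠ c →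
    A i b c * A (i + 1) a c * A i a b = A (i + 1) a b * A i a c * A (i + 1) b c
  far : ∀ i j, i + 1 < j → j < n → ∀ a b c d : ℝ, A i a b * A j c d = A j c d * A i a b

def ybM (A : ℕ → ℝ → ℝ → R) : ℕ → ℝ → (ℕ → ℝ) → R
  | 0, _, _ => 1
  | k + 1, u, v => A k u (v k) * ybM A k u v

def ybS (A : ℕ → ℝ → ℝ → R) : ℕ → (ℕ → ℝ) → R
  | 0, _ => 1
  | k + 1, v => ybS A k (fun i => v (i + 1)) * ybM A k (v 0) (fun i => v (i + 1))

def ybcyc : ℕ → (ℕ → ℝ) → (ℕ → ℝ)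
  | 0, v => v
  | k + 1, v => fun i => ybcyc k v (Equiv.swap k (k + 1) i)

def ybrv : ℕ → (ℕ → ℝ) → (ℕ → ℝ)
  | 0, v => v
  | k + 1, v => ybrv k (ybcyc k v)

theorem ybcyc_apply (k : ℕ) (v : ℕ → ℝ) (i : ℕ) :
    ybcyc k v i = if i < k then v (i + 1) else if i = k then v 0 else v i := by
  induction k generalizing i with
  | zero => 
    by_cases h : i = 0
    · subst h; simp [ybcyc]
    · simp [ybcyc, h]
  | succ k ih =>
    simp only [ybcyc, ih, Equiv.swap_apply_def]
    split_ifs <;> first | rfl | (exfalso; omega) | (congr 1; omega)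

theorem ybcyc_inj (k : ℕ) (v : ℕ → ℝ) (hv : Function.Injective v) :
    Function.Injective (ybcyc k v) := by
  induction k with
  | zero => exact hv
  | succ k ih => exact ih.comp (Equiv.injective _)

theorem ybcyc_ne (k : ℕ) (v : ℕ → ℝ) (u : ℝ) (hv : ∀ i, u ≠ v i) :
    ∀ i, u ≠ ybcyc k v i := by
  induction k with
  | zero => exact hv
  | succ k ih => exact fun i => ih _

theorem ybrv_apply (k : ℕ) (v : ℕ → ℝ) (i : ℕ) :
    ybrv k v i = if i < k then v (k - 1 - i) else v i := by
  induction k generalizing v with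
  | zero => simp [ybrv]
  | succ k ih =>
    simp only [ybrv, ih, ybcyc_apply]
    split_ifs <;> first | rfl | (exfalso; omega) | (congr 1; omega)

theorem ybM_congr (A B : ℕ → ℝ → ℝ → R) (k : ℕ) (u : ℝ) (v v' : ℕ → ℝ)
    (hA : ∀ i, i < k → A i = B i)
    (h : ∀ i, i < k → v i = v' i) : ybM A k u v = ybM B k u v' := by
  induction k with
  | zero => rfl
  | succ k ih =>
    simp only [ybM]
    rw [hA k (by omega), h k (by omega),
      ih (fun i hi => hA i (by omega)) (fun i hi => h i (by omega))]

theorem ybS_congr (A B : ℕ → ℝ → ℝ → R) (k : ℕ) (v v' : ℕ → ℝ)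
    (hA : ∀ i, i + 1 < k → A i = B i)
    (h : ∀ i, i < k → v i = v' i) : ybS A k v = ybS B k v' := by
  induction k generalizing v v' with
  | zero => rfl
  | succ k ih =>
    simp only [ybS]
    rw [h 0 (by omega), ih _ (fun i => v' (i + 1)) (fun i hi => hA i (by omega))
      (fun i hi => h (i + 1) (by omega)),
      ybM_congr A B k (v' 0) (fun i => v (i + 1)) (fun i => v' (i + 1))
        (fun i hi => hA i (by omega)) (fun i hi => h (i + 1) (by omega))]

theorem ybM_far (A : ℕ → ℝ → ℝ → R) (n : ℕ) (hA : YBF A n) (k j : ℕ) (hkj : k < j) (hj : j < n)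
    (a b u : ℝ) (v : ℕ → ℝ) : A j a b * ybM A k u v = ybM A k u v * A j a b := by
  induction k with
  | zero => simp [ybM]
  | succ k ih =>
    simp only [ybM]
    rw [← mul_assoc, ← hA.far k j (by omega) hj, mul_assoc, ih (by omega), mul_assoc]

theorem ybM_one (A : ℕ → ℝ → ℝ → R) (n : ℕ) (hA : YBF A n) (k i : ℕ) (hik : i + 1 < k)
    (hk : k ≤ n) (u : ℝ) (v : ℕ → ℝ) (hv : Function.Injective v) (hu : ∀ i, u ≠ v i) :
    A i (v i) (v (i + 1)) * ybM A k u v =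
      ybM A k u (fun j => v (Equiv.swap i (i + 1) j)) * A (i + 1) (v i) (v (i + 1)) := by
  induction k with
  | zero => omega
  | succ k ih =>
    rcases Nat.lt_or_ge (i + 1) k with h | h
    · simp only [ybM]
      rw [← mul_assoc, hA.far i k h (by omega), mul_assoc, ih h (by omega),
        Equiv.swap_apply_of_ne_of_ne (by omega) (by omega), mul_assoc]
    · obtain rfl : k = i + 1 := by omega
      have h1 := ybM_far A n hA i (i + 1) (by omega) (by omega) (v i) (v (i + 1)) u v
      have h2 := hA.yb i (by omega) u (v i) (v (i + 1)) (hu _) (hu _)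
        (fun h => by have := hv h; omega)
      have h3 : ybM A i u (fun j => v (Equiv.swap i (i + 1) j)) = ybM A i u v :=
        ybM_congr A A i u _ _ (fun _ _ => rfl) (fun j hj => by
          rw [Equiv.swap_apply_of_ne_of_ne (by omega) (by omega)])
      simp only [ybM, Equiv.swap_apply_left, Equiv.swap_apply_right, h3]
      rw [mul_assoc, mul_assoc, ← h1, ← mul_assoc, ← mul_assoc, h2]
      noncomm_ring

theorem ybM_M (A : ℕ → ℝ → ℝ → R) (n : ℕ) (hA : YBF A n) (k j : ℕ) (hjk : j < k)
    (hk : k ≤ n) (u : ℝ) (v : ℕ → ℝ) (hv : Function.Injective v) (hu : ∀ i, u ≠ v i) :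
    ybM A j (v 0) (fun i => v (i + 1)) * ybM A k u v =
      ybM A k u (ybcyc j v) * ybM (fun i => A (i + 1)) j (v 0) (fun i => v (i + 1)) := by
  induction j with
  | zero => simp [ybM, ybcyc]
  | succ j ih =>
    have h1 := ybM_one A n hA k j hjk hk u (ybcyc j v) (ybcyc_inj j v hv) (ybcyc_ne j v u hu)
    have e1 : ybcyc j v j = v 0 := by simp [ybcyc_apply]
    have e2 : ybcyc j v (j + 1) = v (j + 1) := by simp [ybcyc_apply]
    rw [e1, e2] at h1
    simp only [ybM, ybcyc]
    rw [mul_assoc, ih (by omega), ← mul_assoc, h1, mul_assoc]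

theorem ybS_cyc (A : ℕ → ℝ → ℝ → R) (k : ℕ) (v : ℕ → ℝ) :
    ybS A k (fun i => v (i + 1)) = ybS A k (ybcyc k v) :=
  ybS_congr A A k _ _ (fun _ _ => rfl) (fun i hi => by simp [ybcyc_apply, hi])

theorem ybS_M (A : ℕ → ℝ → ℝ → R) (n : ℕ) (hA : YBF A n) (k j : ℕ) (hjk : j ≤ k)
    (hk : k ≤ n) (u : ℝ) (v : ℕ → ℝ) (hv : Function.Injective v) (hu : ∀ i, u ≠ v i) :
    ybS A j v * ybM A k u v = ybM A k u (ybrv j v) * ybS (fun i => A (i + 1)) j v := by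
  induction j generalizing v with
  | zero => simp [ybS, ybrv]
  | succ j ih =>
    simp only [ybS, ybrv]
    rw [mul_assoc, ybM_M A n hA k j (by omega) hk u v hv hu, ybS_cyc A, ← mul_assoc,
      ih (by omega) (ybcyc j v) (ybcyc_inj j v hv) (ybcyc_ne j v u hu),
      ybS_cyc (fun i => A (i + 1)), mul_assoc]

theorem ybS_succ' (A : ℕ → ℝ → ℝ → R) (k : ℕ) (hA : YBF A k)
    (v : ℕ → ℝ) (hv : Function.Injective v) :
    ybS A (k + 1) v = ybM A k (v 0) (ybrv k (fun i => v (i + 1))) *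
      ybS (fun i => A (i + 1)) k (fun i => v (i + 1)) := by
  rw [ybS, ybS_M A k hA k k le_rfl le_rfl]
  · intro i j h; have := hv h; omega
  · intro i h; have := hv h; omega

theorem YBF.shift {A : ℕ → ℝ → ℝ → R} {n : ℕ} (hA : YBF A (n + 1)) :
    YBF (fun i => A (i + 1)) n :=
  ⟨fun i hi => hA.yb (i + 1) (by omega), fun i j hij hj => hA.far _ _ (by omega) (by omega)⟩

/-- ascending product -/
def ybN (A : ℕ → ℝ → ℝ → R) : ℕ → ℝ → (ℕ → ℝ) → R
  | 0, _, _ => 1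
  | k + 1, u, v => ybN A k u v * A k u (v k)

theorem ybN_eq (A : ℕ → ℝ → ℝ → R) (k : ℕ) (u : ℝ) (v : ℕ → ℝ) :
    ybN A (k + 1) u v = A 0 u (v 0) * ybN (fun i => A (i + 1)) k u (fun i => v (i + 1)) := by
  induction k with
  | zero => simp [ybN]
  | succ k ih => rw [ybN, ih, ybN, mul_assoc]

theorem ybN_eq_M (A : ℕ → ℝ → ℝ → R) (k : ℕ) (u : ℝ) (v : ℕ → ℝ) :
    ybN A k u v = ybM (fun i => A (k - 1 - i)) k u (ybrv k v) := by
  induction k generalizing A v with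
  | zero => rfl
  | succ k ih =>
    rw [ybN_eq, ih, ybM]
    congr 1
    · simp [ybrv_apply]
    · apply ybM_congr
      · intro i hi
        show A (k - 1 - i + 1) = A (k + 1 - 1 - i)
        congr 1; omega
      · intro i hi
        simp only [ybrv_apply]
        rw [if_pos hi, if_pos (by omega)]
        congr 1; omega

theorem ybM_star' [StarRing R] (A : ℕ → ℝ → ℝ → R) (k : ℕ)
    (hs : ∀ i, i < k → ∀ a b, star (A i a b) = A i a b) (u : ℝ) (v : ℕ → ℝ) :
    star (ybM A k u v) = ybN A k u v := by
  induction k with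
  | zero => simp [ybM, ybN]
  | succ k ih =>
    rw [ybM, ybN, star_mul, ih (fun i hi => hs i (by omega)), hs k (by omega)]

theorem ybS_star [StarRing R] (A : ℕ → ℝ → ℝ → R) (k : ℕ)
    (hs : ∀ i, i < k → ∀ a b, star (A i a b) = A i a b)
    (hA : YBF (fun i => A (k - 1 - i)) k) (v : ℕ → ℝ) (hv : Function.Injective v) :
    star (ybS A (k + 1) v) = ybS (fun i => A (k - 1 - i)) (k + 1) v := by
  induction k generalizing v with
  | zero => simp [ybS, ybM]
  | succ k ih =>
    have e : (fun i => A (k + 1 - 1 - (i + 1))) = (fun i => A (k - 1 - i)) := by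
      funext i; congr 1; omega
    have hsh := hA.shift
    simp only [e] at hsh
    rw [ybS_succ' _ _ hA v hv]
    simp only [e]
    rw [← ih (fun i hi => hs i (by omega)) hsh (fun i => v (i + 1))
      (fun i j h => by have := hv h; omega), ← ybN_eq_M, ← ybM_star' A _ hs, ← star_mul]
    rfl

theorem ybM_conj (A B : ℕ → ℝ → ℝ → R) (r : R) (hr : r * r = 1) (k : ℕ)
    (h : ∀ i, i < k → ∀ a b, r * A i a b * r = B i a b) (u : ℝ) (v : ℕ → ℝ) :
    r * ybM A k u v * r = ybM B k u v := by
  induction k with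
  | zero => simp [ybM, hr]
  | succ k ih =>
    simp only [ybM]
    rw [← ih (fun i hi => h i (by omega)), ← h k (by omega)]
    calc r * (A k u (v k) * ybM A k u v) * r = r * A k u (v k) * 1 * ybM A k u v * r := by
          noncomm_ring
      _ = _ := by rw [← hr]; noncomm_ring

theorem ybS_conj (A B : ℕ → ℝ → ℝ → R) (r : R) (hr : r * r = 1) (k : ℕ)
    (h : ∀ i, i + 1 < k → ∀ a b, r * A i a b * r = B i a b) (v : ℕ → ℝ) :
    r * ybS A k v * r = ybS B k v := by
  induction k generalizing v with
  | zero => simp [ybS, hr]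
  | succ k ih =>
    simp only [ybS]
    rw [← ih (fun i hi => h i (by omega)),
      ← ybM_conj A B r hr k (fun i hi => h i (by omega))]
    calc r * (ybS A k (fun i => v (i + 1)) * ybM A k (v 0) (fun i => v (i + 1))) * r 
        = r * ybS A k (fun i => v (i + 1)) * 1 * ybM A k (v 0) (fun i => v (i + 1)) * r := by
          noncomm_ring
      _ = _ := by rw [← hr]; noncomm_ring

theorem ybS_herm [StarRing R] (A : ℕ → ℝ → ℝ → R) (n : ℕ) (r : R) (hr : r * r = 1)
    (hrs : star r = r)
    (hs : ∀ i, i < n → ∀ a b, star (A i a b) = A i a b)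
    (h : ∀ i, i < n → ∀ a b, r * A i a b * r = A (n - 1 - i) a b)
    (hA : YBF (fun i => A (n - 1 - i)) n) (v : ℕ → ℝ) (hv : Function.Injective v) :
    star (r * ybS A (n + 1) v) = r * ybS A (n + 1) v := by
  rw [star_mul, hrs, ybS_star A n hs hA v hv,
    ← ybS_conj A (fun i => A (n - 1 - i)) r hr (n + 1) (fun i hi => h i (by omega)) v,
    mul_assoc, hr, mul_one]

theorem ybM_unit (A : ℕ → ℝ → ℝ → R) (k : ℕ) (u : ℝ) (v : ℕ → ℝ)
    (h : ∀ i, i < k → IsUnit (A i u (v i))) : IsUnit (ybM A k u v) := by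
  induction k with
  | zero => exact isUnit_one
  | succ k ih => exact (h k (by omega)).mul (ih (fun i hi => h i (by omega)))

theorem ybS_unit (A : ℕ → ℝ → ℝ → R) (n k : ℕ) (hk : k ≤ n + 1) (v : ℕ → ℝ)
    (h : ∀ i, i < n → ∀ a b : ℕ, a < k → b < k → a ≠ b → IsUnit (A i (v a) (v b))) :
    IsUnit (ybS A k v) := by
  induction k generalizing v with
  | zero => exact isUnit_one
  | succ k ih =>
    refine (ih (by omega) _ fun i hi a b ha hb hab => 
      h i hi (a + 1) (b + 1) (by omega) (by omega) (by omega)).mul (ybM_unit A k _ _ ?_)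
    intro i hi
    exact h i (by omega) 0 (i + 1) (by omega) (by omega) (by omega)

theorem ybM_transport {W : Type*} (A : ℕ → ℝ → ℝ → R) (n : ℕ) (act : R → W → W)
    (h1 : ∀ x, act 1 x = x) (hm : ∀ a b x, act (a * b) x = act a (act b x))
    (T : (ℕ → ℝ) → W → Prop)
    (hT : ∀ v x i, i < n → T v x →
      T (fun j => v (Equiv.swap i (i + 1) j)) (act (A i (v i) (v (i + 1))) x))
    (k : ℕ) (hk : k ≤ n) (v : ℕ → ℝ) (x : W) (hx : T v x) :
    T (ybcyc k v) (act (ybM A k (v 0) (fun i => v (i + 1))) x) := by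
  induction k with
  | zero => simpa [ybcyc, ybM, h1] using hx
  | succ k ih =>
    have := hT _ _ k (by omega) (ih (by omega))
    have e1 : ybcyc k v k = v 0 := by simp [ybcyc_apply]
    have e2 : ybcyc k v (k + 1) = v (k + 1) := by simp [ybcyc_apply]
    rw [e1, e2, ← hm] at this
    exact this

theorem ybS_transport {W : Type*} (A : ℕ → ℝ → ℝ → R) (n : ℕ) (act : R → W → W)
    (h1 : ∀ x, act 1 x = x) (hm : ∀ a b x, act (a * b) x = act a (act b x))
    (T : (ℕ → ℝ) → W → Prop)
    (hT : ∀ v x i, i < n → T v x →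
      T (fun j => v (Equiv.swap i (i + 1) j)) (act (A i (v i) (v (i + 1))) x))
    (k : ℕ) (hk : k ≤ n + 1) (v : ℕ → ℝ) (x : W) (hx : T v x) :
    T (ybrv k v) (act (ybS A k v) x) := by
  induction k generalizing v x with
  | zero => simpa [ybrv, ybS, h1] using hx
  | succ k ih =>
    have := ih (by omega) _ _ (ybM_transport A n act h1 hm T hT k (by omega) v x hx)
    rw [← hm, ← ybS_cyc] at this
    exact this

end YangBaxter


section PDPath
open scoped ComplexOrder

theorem pd_path {m : Type*} [Fintype m] [DecidableEq m] (H : unitInterval → Matrix m m ℂ)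
    (hc : Continuous H) (hh : ∀ t, (H t).IsHermitian) (hu : ∀ t, IsUnit (H t))
    (h0 : H 0 = 1) : (H 1).PosDef := by
  have key : ∀ t, (H t).PosDef ↔ ∀ x : m → ℂ, 0 ≤ (star x ⬝ᵥ (H t *ᵥ x)).re := by
    intro t
    constructor
    · intro h x
      exact (Complex.le_def.mp (h.posSemidef.dotProduct_mulVec_nonneg x)).1
    · intro h
      have : (H t).PosSemidef := .of_dotProduct_mulVec_nonneg (hh t) fun x => by
        rw [Complex.le_def]
        exact ⟨h x, ((hh t).im_star_dotProduct_mulVec_self x).symm⟩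
      exact this.posDef_iff_isUnit.mpr (hu t)
  have key2 : ∀ t, (H t).PosDef ↔
      ∀ x ∈ Metric.sphere (0 : m → ℂ) 1, 0 < (star x ⬝ᵥ (H t *ᵥ x)).re := by
    intro t
    constructor
    · intro h x hx
      have hx0 : x ≠ 0 := by
        rintro rfl
        simp at hx
      exact (Complex.lt_def.mp (h.dotProduct_mulVec_pos hx0)).1
    · intro h
      rw [key]
      intro x
      by_cases hx : x = 0
      · subst hx; simp
      have hn : 0 < ‖x‖ := norm_pos_iff.mpr hx
      have h1 := h (((‖x‖ : ℂ)⁻¹) • x) (by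
        simp [norm_smul, hn.ne'])
      have e : star (((‖x‖ : ℂ)⁻¹) • x) ⬝ᵥ (H t *ᵥ (((‖x‖ : ℂ)⁻¹) • x)) =
        ((‖x‖⁻¹ * ‖x‖⁻¹ : ℝ) : ℂ) * (star x ⬝ᵥ (H t *ᵥ x)) := by
        rw [star_smul, mulVec_smul, smul_dotProduct, dotProduct_smul]
        simp [mul_assoc]
      rw [e, Complex.re_ofReal_mul] at h1
      have : 0 < ‖x‖⁻¹ * ‖x‖⁻¹ := by positivity
      exact (pos_of_mul_pos_right h1 this.le).le
  have hq : Continuous fun p : unitInterval × (m → ℂ) => (star p.2 ⬝ᵥ (H p.1 *ᵥ p.2)).re := by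
    apply Complex.continuous_re.comp
    apply Continuous.dotProduct
    · exact continuous_snd.star
    · exact (hc.comp continuous_fst).matrix_mulVec continuous_snd
  have hclopen : IsClopen {t | (H t).PosDef} := by
    constructor
    · have : {t | (H t).PosDef} = ⋂ x : m → ℂ, {t | 0 ≤ (star x ⬝ᵥ (H t *ᵥ x)).re} := by
        ext t; simp [key]
      rw [this]
      refine isClosed_iInter fun x => isClosed_le continuous_const ?_
      exact hq.comp (continuous_id.prodMk continuous_const)
    · rw [isOpen_iff_mem_nhds]
      intro t ht
      have ht' := (key2 t).mp ht
      have := (isCompact_sphere (0 : m → ℂ) 1).eventually_forall_of_forall_eventually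
        (x₀ := t) (P := fun t x => 0 < (star x ⬝ᵥ (H t *ᵥ x)).re) (fun y hy =>
          (hq.continuousAt (x := (t, y))).eventually (lt_mem_nhds (ht' y hy)))
      filter_upwards [this] with s hs
      exact (key2 s).mpr hs
  have huniv := hclopen.eq_univ ⟨0, by simpa [h0] using Matrix.PosDef.one⟩
  have : (1 : unitInterval) ∈ {t | (H t).PosDef} := by rw [huniv]; trivial
  exact this

end PDPath


section Positions

def pos (n i : ℕ) : Fin (n + 1) := Fin.ofNat (n + 1) i

theorem pos_val (n i : ℕ) (h : i ≤ n) : (pos n i).val = i := by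
  simp [pos, Fin.ofNat, Nat.mod_eq_of_lt (Nat.lt_succ_of_le h)]

theorem pos_ne (n i j : ℕ) (hi : i ≤ n) (hj : j ≤ n) (h : i ≠ j) : pos n i ≠ pos n j := by
  intro e
  have := congrArg Fin.val e
  rw [pos_val n i hi, pos_val n j hj] at this
  exact h this

theorem pos_self (n : ℕ) (i : Fin (n + 1)) : pos n i.val = i := by
  apply Fin.ext
  rw [pos_val n _ (by omega)]

def sw (n i : ℕ) : Equiv.Perm (Fin (n + 1)) := Equiv.swap (pos n i) (pos n (i + 1))

theorem sw_sq (n i : ℕ) : sw n i * sw n i = 1 := Equiv.swap_mul_self _ _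

theorem sw_inv (n i : ℕ) : (sw n i)⁻¹ = sw n i := Equiv.swap_inv _ _

theorem sw_braid (n i : ℕ) (h : i + 1 < n) :
    sw n i * sw n (i + 1) * sw n i = sw n (i + 1) * sw n i * sw n (i + 1) := by
  have h1 := pos_ne n i (i + 1) (by omega) (by omega) (by omega)
  have h2 := pos_ne n i (i + 2) (by omega) (by omega) (by omega)
  have h3 := pos_ne n (i + 1) (i + 2) (by omega) (by omega) (by omega)
  unfold sw
  rw [Equiv.swap_mul_swap_mul_swap h1 h2, Equiv.swap_comm (pos n i),
    Equiv.swap_comm (pos n (i + 1)) (pos n (i + 1 + 1)),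
    Equiv.swap_mul_swap_mul_swap h3.symm h2.symm, Equiv.swap_comm]

theorem sw_far (n i j : ℕ) (hij : i + 1 < j) (h : j < n) :
    sw n i * sw n j = sw n j * sw n i := by
  have h1 := pos_ne n i j (by omega) (by omega) (by omega)
  have h2 := pos_ne n i (j + 1) (by omega) (by omega) (by omega)
  have h3 := pos_ne n (i + 1) j (by omega) (by omega) (by omega)
  have h4 := pos_ne n (i + 1) (j + 1) (by omega) (by omega) (by omega)
  unfold sw
  ext x
  simp only [Equiv.Perm.mul_apply, Equiv.swap_apply_def]
  grind

theorem pos_rev (n i : ℕ) (h : i ≤ n) : Fin.rev (pos n i) = pos n (n - i) := by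
  apply Fin.ext
  rw [Fin.val_rev, pos_val n i h, pos_val n _ (by omega)]
  omega

theorem rev_sq (n : ℕ) : (Fin.revPerm : Equiv.Perm (Fin (n + 1))) * Fin.revPerm = 1 := by
  ext x; simp

theorem rev_inv (n : ℕ) : (Fin.revPerm : Equiv.Perm (Fin (n + 1)))⁻¹ = Fin.revPerm :=
  inv_eq_of_mul_eq_one_left (rev_sq n)

theorem rev_sw (n i : ℕ) (h : i < n) :
    (Fin.revPerm : Equiv.Perm (Fin (n + 1))) * sw n i * Fin.revPerm = sw n (n - 1 - i) := by
  have := Equiv.swap_apply_apply (Fin.revPerm : Equiv.Perm (Fin (n + 1))) (pos n i) (pos n (i + 1))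
  rw [rev_inv] at this
  unfold sw
  rw [← this, Fin.revPerm_apply, Fin.revPerm_apply, pos_rev n i (by omega),
    pos_rev n (i + 1) (by omega), Equiv.swap_comm]
  congr 2 <;> omega

end Positions

section AMat
variable {R : Type*} [Ring R] [Algebra ℝ R]

noncomputable def rA (s : ℕ → R) (t : ℝ) (i : ℕ) (a b : ℝ) : R :=
  (1 - t / (a - b))⁻¹ • (s i - (t / (a - b)) • (1 : R))

theorem rA_yb_aux (s r : R) (hs : s * s = 1) (hr : r * r = 1) (hb : s * r * s = r * s * r)
    (x y w : ℝ) (h : w * (x + y) = x * y) :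
    (s - y • (1 : R)) * (r - w • (1 : R)) * (s - x • (1 : R)) =
      (r - x • (1 : R)) * (s - w • (1 : R)) * (r - y • (1 : R)) := by
  simp only [sub_mul, mul_sub, smul_mul_assoc, mul_smul_comm, mul_one, one_mul, smul_smul, hs, hr,
    hb, smul_sub]
  have key : (w * (x + y) - x * y) • (s - r) = 0 := by rw [h, sub_self, zero_smul]
  rw [← sub_eq_zero, ← key]
  module

theorem rA_yb (s : ℕ → R) (t : ℝ) (i j : ℕ) (hs : s i * s i = 1) (hr : s j * s j = 1)
    (hb : s i * s j * s i = s j * s i * s j) (a b c : ℝ) (hab : a ≠ b) (hac : a ≠ c)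
    (hbc : b ≠ c) : rA s t i b c * rA s t j a c * rA s t i a b =
      rA s t j a b * rA s t i a c * rA s t j b c := by
  have h : t / (a - c) * (t / (a - b) + t / (b - c)) = t / (a - b) * (t / (b - c)) := by
    have h1 := sub_ne_zero.mpr hab
    have h2 := sub_ne_zero.mpr hac
    have h3 := sub_ne_zero.mpr hbc
    field_simp
    ring
  simp only [rA, smul_mul_smul_comm]
  rw [rA_yb_aux (s i) (s j) hs hr hb _ _ _ h]
  congr 1
  ring

theorem rA_far (s : ℕ → R) (t : ℝ) (i j : ℕ) (h : s i * s j = s j * s i) (a b c d : ℝ) :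
    rA s t i a b * rA s t j c d = rA s t j c d * rA s t i a b := by
  have h1 : Commute (s i) (s j) := h
  have : Commute (s i - (t / (a - b)) • (1 : R)) (s j - (t / (c - d)) • (1 : R)) := by
    apply Commute.sub_left <;> apply Commute.sub_right
    · exact h1
    · exact (Commute.one_right _).smul_right _
    · exact (Commute.one_left _).smul_left _
    · exact ((Commute.one_right _).smul_right _).smul_left _
  exact ((this.smul_left _).smul_right _)

theorem rA_star [StarRing R] [StarModule ℝ R] (s : ℕ → R) (t : ℝ) (i : ℕ)
    (h : star (s i) = s i) (a b : ℝ) : star (rA s t i a b) = rA s t i a b := by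
  simp [rA, h]

theorem rA_conj (s : ℕ → R) (t : ℝ) (i j : ℕ) (r : R) (hr : r * r = 1)
    (h : r * s i * r = s j) (a b : ℝ) : r * rA s t i a b * r = rA s t j a b := by
  simp only [rA, mul_smul_comm, smul_mul_assoc, mul_sub, sub_mul, h, mul_one, hr]

theorem rA_unit (s : ℕ → R) (t : ℝ) (i : ℕ) (hs : s i * s i = 1) (a b : ℝ)
    (ht : |t| ≤ 1) (hab : 1 < |a - b|) : IsUnit (rA s t i a b) ∧ 1 - t / (a - b) ≠ 0 := by
  set c := t / (a - b) with hc
  have h1 : |c| < 1 := by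
    rw [hc, abs_div, div_lt_one (by linarith)]
    linarith
  obtain ⟨h2, h3⟩ := abs_lt.mp h1
  have h4 : 1 - c ≠ 0 := by linarith
  have h5 : 1 + c ≠ 0 := by linarith
  have e : (1 - c)⁻¹ * (1 + c)⁻¹ * (1 - c * c) = 1 := by
    field_simp
    ring
  refine ⟨⟨⟨rA s t i a b, (1 + c)⁻¹ • (s i + c • (1 : R)), ?_, ?_⟩, rfl⟩, h4⟩
  · simp only [rA, ← hc, smul_mul_smul_comm]
    have : (s i - c • (1 : R)) * (s i + c • (1 : R)) = (1 - c * c) • (1 : R) := by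
      simp only [sub_mul, mul_add, smul_mul_assoc, mul_smul_comm, mul_one, one_mul, hs]
      module
    rw [this, smul_smul, e, one_smul]
  · simp only [rA, ← hc, smul_mul_smul_comm]
    have : (s i + c • (1 : R)) * (s i - c • (1 : R)) = (1 - c * c) • (1 : R) := by
      simp only [add_mul, mul_sub, smul_mul_assoc, mul_smul_comm, mul_one, one_mul, hs]
      module
    rw [this, smul_smul, mul_comm (1 + c)⁻¹, e, one_smul]

end AMat

theorem ybS_cont {R : Type*} [Ring R] {Y : Type*} [TopologicalSpace Y] [TopologicalSpace R] [ContinuousMul R]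
    (A : Y → ℕ → ℝ → ℝ → R) (k : ℕ) (v : ℕ → ℝ)
    (h : ∀ i a b : ℕ, a ≠ b → Continuous fun t => A t i (v a) (v b)) :
    Continuous fun t => ybS (A t) k v := by
  induction k generalizing v with
  | zero => exact continuous_const
  | succ k ih =>
    refine (ih _ fun i a b hab => h i (a + 1) (b + 1) (by omega)).mul ?_
    have : ∀ k : ℕ, Continuous fun t => ybM (A t) k (v 0) (fun i => v (i + 1)) := by
      intro k
      induction k with
      | zero => exact continuous_const
      | succ k ih => exact (h k 0 (k + 1) (by omega)).mul ih
    exact this k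

section VSide
open scoped ComplexOrder

abbrev TT (n : ℕ) := Fin (n + 1) → Fin (n + 1)

def pm (n : ℕ) (g : Equiv.Perm (Fin (n + 1))) : Matrix (TT n) (TT n) ℂ :=
  fun τ τ' => if τ' = τ ∘ g then 1 else 0

theorem pm_mulVec (n : ℕ) (g : Equiv.Perm (Fin (n + 1))) (f : TT n → ℂ) (τ : TT n) :
    (pm n g *ᵥ f) τ = f (τ ∘ g) := by
  simp [Matrix.mulVec, dotProduct, pm]

theorem pm_mul (n : ℕ) (g h : Equiv.Perm (Fin (n + 1))) : pm n g * pm n h = pm n (g * h) := by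
  ext τ τ'
  have := pm_mulVec n g (fun x => pm n h x τ') τ
  simp only [Matrix.mul_apply]
  simp only [Matrix.mulVec, dotProduct] at this
  rw [this]
  rfl

theorem pm_one (n : ℕ) : pm n 1 = 1 := by
  ext τ τ'
  simp [pm, Matrix.one_apply, eq_comm]

theorem pm_star (n : ℕ) (g : Equiv.Perm (Fin (n + 1))) : star (pm n g) = pm n g⁻¹ := by
  ext τ τ'
  simp only [pm, Matrix.star_apply]
  have : τ = τ' ∘ g ↔ τ' = τ ∘ (g⁻¹ : Equiv.Perm (Fin (n + 1))) := by
    constructor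
    · rintro rfl; funext x; simp
    · rintro rfl; funext x; simp
  simp only [this]
  split_ifs <;> simp

noncomputable def zext (n : ℕ) (z : Fin (n + 1) → ℝ) (w : Equiv.Perm (Fin (n + 1))) (i : ℕ) : ℝ :=
  if i ≤ n then z (w (pos n i)) else (∑ j, |z j|) + 2 * i

theorem zext_sep (n : ℕ) (z : Fin (n + 1) → ℝ) (hsep : ∀ i j, i ≠ j → 1 < |z i - z j|)
    (w : Equiv.Perm (Fin (n + 1))) (i j : ℕ) (hij : i ≠ j) :
    1 < |zext n z w i - zext n z w j| := by
  have hz : ∀ a, z a ≤ ∑ j, |z j| := fun a =>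
    (le_abs_self _).trans (Finset.single_le_sum (f := fun j => |z j|)
      (fun i _ => abs_nonneg _) (Finset.mem_univ a))
  unfold zext
  split_ifs with h1 h2 h2
  · exact hsep _ _ fun h => pos_ne n i j h1 h2 hij (w.injective h)
  · rw [abs_sub_comm, lt_abs]; left
    have : (1 : ℝ) ≤ j := by exact_mod_cast (by omega : 1 ≤ j)
    linarith [hz (w (pos n i))]
  · rw [lt_abs]; left
    have : (1 : ℝ) ≤ i := by exact_mod_cast (by omega : 1 ≤ i)
    linarith [hz (w (pos n j))]
  · have : (1 : ℝ) ≤ |((i : ℤ) - (j : ℤ) : ℤ)| := by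
      have h3 : ((i : ℤ) - (j : ℤ)) ≠ 0 := by omega
      exact_mod_cast Int.one_le_abs h3
    have e : (∑ j, |z j|) + 2 * (i : ℝ) - ((∑ j, |z j|) + 2 * j) = 2 * (((i : ℤ) - (j : ℤ) : ℤ) : ℝ) := by
      push_cast; ring
    rw [e, abs_mul]
    norm_num at this ⊢
    linarith

theorem zext_swap (n : ℕ) (z : Fin (n + 1) → ℝ) (w : Equiv.Perm (Fin (n + 1))) (i : ℕ)
    (hi : i < n) : (fun j => zext n z w (Equiv.swap i (i + 1) j)) = zext n z (w * sw n i) := by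
  funext j
  unfold zext sw
  by_cases h1 : j = i
  · subst h1
    simp [hi.le, Nat.succ_le_of_lt hi]
  by_cases h2 : j = i + 1
  · subst h2
    simp [hi.le, Nat.succ_le_of_lt hi]
  rw [Equiv.swap_apply_of_ne_of_ne h1 h2]
  split_ifs with h
  · rw [Equiv.Perm.mul_apply, Equiv.swap_apply_of_ne_of_ne
      (pos_ne n _ _ h hi.le h1) (pos_ne n _ _ h hi h2)]
  · rfl

theorem zext_rv (n : ℕ) (z : Fin (n + 1) → ℝ) (hz : Function.Injective z)
    (w w' : Equiv.Perm (Fin (n + 1)))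
    (h : ybrv (n + 1) (zext n z w) = zext n z w') : w' = w * Fin.revPerm := by
  ext1 x
  have h1 := congrFun h x.val
  rw [ybrv_apply, if_pos x.isLt] at h1
  unfold zext at h1
  rw [if_pos (by omega), if_pos (by omega), pos_self] at h1
  rw [← hz h1]
  simp only [Equiv.Perm.mul_apply, Fin.revPerm_apply]
  congr 1
  apply Fin.ext
  rw [pos_val _ _ (by omega), Fin.val_rev]
  omega

theorem V_pos (n : ℕ) (z : Fin (n + 1) → ℝ) (hz : Function.Injective z)
    (hsep : ∀ i j, i ≠ j → 1 < |z i - z j|)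
    (ψ : Equiv.Perm (Fin (n + 1)) → TT n → ℂ)
    (hψ : ∀ w i, i < n → ∀ τ, ψ w (τ ∘ sw n i) =
      ((1 / (z (w (pos n i)) - z (w (pos n (i + 1)))) : ℝ) : ℂ) * ψ w τ
        + ((1 - 1 / (z (w (pos n i)) - z (w (pos n (i + 1)))) : ℝ) : ℂ) * ψ (w * sw n i) τ)
    (hne : ∀ w, ψ w ≠ 0) (w : Equiv.Perm (Fin (n + 1))) :
    ∃ r : ℝ, 0 < r ∧
      ∑ τ, ψ w τ * star (ψ (w * Fin.revPerm) (τ ∘ (Fin.revPerm : Equiv.Perm (Fin (n + 1))))) = r := by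
  set s : ℕ → Matrix (TT n) (TT n) ℂ := fun i => pm n (sw n i) with hs
  set v := zext n z w with hv
  have hvs := zext_sep n z hsep w
  have hvinj : Function.Injective v := by
    intro i j h
    by_contra hij
    have := hvs i j hij
    rw [← hv, h] at this
    simp at this
    linarith
  have ssq : ∀ i, s i * s i = 1 := fun i => by simp only [hs]; rw [pm_mul, sw_sq, pm_one]
  have sbr : ∀ i, i + 1 < n → s i * s (i + 1) * s i = s (i + 1) * s i * s (i + 1) := fun i hi => by
    simp only [hs]; rw [pm_mul, pm_mul, pm_mul, pm_mul, sw_braid n i hi]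
  have sfar : ∀ i j, i + 1 < j → j < n → s i * s j = s j * s i := fun i j hij hj => by
    simp only [hs]; rw [pm_mul, pm_mul, sw_far n i j hij hj]
  have sst : ∀ i, star (s i) = s i := fun i => by
    simp only [hs]; rw [pm_star, sw_inv]
  set ρ : Matrix (TT n) (TT n) ℂ := pm n Fin.revPerm with hρ
  have ρsq : ρ * ρ = 1 := by rw [hρ, pm_mul, rev_sq, pm_one]
  have ρst : star ρ = ρ := by rw [hρ, pm_star, rev_inv]
  have ρs : ∀ i, i < n → ρ * s i * ρ = s (n - 1 - i) := fun i hi => by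
    rw [hρ]; simp only [hs]; rw [pm_mul, pm_mul, rev_sw n i hi]
  have hyb : ∀ t, YBF (fun i => rA s t (n - 1 - i)) n := by
    intro t
    constructor
    · intro i hi a b c hab hac hbc
      have := sbr (n - 1 - (i + 1)) (by omega)
      rw [show n - 1 - (i + 1) + 1 = n - 1 - i by omega] at this
      exact rA_yb s t _ _ (ssq _) (ssq _) this.symm a b c hab hac hbc
    · intro i j hij hj a b c d
      exact rA_far s t _ _ (sfar (n - 1 - j) (n - 1 - i) (by omega) (by omega)).symm a b c d
  let H : unitInterval → Matrix (TT n) (TT n) ℂ := fun t => ρ * ybS (rA s (t : ℝ)) (n + 1) v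
  have habs : ∀ t : unitInterval, |(t : ℝ)| ≤ 1 := fun t => by
    rw [abs_of_nonneg t.2.1]; exact t.2.2
  have hpd : (H 1).PosDef := by
    apply pd_path H
    · apply continuous_const.mul
      apply ybS_cont (fun t : unitInterval => rA s (t : ℝ))
      intro i a b hab
      unfold rA
      apply Continuous.fun_smul
      · apply Continuous.fun_inv₀
        · fun_prop
        · intro t
          exact (rA_unit s t i (ssq i) _ _ (habs t) (hvs a b hab)).2
      · fun_prop
    · intro t
      exact ybS_herm (rA s (t : ℝ)) n ρ ρsq ρst (fun i hi a b => rA_star s t i (sst i) a b)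
        (fun i hi a b => rA_conj s t i _ ρ ρsq (ρs i hi) a b) (hyb t) v hvinj
    · intro t
      have hρu : IsUnit ρ := ⟨⟨ρ, ρ, ρsq, ρsq⟩, rfl⟩
      refine hρu.mul (ybS_unit _ n (n + 1) le_rfl v ?_)
      intro i hi a b _ _ hab
      exact (rA_unit s t i (ssq i) _ _ (habs t) (hvs a b hab)).1
    · have := ybS_transport (rA s 0) n (fun a x => a * x) (fun x => one_mul x)
        (fun a b x => mul_assoc a b x)
        (fun v x => ∃ w', v = zext n z w' ∧ x = pm n w'⁻¹)
        (by
          rintro v x i hi ⟨w', rfl, rfl⟩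
          refine ⟨w' * sw n i, zext_swap n z w' i hi, ?_⟩
          simp [rA, hs, pm_mul, sw_inv]) (n + 1) le_rfl v (pm n w⁻¹) ⟨w, rfl, rfl⟩
      obtain ⟨w', h1, h2⟩ := this
      have h3 := zext_rv n z hz w w' h1
      subst h3
      have h4 : ybS (rA s 0) (n + 1) v = pm n Fin.revPerm := by
        calc ybS (rA s 0) (n + 1) v = ybS (rA s 0) (n + 1) v * pm n w⁻¹ * pm n w := by
              rw [mul_assoc, pm_mul, inv_mul_cancel, pm_one, mul_one]
          _ = _ := by rw [h2, pm_mul]; simp [rev_inv]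
      show ρ * ybS (rA s ((0 : unitInterval) : ℝ)) (n + 1) v = 1
      rw [Set.Icc.coe_zero, h4, ← hρ, ρsq]
  have htr := ybS_transport (rA s 1) n (fun a x => a *ᵥ x) (fun x => one_mulVec x)
        (fun a b x => (mulVec_mulVec x a b).symm)
        (fun v x => ∃ w', v = zext n z w' ∧ x = ψ w')
        (by
          rintro v x i hi ⟨w', rfl, rfl⟩
          refine ⟨w' * sw n i, zext_swap n z w' i hi, ?_⟩
          funext τ
          have h1 := (rA_unit s 1 i (ssq i) _ _ (by simp)
            (zext_sep n z hsep w' i (i + 1) (by omega))).2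
          have h2 := hψ w' i hi τ
          have e1 : zext n z w' i = z (w' (pos n i)) := by simp [zext, hi.le]
          have e2 : zext n z w' (i + 1) = z (w' (pos n (i + 1))) := by
            simp [zext, Nat.succ_le_of_lt hi]
          rw [e1, e2] at h1 ⊢
          set c : ℝ := 1 / (z (w' (pos n i)) - z (w' (pos n (i + 1)))) with hc
          have h1' : ((1 - c : ℝ) : ℂ) ≠ 0 := by exact_mod_cast h1
          simp only [rA, ← hc, smul_mulVec, sub_mulVec, one_mulVec, Pi.smul_apply, Pi.sub_apply, hs,
            pm_mulVec]
          rw [h2, Complex.real_smul, Complex.real_smul]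
          push_cast at h1' ⊢
          field_simp
          ring) (n + 1) le_rfl v (ψ w) ⟨w, rfl, rfl⟩
  obtain ⟨w', h1, h2⟩ := htr
  have h3 := zext_rv n z hz w w' h1
  subst h3
  have h4 : H 1 *ᵥ ψ w = fun τ =>
      ψ (w * Fin.revPerm) (τ ∘ (Fin.revPerm : Equiv.Perm (Fin (n + 1)))) := by
    funext τ
    show ((ρ * ybS (rA s ((1 : unitInterval) : ℝ)) (n + 1) v) *ᵥ ψ w) τ = _
    rw [Set.Icc.coe_one, ← mulVec_mulVec, hρ, pm_mulVec]
    exact congrFun h2 _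
  have h5 := hpd.dotProduct_mulVec_pos (hne w)
  rw [h4] at h5
  obtain ⟨h6, h7⟩ := Complex.lt_def.mp h5
  refine ⟨_, h6, ?_⟩
  apply Complex.ext
  · simp [dotProduct, Complex.mul_re]
  · rw [Complex.ofReal_im]
    rw [Complex.zero_im] at h7
    have : ∀ x : ℂ, x.im = 0 → (star x).im = 0 := by intro x hx; simp [hx]
    have h8 := this _ h7.symm
    rw [← h8]
    congr 1
    simp [dotProduct]

end VSide


section LSide

theorem rot_pos (n i : ℕ) (h : i < n) : finRotate (n + 1) (pos n i) = pos n (i + 1) := by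
  apply Fin.ext
  rw [coe_finRotate_of_ne_last, pos_val n i h.le, pos_val n (i + 1) h]
  intro e
  have := congrArg Fin.val e
  rw [pos_val n i h.le, Fin.val_last] at this
  omega

theorem rot_last (n : ℕ) : finRotate (n + 1) (pos n n) = pos n 0 := by
  have : pos n n = Fin.last n := by
    apply Fin.ext; rw [pos_val n n le_rfl]; rfl
  rw [this, finRotate_last]
  rfl

theorem rot_sw (n i : ℕ) (h : i + 1 < n) :
    finRotate (n + 1) * sw n i = sw n (i + 1) * finRotate (n + 1) := by
  have := Equiv.swap_apply_apply (finRotate (n + 1)) (pos n i) (pos n (i + 1))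
  rw [rot_pos n i (by omega), rot_pos n (i + 1) (by omega)] at this
  unfold sw
  rw [this]
  simp

theorem rot_rot_sw (n m : ℕ) (h : n = m + 1) :
    finRotate (n + 1) * finRotate (n + 1) * sw n m =
      sw n 0 * (finRotate (n + 1) * finRotate (n + 1)) := by
  subst h
  have := Equiv.swap_apply_apply (finRotate (m + 1 + 1) * finRotate (m + 1 + 1))
    (pos (m + 1) m) (pos (m + 1) (m + 1))
  rw [Equiv.Perm.mul_apply, Equiv.Perm.mul_apply, rot_pos (m + 1) m (by omega), rot_last,
    rot_pos (m + 1) 0 (by omega)] at this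
  unfold sw
  rw [zero_add, this, inv_mul_cancel_right]

abbrev LL (n : ℕ) := Equiv.Perm (Fin (n + 1)) → ℂ

noncomputable def lE (n : ℕ) (z : Fin (n + 1) → ℝ) (i : ℕ) (w : Equiv.Perm (Fin (n + 1))) : ℂ :=
  ((1 / (z (w (pos n i)) - z (w (pos n (i + 1)))) : ℝ) : ℂ)

noncomputable def lS (n : ℕ) (z : Fin (n + 1) → ℝ) (i : ℕ) : Module.End ℂ (LL n) where
  toFun f := fun w => lE n z i w * f w + (1 - lE n z i w) * f (w * sw n i)
  map_add' f g := by funext w; simp only [Pi.add_apply]; ring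
  map_smul' c f := by funext w; simp only [Pi.smul_apply, smul_eq_mul, RingHom.id_apply]; ring

theorem lS_apply (n : ℕ) (z : Fin (n + 1) → ℝ) (i : ℕ) (f : LL n) (w) :
    lS n z i f w = lE n z i w * f w + (1 - lE n z i w) * f (w * sw n i) := rfl

noncomputable def lP (n : ℕ) (β : Fin (n + 1) → ℂ) : Module.End ℂ (LL n) where
  toFun f := fun w => β (w 0) * f (w * finRotate (n + 1))
  map_add' f g := by funext w; simp only [Pi.add_apply]; ring
  map_smul' c f := by funext w; simp only [Pi.smul_apply, smul_eq_mul, RingHom.id_apply]; ring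

theorem lP_apply (n : ℕ) (β : Fin (n + 1) → ℂ) (f : LL n) (w) :
    lP n β f w = β (w 0) * f (w * finRotate (n + 1)) := rfl

theorem sw_l (n i : ℕ) : sw n i (pos n i) = pos n (i + 1) := Equiv.swap_apply_left _ _
theorem sw_r (n i : ℕ) : sw n i (pos n (i + 1)) = pos n i := Equiv.swap_apply_right _ _
theorem sw_o (n i j : ℕ) (hi : i < n) (hj : j ≤ n) (h1 : j ≠ i) (h2 : j ≠ i + 1) :
    sw n i (pos n j) = pos n j :=
  Equiv.swap_apply_of_ne_of_ne (pos_ne n j i hj (by omega) h1)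
    (pos_ne n j (i + 1) hj (by omega) h2)

theorem lE_self (n : ℕ) (z : Fin (n + 1) → ℝ) (i : ℕ) (w) :
    lE n z i (w * sw n i) = - lE n z i w := by
  unfold lE
  rw [Equiv.Perm.mul_apply, Equiv.Perm.mul_apply, sw_l, sw_r, ← Complex.ofReal_neg, ← neg_sub,
    one_div, one_div, inv_neg]

theorem lS_sq (n : ℕ) (z : Fin (n + 1) → ℝ) (i : ℕ) : lS n z i * lS n z i = 1 := by
  refine LinearMap.ext fun f => ?_
  funext w
  simp only [Module.End.mul_apply, lS_apply, lE_self, mul_assoc, sw_sq, mul_one,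
    Module.End.one_apply]
  ring

theorem lS_far (n : ℕ) (z : Fin (n + 1) → ℝ) (i j : ℕ) (hij : i + 1 < j) (hj : j < n) :
    lS n z i * lS n z j = lS n z j * lS n z i := by
  have e1 : ∀ w, lE n z i (w * sw n j) = lE n z i w := fun w => by
    unfold lE
    rw [Equiv.Perm.mul_apply, Equiv.Perm.mul_apply, sw_o n j i hj (by omega) (by omega) (by omega),
      sw_o n j (i + 1) hj (by omega) (by omega) (by omega)]
  have e2 : ∀ w, lE n z j (w * sw n i) = lE n z j w := fun w => by
    unfold lE
    rw [Equiv.Perm.mul_apply, Equiv.Perm.mul_apply,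
      sw_o n i j (by omega) (by omega) (by omega) (by omega),
      sw_o n i (j + 1) (by omega) (by omega) (by omega) (by omega)]
  refine LinearMap.ext fun f => ?_
  funext w
  simp only [Module.End.mul_apply, lS_apply, e1, e2, mul_assoc w, sw_far n i j hij hj]
  ring

theorem lS_braid (n : ℕ) (z : Fin (n + 1) → ℝ) (hz : Function.Injective z) (i : ℕ)
    (hi : i + 1 < n) :
    lS n z i * lS n z (i + 1) * lS n z i = lS n z (i + 1) * lS n z i * lS n z (i + 1) := by
  have o1 : sw n i (pos n (i + 1 + 1)) = pos n (i + 1 + 1) :=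
    sw_o n i (i + 2) (by omega) (by omega) (by omega) (by omega)
  have o2 : sw n (i + 1) (pos n i) = pos n i :=
    sw_o n (i + 1) i (by omega) (by omega) (by omega) (by omega)
  refine LinearMap.ext fun f => ?_
  funext w
  have h1 : z (w (pos n i)) ≠ z (w (pos n (i + 1))) := fun h =>
    pos_ne n i (i + 1) (by omega) (by omega) (by omega) (w.injective (hz h))
  have h2 : z (w (pos n i)) ≠ z (w (pos n (i + 1 + 1))) := fun h =>
    pos_ne n i (i + 2) (by omega) (by omega) (by omega) (w.injective (hz h))
  have h3 : z (w (pos n (i + 1))) ≠ z (w (pos n (i + 1 + 1))) := fun h =>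
    pos_ne n (i + 1) (i + 2) (by omega) (by omega) (by omega) (w.injective (hz h))
  have hb : w * sw n i * sw n (i + 1) * sw n i = w * sw n (i + 1) * sw n i * sw n (i + 1) := by
    have := sw_braid n i hi
    simp only [mul_assoc] at this ⊢
    rw [this]
  have hs : ∀ (w : Equiv.Perm (Fin (n + 1))) i, w * sw n i * sw n i = w := fun w i => by
    rw [mul_assoc, sw_sq, mul_one]
  simp only [Module.End.mul_apply, lS_apply, hb, hs]
  simp only [lE, Equiv.Perm.mul_apply, sw_l, sw_r, o1, o2]
  set a := z (w (pos n i))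
  set b := z (w (pos n (i + 1)))
  set c := z (w (pos n (i + 1 + 1)))
  have g1 : (1 / (b - a) : ℝ) = - (1 / (a - b)) := by rw [← neg_sub, one_div, one_div, inv_neg]
  have g2 : (1 / (c - b) : ℝ) = - (1 / (b - c)) := by rw [← neg_sub, one_div, one_div, inv_neg]
  have key : (1 / (a - c)) * (1 / (a - b) + 1 / (b - c)) = 1 / (a - b) * (1 / (b - c)) := by
    have h1 := sub_ne_zero.mpr h1
    have h2 := sub_ne_zero.mpr h2
    have h3 := sub_ne_zero.mpr h3
    field_simp
    ring
  simp only [g1, g2]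
  generalize 1 / (a - b) = x at *
  generalize 1 / (b - c) = y at *
  generalize 1 / (a - c) = u at *
  have key' : (u : ℂ) * (x + y) = x * y := by exact_mod_cast key
  push_cast
  generalize f w = f0
  generalize f (w * sw n i) = f1
  generalize f (w * sw n (i + 1)) = f2
  linear_combination ((y - x) * f0 + (x - 1) * f1 + (1 - y) * f2) * key'

theorem lP_S (n : ℕ) (z : Fin (n + 1) → ℝ) (β : Fin (n + 1) → ℂ) (i : ℕ) (hi : i + 1 < n) :
    lP n β * lS n z i = lS n z (i + 1) * lP n β := by
  refine LinearMap.ext fun f => ?_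
  funext w
  have h0 : sw n (i + 1) 0 = 0 := by
    have := sw_o n (i + 1) 0 (by omega) (by omega) (by omega) (by omega)
    exact this
  have he : lE n z i (w * finRotate (n + 1)) = lE n z (i + 1) w := by
    unfold lE
    rw [Equiv.Perm.mul_apply, Equiv.Perm.mul_apply, rot_pos n i (by omega),
      rot_pos n (i + 1) (by omega)]
  simp only [Module.End.mul_apply, lS_apply, lP_apply, he, mul_assoc w, rot_sw n i hi]
  rw [Equiv.Perm.mul_apply, h0]
  ring

theorem lPP_S (n : ℕ) (z : Fin (n + 1) → ℝ) (β : Fin (n + 1) → ℂ) (m : ℕ) (hm : n = m + 1) :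
    lP n β * lP n β * lS n z m = lS n z 0 * (lP n β * lP n β) := by
  refine LinearMap.ext fun f => ?_
  funext w
  have p0 : (0 : Fin (n + 1)) = pos n 0 := rfl
  have h0 : sw n 0 0 = pos n 1 := sw_l n 0
  have h1 : sw n 0 (pos n 1) = 0 := sw_r n 0
  have hr : finRotate (n + 1) 0 = pos n 1 := rot_pos n 0 (by omega)
  have he : lE n z m (w * (finRotate (n + 1) * finRotate (n + 1))) = lE n z 0 w := by
    subst hm
    unfold lE
    rw [Equiv.Perm.mul_apply, Equiv.Perm.mul_apply, Equiv.Perm.mul_apply, Equiv.Perm.mul_apply,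
      rot_pos _ m (by omega), rot_last, rot_pos _ 0 (by omega)]
  have rr := rot_rot_sw n m hm
  simp only [mul_assoc] at rr he
  simp only [Module.End.mul_apply, lS_apply, lP_apply, mul_assoc, he, rr]
  simp only [Equiv.Perm.mul_apply, hr, h0, h1]
  ring

end LSide


section XFormula

noncomputable def lF (k : ℕ) (G ζ : ℕ → ℂ) : ℂ :=
  (∑ m ∈ Finset.range k, G m * (∏ j ∈ Finset.range k, (1 + 1 / (ζ m - ζ j))) * (1 / (ζ m - ζ k)))
    + G k * ∏ j ∈ Finset.range k, (1 + 1 / (ζ k - ζ j))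

theorem lF_step (k : ℕ) (G ζ G' ζ' : ℕ → ℂ)
    (hζ : ∀ i j, i ≤ k + 1 → j ≤ k + 1 → i ≠ j → ζ i ≠ ζ j)
    (h1 : ∀ i, i < k → ζ' i = ζ i) (h2 : ζ' k = ζ (k + 1))
    (h3 : ∀ i, i < k → G' i = G i) (h4 : G' k = G (k + 1)) :
    1 / (ζ k - ζ (k + 1)) * lF k G ζ + (1 - 1 / (ζ k - ζ (k + 1))) * lF k G' ζ' =
      lF (k + 1) G ζ := by
  have hF : lF k G' ζ' = (∑ m ∈ Finset.range k, G m *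
      (∏ j ∈ Finset.range k, (1 + 1 / (ζ m - ζ j))) * (1 / (ζ m - ζ (k + 1))))
    + G (k + 1) * ∏ j ∈ Finset.range k, (1 + 1 / (ζ (k + 1) - ζ j)) := by
    unfold lF
    rw [h2, h4]
    congr 1
    · apply Finset.sum_congr rfl
      intro m hm
      rw [Finset.mem_range] at hm
      rw [h3 m hm, h1 m hm]
      congr 2
      apply Finset.prod_congr rfl
      intro j hj
      rw [h1 j (Finset.mem_range.mp hj)]
    · congr 1
      apply Finset.prod_congr rfl
      intro j hj
      rw [h1 j (Finset.mem_range.mp hj)]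
  rw [hF]
  unfold lF
  rw [Finset.sum_range_succ]
  simp only [Finset.prod_range_succ]
  have hd : ζ k - ζ (k + 1) ≠ 0 :=
    sub_ne_zero.mpr (hζ k (k + 1) (by omega) (by omega) (by omega))
  have hs : ∑ m ∈ Finset.range k, G m *
      ((∏ j ∈ Finset.range k, (1 + 1 / (ζ m - ζ j))) * (1 + 1 / (ζ m - ζ k)))
        * (1 / (ζ m - ζ (k + 1))) =
      1 / (ζ k - ζ (k + 1)) * (∑ m ∈ Finset.range k, G m *
      (∏ j ∈ Finset.range k, (1 + 1 / (ζ m - ζ j))) * (1 / (ζ m - ζ k)))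
      + (1 - 1 / (ζ k - ζ (k + 1))) * (∑ m ∈ Finset.range k, G m *
      (∏ j ∈ Finset.range k, (1 + 1 / (ζ m - ζ j))) * (1 / (ζ m - ζ (k + 1)))) := by
    rw [Finset.mul_sum, Finset.mul_sum, ← Finset.sum_add_distrib]
    apply Finset.sum_congr rfl
    intro m hm
    rw [Finset.mem_range] at hm
    have hx : ζ m - ζ k ≠ 0 := sub_ne_zero.mpr (hζ m k (by omega) (by omega) (by omega))
    have hy : ζ m - ζ (k + 1) ≠ 0 :=
      sub_ne_zero.mpr (hζ m (k + 1) (by omega) (by omega) (by omega))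
    generalize (∏ j ∈ Finset.range k, (1 + 1 / (ζ m - ζ j))) = T
    have : (1 + 1 / (ζ m - ζ k)) * (1 / (ζ m - ζ (k + 1))) =
      1 / (ζ k - ζ (k + 1)) * (1 / (ζ m - ζ k)) +
        (1 - 1 / (ζ k - ζ (k + 1))) * (1 / (ζ m - ζ (k + 1))) := by
      field_simp
      ring
    linear_combination G m * T * this
  rw [hs, sub_self, div_zero, add_zero, mul_one]
  have hd' : 1 / (ζ (k + 1) - ζ k) = - (1 / (ζ k - ζ (k + 1))) := by
    rw [← neg_sub, one_div, one_div, inv_neg]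
  rw [hd']
  ring

def lI (n : ℕ) (g : Fin (n + 1) → ℂ) : LL n := fun w => g (w 0)

theorem afP_formula (n : ℕ) (z : Fin (n + 1) → ℝ) (hz : Function.Injective z)
    (g : Fin (n + 1) → ℂ) (k : ℕ) (hk : k ≤ n) (u : Equiv.Perm (Fin (n + 1))) :
    afP (lS n z) k (lI n g) u =
      lF k (fun m => g (u (pos n m))) (fun m => ((z (u (pos n m)) : ℝ) : ℂ)) := by
  induction k generalizing u with
  | zero => simp [afP, lF, lI]; rfl
  | succ k ih =>
    rw [afP, Module.End.mul_apply, lS_apply, ih (by omega), ih (by omega)]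
    rw [← lF_step k _ _ (fun m => g ((u * sw n k) (pos n m)))
      (fun m => ((z ((u * sw n k) (pos n m)) : ℝ) : ℂ))]
    · simp [lE]
    · intro i j hi hj hij h
      have h' := hz (Complex.ofReal_injective h)
      exact pos_ne n i j (by omega) (by omega) hij (u.injective h')
    · intro i hi
      simp only [Equiv.Perm.mul_apply]
      rw [sw_o n k i (by omega) (by omega) (by omega) (by omega)]
    · simp only [Equiv.Perm.mul_apply, sw_l]
    · intro i hi
      simp only [Equiv.Perm.mul_apply]
      rw [sw_o n k i (by omega) (by omega) (by omega) (by omega)]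
    · simp only [Equiv.Perm.mul_apply, sw_l]

noncomputable def lC (n : ℕ) (z : Fin (n + 1) → ℝ) (a : Fin (n + 1)) : ℝ :=
  ∏ j, (1 + 1 / (z a - z j))

theorem sep_ne (n : ℕ) (z : Fin (n + 1) → ℝ) (hsep : ∀ i j, i ≠ j → 1 < |z i - z j|)
    (a b : Fin (n + 1)) : z a - z b + 1 ≠ 0 := by
  intro h
  by_cases hab : a = b
  · subst hab; simp at h
  · have := hsep a b hab
    rw [show z a - z b = -1 by linarith] at this
    simp at this

theorem lC_ne (n : ℕ) (z : Fin (n + 1) → ℝ) (hsep : ∀ i j, i ≠ j → 1 < |z i - z j|)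
    (a : Fin (n + 1)) : lC n z a ≠ 0 := by
  unfold lC
  rw [Finset.prod_ne_zero_iff]
  intro j _
  by_cases h : z a - z j = 0
  · rw [h]; simp
  · have := sep_ne n z hsep a j
    intro h2
    field_simp at h2
    exact this (by rw [h2, mul_zero])

theorem sum_pos (n : ℕ) (u : Equiv.Perm (Fin (n + 1))) (f : Fin (n + 1) → ℂ) :
    ∑ m ∈ Finset.range (n + 1), f (u (pos n m)) = ∑ a, f a := by
  rw [Finset.sum_range, ← Equiv.sum_comp u f]
  apply Finset.sum_congr rfl
  intro i _
  rw [pos_self]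

theorem prod_pos' (n : ℕ) (u : Equiv.Perm (Fin (n + 1))) (f : Fin (n + 1) → ℂ) :
    ∏ m ∈ Finset.range (n + 1), f (u (pos n m)) = ∏ a, f a := by
  rw [Finset.prod_range, ← Equiv.prod_comp u f]
  apply Finset.prod_congr rfl
  intro i _
  rw [pos_self]

theorem lF_top (n : ℕ) (z : Fin (n + 1) → ℝ) (hz : Function.Injective z)
    (hsep : ∀ i j, i ≠ j → 1 < |z i - z j|)
    (g : Fin (n + 1) → ℂ) (u : Equiv.Perm (Fin (n + 1))) :
    lF n (fun m => g (u (pos n m))) (fun m => ((z (u (pos n m)) : ℝ) : ℂ)) =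
      ∑ a, (lC n z a : ℂ) * g a / ((z a : ℂ) - (z (u (pos n n)) : ℂ) + 1) := by
  rw [← sum_pos n u, Finset.sum_range_succ]
  have hC : ∀ m, (lC n z (u (pos n m)) : ℂ) =
      (∏ j ∈ Finset.range n, (1 + 1 / ((z (u (pos n m)) : ℂ) - (z (u (pos n j)) : ℂ)))) *
        (1 + 1 / ((z (u (pos n m)) : ℂ) - (z (u (pos n n)) : ℂ))) := by
    intro m
    rw [← Finset.prod_range_succ (fun j => (1 + 1 / ((z (u (pos n m)) : ℂ) - (z (u (pos n j)) : ℂ)))),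
      prod_pos' n u (fun a => (1 + 1 / ((z (u (pos n m)) : ℂ) - (z a : ℂ))))]
    unfold lC
    push_cast
    rfl
  unfold lF
  congr 1
  · apply Finset.sum_congr rfl
    intro m hm
    rw [Finset.mem_range] at hm
    rw [hC]
    have h1 : (z (u (pos n m)) : ℂ) - (z (u (pos n n)) : ℂ) ≠ 0 := by
      intro h
      have h' : z (u (pos n m)) - z (u (pos n n)) = 0 := by exact_mod_cast h
      exact pos_ne n m n (by omega) le_rfl (by omega) (u.injective (hz (sub_eq_zero.mp h')))
    have h2 : (z (u (pos n m)) : ℂ) - (z (u (pos n n)) : ℂ) + 1 ≠ 0 := by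
      exact_mod_cast sep_ne n z hsep (u (pos n m)) (u (pos n n))
    generalize (∏ j ∈ Finset.range n,
      (1 + 1 / ((z (u (pos n m)) : ℂ) - (z (u (pos n j)) : ℂ)))) = T
    field_simp
  · rw [hC]
    simp [mul_comm]

/-- the intertwining map -/
noncomputable def lJ (n : ℕ) (z : Fin (n + 1) → ℝ) : (Fin (n + 1) → ℂ) →ₗ[ℂ] LL n where
  toFun h := lI n (fun a => (lC n z a : ℂ)⁻¹ * h a)
  map_add' f g := by funext w; simp only [Pi.add_apply, lI]; ring
  map_smul' c f := by
    funext w; simp only [Pi.smul_apply, smul_eq_mul, RingHom.id_apply, lI]; ring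

theorem X0_J (n : ℕ) (z : Fin (n + 1) → ℝ) (hz : Function.Injective z)
    (hsep : ∀ i j, i ≠ j → 1 < |z i - z j|) (b : Fin (n + 1) → ℂ)
    (Q : Matrix (Fin (n + 1)) (Fin (n + 1)) ℂ)
    (hQ : ∀ i j, Q i j = if i = j then b i else (b j) / ((z i : ℂ) - (z j : ℂ) + 1))
    (h : Fin (n + 1) → ℂ) :
    (lP n (fun a => b a / lC n z a) * afP (lS n z) n) (lJ n z h) = lJ n z (Qᵀ *ᵥ h) := by
  funext w
  have hQ' : ∀ i j, Q i j = (b j) / ((z i : ℂ) - (z j : ℂ) + 1) := by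
    intro i j
    rw [hQ]
    split_ifs with hij
    · subst hij; simp
    · rfl
  rw [Module.End.mul_apply, lP_apply]
  have e1 : ∀ h w, lJ n z h w = (lC n z (w 0) : ℂ)⁻¹ * h (w 0) := fun _ _ => rfl
  have e2 : lJ n z h = lI n (fun a => (lC n z a : ℂ)⁻¹ * h a) := rfl
  rw [e1, e2]
  have e3 := (afP_formula n z hz (fun a => (lC n z a : ℂ)⁻¹ * h a) n le_rfl
    (w * finRotate (n + 1))).trans (lF_top n z hz hsep (fun a => (lC n z a : ℂ)⁻¹ * h a)
    (w * finRotate (n + 1)))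
  rw [e3, Equiv.Perm.mul_apply, rot_last]
  show _ * ∑ a, _ * _ / (_ - (z (w 0) : ℂ) + 1) = _
  simp only [mulVec, dotProduct, Matrix.transpose_apply, hQ', Finset.mul_sum]
  apply Finset.sum_congr rfl
  intro a _
  have h1 : (lC n z a : ℂ) ≠ 0 := by exact_mod_cast lC_ne n z hsep a
  have h2 : (lC n z (w 0) : ℂ) ≠ 0 := by exact_mod_cast lC_ne n z hsep (w 0)
  field_simp

theorem aeval_J (n : ℕ) (z : Fin (n + 1) → ℝ) (X0 : Module.End ℂ (LL n))
    (Q : Matrix (Fin (n + 1)) (Fin (n + 1)) ℂ)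
    (hX : ∀ h, X0 (lJ n z h) = lJ n z (Q *ᵥ h)) (p : ℂ[X]) (h : Fin (n + 1) → ℂ) :
    (aeval X0 p) (lJ n z h) = lJ n z ((aeval Q p) *ᵥ h) := by
  induction p using Polynomial.induction_on' generalizing h with
  | add p q hp hq => simp [hp, hq, add_mulVec]
  | monomial k c =>
    simp only [aeval_monomial]
    have : ∀ h, (X0 ^ k) (lJ n z h) = lJ n z ((Q ^ k) *ᵥ h) := by
      induction k with
      | zero => simp
      | succ k ih =>
        intro h
        rw [pow_succ, Module.End.mul_apply, hX, ih, mulVec_mulVec, pow_succ]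
    rw [Module.End.mul_apply, this, ← mulVec_mulVec]
    rw [Module.algebraMap_end_apply, ← map_smul]
    congr 1
    rw [Algebra.algebraMap_eq_smul_one, smul_mulVec, one_mulVec]

theorem J_one (n : ℕ) (z : Fin (n + 1) → ℝ) (hsep : ∀ i j, i ≠ j → 1 < |z i - z j|) :
    lJ n z (fun a => (lC n z a : ℂ)) = fun _ => 1 := by
  funext w
  show (lC n z (w 0) : ℂ)⁻¹ * (lC n z (w 0) : ℂ) = 1
  exact inv_mul_cancel₀ (by exact_mod_cast lC_ne n z hsep (w 0))

theorem X0_charpoly (n : ℕ) (z : Fin (n + 1) → ℝ) (hz : Function.Injective z)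
    (hsep : ∀ i j, i ≠ j → 1 < |z i - z j|) (b : Fin (n + 1) → ℂ)
    (Q : Matrix (Fin (n + 1)) (Fin (n + 1)) ℂ)
    (hQ : ∀ i j, Q i j = if i = j then b i else (b j) / ((z i : ℂ) - (z j : ℂ) + 1)) :
    (aeval (lP n (fun a => b a / lC n z a) * afP (lS n z) n) Q.charpoly) (fun _ => 1) = 0 := by
  rw [← J_one n z hsep, aeval_J n z _ Qᵀ (X0_J n z hz hsep b Q hQ), ← Matrix.charpoly_transpose,
    Matrix.aeval_self_charpoly, zero_mulVec, map_zero]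

end XFormula


section Joint
variable {R ι : Type*} [Ring R]

def jG (E : ℕ → ι → R) : ℕ → (ℕ → ι) → R
  | 0, _ => 1
  | k + 1, τ => E k (τ k) * jG E k τ

theorem jG_congr (E : ℕ → ι → R) (k : ℕ) (τ τ' : ℕ → ι) (h : ∀ i, i < k → τ i = τ' i) :
    jG E k τ = jG E k τ' := by
  induction k with
  | zero => rfl
  | succ k ih => rw [jG, jG, h k (by omega), ih fun i hi => h i (by omega)]

theorem jG_low (E : ℕ → ι → R) (x : R) (k : ℕ) (τ : ℕ → ι)
    (h : ∀ j a, j < k → Commute x (E j a)) : Commute x (jG E k τ) := by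
  induction k with
  | zero => exact Commute.one_right _
  | succ k ih => exact (h k _ (by omega)).mul_right (ih fun j a hj => h j a (by omega))

theorem jG_s (E : ℕ → ι → R) (s : ℕ → R) (n : ℕ)
    (hc : ∀ i j a b, i ≤ n → j ≤ n → Commute (E i a) (E j b))
    (h1 : ∀ i a, i < n → s i * E i a = E (i + 1) a * s i)
    (h2 : ∀ i a, i < n → s i * E (i + 1) a = E i a * s i)
    (hf : ∀ i j a, i < n → j ≤ n → j ≠ i → j ≠ i + 1 → Commute (s i) (E j a))
    (i k : ℕ) (hik : i + 2 ≤ k) (hk : k ≤ n + 1) (τ : ℕ → ι) :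
    s i * jG E k τ = jG E k (fun j => τ (Equiv.swap i (i + 1) j)) * s i := by
  induction k with
  | zero => omega
  | succ k ih =>
    rcases Nat.lt_or_ge (i + 1) k with h | h
    · have := hf i k (τ k) (by omega) (by omega) (by omega) (by omega)
      simp only [jG]
      rw [← mul_assoc, this.eq, mul_assoc, ih h (by omega),
        Equiv.swap_apply_of_ne_of_ne (by omega) (by omega), mul_assoc]
    · obtain rfl : k = i + 1 := by omega
      have e : jG E i (fun j => τ (Equiv.swap i (i + 1) j)) = jG E i τ :=
        jG_congr E i _ _ fun j hj => by
          rw [Equiv.swap_apply_of_ne_of_ne (by omega) (by omega)]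
      have e2 := jG_low E (s i) i τ fun j a hj =>
        hf i j a (by omega) (by omega) (by omega) (by omega)
      simp only [jG, Equiv.swap_apply_left, Equiv.swap_apply_right, e]
      calc s i * (E (i + 1) (τ (i + 1)) * (E i (τ i) * jG E i τ))
          = (s i * E (i + 1) (τ (i + 1))) * E i (τ i) * jG E i τ := by noncomm_ring
        _ = E i (τ (i + 1)) * (s i * E i (τ i)) * jG E i τ := by
            rw [h2 i _ (by omega)]; noncomm_ring
        _ = E i (τ (i + 1)) * E (i + 1) (τ i) * (s i * jG E i τ) := by
            rw [h1 i _ (by omega)]; noncomm_ring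
        _ = _ := by
            rw [e2.eq, (hc i (i + 1) (τ (i + 1)) (τ i) (by omega) (by omega)).eq]; noncomm_ring

end Joint

theorem semiconj_aeval {R : Type*} [Ring R] [Algebra ℂ R] (s x y : R) (h : s * x = y * s)
    (p : ℂ[X]) : s * aeval x p = aeval y p * s := by
  induction p using Polynomial.induction_on' with
  | add p q hp hq => simp [mul_add, add_mul, hp, hq]
  | monomial k c =>
    have : SemiconjBy s x y := h
    simp only [aeval_monomial]
    rw [← mul_assoc, ← Algebra.commutes, mul_assoc, (this.pow_right k).eq, mul_assoc]

section PsiDef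

noncomputable def pX (n : ℕ) (z : Fin (n + 1) → ℝ) (β : Fin (n + 1) → ℂ) : ℕ → Module.End ℂ (LL n) :=
  afX (lS n z) (lP n β * afP (lS n z) n)

noncomputable def pE (n : ℕ) (z : Fin (n + 1) → ℝ) (β q : Fin (n + 1) → ℂ) (i : ℕ)
    (a : Fin (n + 1)) : Module.End ℂ (LL n) :=
  aeval (pX n z β i) (Lagrange.basis Finset.univ q a)

theorem pX_comm (n : ℕ) (z : Fin (n + 1) → ℝ) (hz : Function.Injective z) (β : Fin (n + 1) → ℂ)
    (i j : ℕ) (hi : i ≤ n) (hj : j ≤ n) : Commute (pX n z β i) (pX n z β j) := by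
  have hbr := lS_braid n z hz
  have hfar := lS_far n z
  have hp := lP_S n z β
  have hx := afX_base_s (lS n z) (lP n β) n hbr hfar hp
  have h01 := fun hn => afX_base (lS n z) (lP n β) n (fun i _ => lS_sq n z i) hbr hfar hp
    (fun m hm => lPP_S n z β m hm) hn
  rcases lt_trichotomy i j with h | h | h
  · exact afX_comm _ _ n hbr hfar hx h01 i j h hj
  · subst h; exact Commute.refl _
  · exact (afX_comm _ _ n hbr hfar hx h01 j i h hi).symm

theorem pX_far (n : ℕ) (z : Fin (n + 1) → ℝ) (hz : Function.Injective z) (β : Fin (n + 1) → ℂ)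
    (i j : ℕ) (hi : i < n) (hj : j ≤ n) (h1 : j ≠ i) (h2 : j ≠ i + 1) :
    Commute (lS n z i) (pX n z β j) := by
  have hbr := lS_braid n z hz
  have hfar := lS_far n z
  have hx := afX_base_s (lS n z) (lP n β) n hbr hfar (lP_S n z β)
  rcases Nat.lt_or_ge j i with h | h
  · exact afX_high _ _ n hfar hx j i h hi
  · exact afX_low _ _ n hbr hfar hx j i (by omega) hj

theorem pE_comm (n : ℕ) (z : Fin (n + 1) → ℝ) (hz : Function.Injective z) (β q : Fin (n + 1) → ℂ)
    (i j : ℕ) (a b) (hi : i ≤ n) (hj : j ≤ n) : Commute (pE n z β q i a) (pE n z β q j b) := by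
  have h := semiconj_aeval _ _ _ (pX_comm n z hz β i j hi hj) (Lagrange.basis Finset.univ q b)
  exact (semiconj_aeval _ _ _ h.symm (Lagrange.basis Finset.univ q a)).symm

/-- the joint eigenvectors -/
noncomputable def pf (n : ℕ) (z : Fin (n + 1) → ℝ) (β q : Fin (n + 1) → ℂ) (τ : TT n) : LL n :=
  jG (pE n z β q) (n + 1) (fun i => τ (pos n i)) (fun _ => 1)

theorem lS_one (n : ℕ) (z : Fin (n + 1) → ℝ) (i : ℕ) :
    lS n z i (fun _ => 1) = fun _ => 1 := by
  funext w
  rw [lS_apply]; ring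

theorem pf_s (n : ℕ) (z : Fin (n + 1) → ℝ) (hz : Function.Injective z) (β q : Fin (n + 1) → ℂ)
    (i : ℕ) (hi : i < n) (τ : TT n) : lS n z i (pf n z β q τ) = pf n z β q (τ ∘ sw n i) := by
  have hX1 : lS n z i * pX n z β i = pX n z β (i + 1) * lS n z i := by
    simp only [pX, afX]
    rw [mul_assoc, lS_sq, mul_one]
  have h := jG_s (pE n z β q) (lS n z) n (fun i j a b hi hj => pE_comm n z hz β q i j a b hi hj)
    (fun i a _ => semiconj_aeval _ _ _ (by
      simp only [pX, afX]
      rw [mul_assoc, lS_sq, mul_one]) _)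
    (fun i a _ => semiconj_aeval _ _ _ (by
      simp only [pX, afX]
      rw [← mul_assoc, ← mul_assoc, lS_sq, one_mul]) _)
    (fun i j a hi hj h1 h2 => semiconj_aeval _ _ _ (pX_far n z hz β i j hi hj h1 h2) _)
    i (n + 1) (by omega) le_rfl (fun i => τ (pos n i))
  unfold pf
  rw [← Module.End.mul_apply, h, Module.End.mul_apply, lS_one]
  congr 1
  apply jG_congr
  intro j hj
  show τ _ = τ _
  congr 1
  by_cases h1 : j = i
  · subst h1; rw [Equiv.swap_apply_left, sw_l]
  by_cases h2 : j = i + 1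
  · subst h2; rw [Equiv.swap_apply_right, sw_r]
  rw [Equiv.swap_apply_of_ne_of_ne h1 h2, sw_o n i j hi (by omega) h1 h2]

theorem basis_mul (n : ℕ) (q : Fin (n + 1) → ℂ) (a : Fin (n + 1)) :
    ∃ c : ℂ, (X - C (q a)) * Lagrange.basis Finset.univ q a = C c * ∏ i, (X - C (q i)) := by
  refine ⟨∏ j ∈ Finset.univ.erase a, (q a - q j)⁻¹, ?_⟩
  unfold Lagrange.basis Lagrange.basisDivisor
  rw [Finset.prod_mul_distrib, ← Finset.mul_prod_erase Finset.univ _ (Finset.mem_univ a), map_prod]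
  ring

theorem pf_X (n : ℕ) (z : Fin (n + 1) → ℝ) (hz : Function.Injective z) (β q : Fin (n + 1) → ℂ)
    (hq : (aeval (pX n z β 0) (∏ i, (X - C (q i)))) (fun _ => 1) = 0) (τ : TT n) :
    pX n z β 0 (pf n z β q τ) = q (τ 0) • pf n z β q τ := by
  have key : ∀ k, k ≤ n → pX n z β 0 (jG (pE n z β q) (k + 1) (fun i => τ (pos n i)) (fun _ => 1)) =
      q (τ 0) • jG (pE n z β q) (k + 1) (fun i => τ (pos n i)) (fun _ => 1) := by
    intro k hk
    induction k with
    | zero =>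
      simp only [jG, mul_one]
      obtain ⟨c, hc⟩ := basis_mul n q (τ 0)
      have h1 := congrArg (fun p => (aeval (pX n z β 0) p) (fun _ => (1 : ℂ))) hc
      simp only [map_mul, Module.End.mul_apply] at h1
      rw [hq, map_zero] at h1
      rw [map_sub, aeval_X, aeval_C, LinearMap.sub_apply, Module.algebraMap_end_apply,
        sub_eq_zero] at h1
      exact h1
    | succ k ih =>
      have hcm := semiconj_aeval _ _ _ (pX_comm n z hz β 0 (k + 1) (by omega) hk).eq
        (Lagrange.basis Finset.univ q (τ (pos n (k + 1))))
      rw [jG, Module.End.mul_apply, ← Module.End.mul_apply, pE, hcm, Module.End.mul_apply,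
        ih (by omega), map_smul]
  exact key n le_rfl

theorem pf_ne (n : ℕ) (z : Fin (n + 1) → ℝ) (β q : Fin (n + 1) → ℂ)
    (hq : Function.Injective q) (w : Equiv.Perm (Fin (n + 1))) :
    (fun τ => pf n z β q τ w) ≠ 0 := by
  intro h
  have key : ∀ d, d ≤ n + 1 → ∀ τ : ℕ → Fin (n + 1),
      jG (pE n z β q) (n + 1 - d) τ (fun _ => 1) w = 0 := by
    intro d hd
    induction d with
    | zero =>
      intro τ
      have := congrFun h (fun i => τ i.val)
      simp only [Pi.zero_apply] at this
      rw [← this, pf]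
      rw [jG_congr _ (n + 1 - 0) τ (fun i => τ (pos n i).val)]
      · rfl
      · intro i hi
        rw [pos_val n i (by omega)]
    | succ d ih =>
      intro τ
      have e : n + 1 - d = n + 1 - (d + 1) + 1 := by omega
      set k := n + 1 - (d + 1) with hk
      have h1 : ∑ a, pE n z β q k a = 1 := by
        unfold pE
        rw [← map_sum, Lagrange.sum_basis hq.injOn Finset.univ_nonempty, map_one]
      have h2 : jG (pE n z β q) k τ = ∑ a, jG (pE n z β q) (k + 1) (Function.update τ k a) := by
        simp only [jG, Function.update_self]
        rw [← one_mul (jG (pE n z β q) k τ), ← h1, Finset.sum_mul]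
        apply Finset.sum_congr rfl
        intro a _
        congr 1
        apply jG_congr
        intro i hi
        rw [Function.update_of_ne (by omega)]
      rw [h2, LinearMap.sum_apply, Finset.sum_apply]
      apply Finset.sum_eq_zero
      intro a _
      rw [← e]
      exact ih (by omega) _
  have := key (n + 1) le_rfl (fun _ => 0)
  rw [Nat.sub_self] at this
  simp [jG] at this

def cy (n : ℕ) : ℕ → Equiv.Perm (Fin (n + 1))
  | 0 => 1
  | k + 1 => cy n k * sw n k

theorem cy_apply (n k j : ℕ) (hk : k ≤ n) (hj : j ≤ n) :
    cy n k (pos n j) = if j < k then pos n (j + 1) else if j = k then pos n 0 else pos n j := by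
  induction k generalizing j with
  | zero =>
    by_cases h : j = 0
    · subst h; simp [cy]
    · simp [cy, h]
  | succ k ih =>
    rw [cy, Equiv.Perm.mul_apply]
    by_cases h1 : j = k
    · subst h1
      rw [sw_l, ih (j + 1) (by omega) hk]
      simp
    by_cases h2 : j = k + 1
    · subst h2
      rw [sw_r, ih k (by omega) (by omega)]
      simp
    rw [sw_o n k j (by omega) hj h1 h2, ih j (by omega) hj]
    split_ifs <;> first | rfl | (exfalso; omega)

theorem cy_rot (n : ℕ) : cy n n = finRotate (n + 1) := by
  ext1 x
  rw [← pos_self n x, cy_apply n n _ le_rfl (by omega)]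
  split_ifs with h1 h2
  · rw [rot_pos n _ h1]
  · rw [h2, rot_last]
  · omega

theorem pf_P (n : ℕ) (z : Fin (n + 1) → ℝ) (hz : Function.Injective z) (β q : Fin (n + 1) → ℂ)
    (k : ℕ) (hk : k ≤ n) (τ : TT n) :
    afP (lS n z) k (pf n z β q τ) = pf n z β q (τ ∘ cy n k) := by
  induction k with
  | zero => rfl
  | succ k ih =>
    rw [afP, Module.End.mul_apply, ih (by omega), pf_s n z hz β q k (by omega)]
    rfl

theorem pf_pi (n : ℕ) (z : Fin (n + 1) → ℝ) (hz : Function.Injective z) (β q : Fin (n + 1) → ℂ)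
    (hq : (aeval (pX n z β 0) (∏ i, (X - C (q i)))) (fun _ => 1) = 0) (τ : TT n)
    (w : Equiv.Perm (Fin (n + 1))) :
    q (τ 0) * pf n z β q τ w =
      β (w 0) * pf n z β q (τ ∘ finRotate (n + 1)) (w * finRotate (n + 1)) := by
  have h := congrFun (pf_X n z hz β q hq τ) w
  rw [Pi.smul_apply, smul_eq_mul] at h
  rw [← h]
  show (lP n β * afP (lS n z) n) (pf n z β q τ) w = _
  rw [Module.End.mul_apply, lP_apply, pf_P n z hz β q n le_rfl, cy_rot]

theorem rot_rev_rot (n : ℕ) :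
    finRotate (n + 1) * Fin.revPerm * finRotate (n + 1) = Fin.revPerm := by
  ext1 x
  rw [← pos_self n x]
  have hx : x.val ≤ n := by omega
  generalize x.val = i at hx
  simp only [Equiv.Perm.mul_apply, Fin.revPerm_apply]
  rcases Nat.lt_or_ge i n with h | h
  · rw [rot_pos n i h, pos_rev n _ h, pos_rev n i hx, rot_pos n _ (by omega)]
    congr 1; omega
  · obtain rfl : i = n := by omega
    rw [rot_last, pos_rev _ _ (by omega), Nat.sub_zero, rot_last, pos_rev _ _ le_rfl, Nat.sub_self]

theorem rot_rev_zero (n : ℕ) : (finRotate (n + 1) * Fin.revPerm : Equiv.Perm (Fin (n + 1))) 0 = 0 := by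
  show (finRotate (n + 1) * Fin.revPerm : Equiv.Perm (Fin (n + 1))) (pos n 0) = pos n 0
  rw [Equiv.Perm.mul_apply, Fin.revPerm_apply, pos_rev n 0 (by omega), Nat.sub_zero, rot_last]

end PsiDef

theorem main_succ (n : ℕ) (z : Fin (n + 1) → ℝ) (hz : Function.Injective z)
    (hsep : ∀ i j, i ≠ j → 1 < |z i - z j|) (b : Fin (n + 1) → ℂ)
    (Q : Matrix (Fin (n + 1)) (Fin (n + 1)) ℂ)
    (hQ : ∀ i j, Q i j = if i = j then b i else (b j) / ((z i : ℂ) - (z j : ℂ) + 1))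
    (Qev : Fin (n + 1) → ℝ) (hdist : Function.Injective Qev)
    (hchar : Q.charpoly = ∏ i, (X - C ((Qev i : ℂ)))) (i : Fin (n + 1)) :
    ∃ r : ℝ, b i = (r : ℂ) := by
  set β : Fin (n + 1) → ℂ := fun a => b a / lC n z a with hβ
  set q : Fin (n + 1) → ℂ := fun a => (Qev a : ℂ) with hq
  have hqi : Function.Injective q := Complex.ofReal_injective.comp hdist
  have hX : (aeval (pX n z β 0) (∏ i, (X - C (q i)))) (fun _ => 1) = 0 := by
    have := X0_charpoly n z hz hsep b Q hQ
    rw [hchar] at this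
    exact this
  set ψ : Equiv.Perm (Fin (n + 1)) → TT n → ℂ := fun w τ => pf n z β q τ w with hψ
  have hpos := V_pos n z hz hsep ψ (by
    intro w i hi τ
    simp only [hψ]
    rw [← pf_s n z hz β q i hi, lS_apply]
    simp [lE]) (fun w => pf_ne n z β q hqi w)
  have hpi : ∀ w τ, q (τ 0) * ψ w τ =
      β (w 0) * ψ (w * finRotate (n + 1)) (τ ∘ finRotate (n + 1)) :=
    fun w τ => pf_pi n z hz β q hX τ w
  let w : Equiv.Perm (Fin (n + 1)) := Equiv.swap 0 i
  have hw : w 0 = i := Equiv.swap_apply_left _ _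
  set c := finRotate (n + 1) with hc
  set ρ : Equiv.Perm (Fin (n + 1)) := Fin.revPerm with hρ
  obtain ⟨r1, hr1, e1⟩ := hpos (w * c)
  obtain ⟨r2, hr2, e2⟩ := hpos w
  have f1 : ∑ τ : TT n, q (τ 0) * ψ w τ * star (ψ (w * c * ρ) (τ ∘ c ∘ ρ)) = β i * r1 := by
    rw [← e1, Finset.mul_sum, ← Equiv.sum_comp (Equiv.arrowCongr c.symm (Equiv.refl (Fin (n + 1))))
      (fun τ : TT n => β i * (ψ (w * c) τ * star (ψ (w * c * ρ) (τ ∘ ρ))))]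
    apply Finset.sum_congr rfl
    intro τ _
    rw [hpi, hw, mul_assoc]
    rfl
  have f2 : ∑ τ : TT n, q (τ 0) * ψ w τ * star (ψ (w * c * ρ) (τ ∘ c ∘ ρ)) = star (β i) * r2 := by
    rw [← e2, Finset.mul_sum]
    apply Finset.sum_congr rfl
    intro τ _
    have h1 := hpi (w * c * ρ) (τ ∘ c ∘ ρ)
    have z1 : (w * c * ρ) 0 = i := by
      rw [mul_assoc, Equiv.Perm.mul_apply, rot_rev_zero, hw]
    have z2 : (τ ∘ c ∘ ρ) 0 = τ 0 := congrArg τ (rot_rev_zero n)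
    have z3 : w * c * ρ * c = w * ρ := by
      rw [mul_assoc w, mul_assoc w, rot_rev_rot]
    have z4 : (τ ∘ c ∘ ρ) ∘ c = τ ∘ ρ := by
      funext x
      exact congrArg τ (DFunLike.congr_fun (rot_rev_rot n) x)
    rw [z1, z2, z3, z4] at h1
    have h2 := congrArg star h1
    rw [star_mul', star_mul'] at h2
    have h3 : star (q (τ 0)) = q (τ 0) := Complex.conj_ofReal _
    rw [h3] at h2
    linear_combination ψ w τ * h2
  have f3 : β i * r1 = star (β i) * r2 := f1.symm.trans f2
  have f4 := congrArg Complex.im f3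
  simp at f4
  have f5 : (β i).im = 0 := by
    have : (β i).im * (r1 + r2) = 0 := by linarith
    rcases mul_eq_zero.mp this with h | h
    · exact h
    · linarith
  have hCi : (lC n z i : ℂ) ≠ 0 := by exact_mod_cast lC_ne n z hsep i
  refine ⟨(β i).re * lC n z i, ?_⟩
  have f6 : β i = ((β i).re : ℂ) := Complex.ext rfl (by simp [f5])
  rw [Complex.ofReal_mul, ← f6]
  simp only [hβ]
  field_simp


/-- For distinct nonzero real `z i` with `|z i - z j| > 1` for `i ≠ j`: if the
matrix `Q^d` (diagonal `b i`, off-diagonal `b j/(z i - z j + 1)`) has `N`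
distinct nonzero real eigenvalues, then all `b i` are real. -/
theorem stmt_19 (N : ℕ) (z : Fin N → ℝ) (hzdist : Function.Injective z)
    (hz0 : ∀ i, z i ≠ 0) (hsep : ∀ i j, i ≠ j → 1 < |z i - z j|)
    (b : Fin N → ℂ) (Qd : Matrix (Fin N) (Fin N) ℂ)
    (hQd : ∀ i j, Qd i j = if i = j then b i
      else (b j) / ((z i : ℂ) - (z j : ℂ) + 1))
    (Qev : Fin N → ℝ) (hQevdist : Function.Injective Qev) (hQev0 : ∀ i, Qev i ≠ 0)
    (hchar : Matrix.charpoly Qd = ∏ i, (X - C ((Qev i : ℂ)))) :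
    ∀ i, ∃ r : ℝ, b i = (r : ℂ) := by
  rcases N with _ | n
  · exact fun i => i.elim0
  · exact fun i => main_succ n z hzdist hsep b Qd hQd Qev hQevdist hchar i
end
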